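/- arXiv:1808.09245 — 2 statements merged into one kernel-verified Lean document; each statement's English description precedes it below -/
import Mathlib

section
/- For all integers ℓ with 2 ≤ ℓ ≤ 5 and all integers k ≥ 1, the k-color Gallai-Ramsey number of the odd cycle satisfies gr_k(K_3 : C_{2ℓ+1}) = ℓ·2^k + 1. -/
open SimpleGraph

/-- The edge coloring `c` of the complete graph on `V` contains a rainbow triangle. -/
def HasRainbowTriangle {V α : Type*} (c : Sym2 V → α) : Prop :=
  ∃ x y z : V, x ≠ y ∧ x ≠ z ∧ y ≠ z ∧
    c s(x, y) ≠ c s(x, z) ∧ c s(x, y) ≠ c s(y, z) ∧ c s(x, z) ≠ c s(y, z)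

/-- The edge coloring `c` contains a copy of `H` all of whose edges have color `i`. -/
def HasMonoCopyIn {V W α : Type*} (c : Sym2 V → α) (H : SimpleGraph W) (i : α) : Prop :=
  ∃ f : W ↪ V, ∀ u v, H.Adj u v → c s(f u, f v) = i

/-- The edge coloring `c` contains a monochromatic copy of `H`. -/
def HasMonoCopy {V W α : Type*} (c : Sym2 V → α) (H : SimpleGraph W) : Prop :=
  ∃ i, HasMonoCopyIn c H i

/-- Every `k`-coloring of the edges of `K_n` contains a rainbow triangle or a
monochromatic copy of `H`. -/
def grProp {W : Type*} (k : ℕ) (H : SimpleGraph W) (n : ℕ) : Prop :=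
  ∀ c : Sym2 (Fin n) → Fin k, HasRainbowTriangle c ∨ HasMonoCopy c H

/-- The `k`-color Gallai–Ramsey number `gr_k(K₃ : H)`: the minimum `N` such that for all
`n ≥ N`, every `k`-coloring of the edges of `K_n` contains a rainbow triangle or a
monochromatic copy of `H`. -/
noncomputable def gr {W : Type*} (k : ℕ) (H : SimpleGraph W) : ℕ :=
  sInf {N | ∀ n, N ≤ n → grProp k H n}


section MCbasics
variable {V : Type*}

/-- A cycle of length `n` in the relation `R` with all vertices in `S`. -/
def MC (R : V → V → Prop) (S : Finset V) (n : ℕ) : Prop :=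
  ∃ (x : V) (l : List V), l.length + 1 = n ∧ (x :: l).Nodup ∧ (∀ y ∈ x :: l, y ∈ S) ∧
    (x :: (l ++ [x])).IsChain R

theorem MC.of_fun {R : V → V → Prop} {S : Finset V} {n : ℕ} (hn : 1 ≤ n) (g : ℕ → V)
    (hS : ∀ i, i < n → g i ∈ S) (hi : ∀ i j, i < j → j < n → g i ≠ g j)
    (hR : ∀ i, i + 1 < n → R (g i) (g (i + 1))) (hc : R (g (n - 1)) (g 0)) : MC R S n := by
  obtain ⟨m, rfl⟩ : ∃ m, n = m + 1 := ⟨n - 1, by omega⟩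
  refine ⟨g 0, (List.range m).map (fun i => g (i + 1)), by simp, ?_, ?_, ?_⟩
  · have : g 0 :: (List.range m).map (fun i => g (i + 1)) = (List.range (m + 1)).map g := by
      rw [List.range_succ_eq_map]; simp [Function.comp_def]
    rw [this]
    refine List.Nodup.map_on ?_ List.nodup_range
    intro x hx y hy hxy
    simp only [List.mem_range] at hx hy
    rcases lt_trichotomy x y with h | h | h
    · exact absurd hxy (hi _ _ h hy)
    · exact h
    · exact absurd hxy.symm (hi _ _ h hx)
  · intro y hy
    simp only [List.mem_cons, List.mem_map, List.mem_range] at hy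
    rcases hy with rfl | ⟨i, hi', rfl⟩
    · exact hS _ (by omega)
    · exact hS _ (by omega)
  · rw [List.isChain_iff_getElem]
    intro i hi'
    simp only [List.length_cons, List.length_append, List.length_map, List.length_range,
      List.length_nil] at hi'
    have key : ∀ (j : ℕ) (hj : j < (g 0 :: (List.map (fun i => g (i + 1)) (List.range m) ++ [g 0])).length),
        (g 0 :: (List.map (fun i => g (i + 1)) (List.range m) ++ [g 0]))[j] =
          if j ≤ m then g j else g 0 := by
      intro j hj
      cases j with
      | zero => simp
      | succ j =>
        simp only [List.getElem_cons_succ]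
        rw [List.getElem_append]
        simp only [List.length_map, List.length_range, List.getElem_map, List.getElem_range,
          List.getElem_singleton]
        split_ifs <;> first | rfl | omega
    rw [key, key]
    by_cases h : i + 1 ≤ m
    · rw [if_pos (by omega), if_pos h]; exact hR i (by omega)
    · have : i = m := by omega
      subst this
      simpa using hc

theorem MC.mono {R R' : V → V → Prop} {S S' : Finset V} {n : ℕ} (h : MC R S n)
    (hS : S ⊆ S') (hR : ∀ x ∈ S, ∀ y ∈ S, R x y → R' x y) : MC R' S' n := by
  obtain ⟨x, l, h1, h2, h3, h4⟩ := h
  refine ⟨x, l, h1, h2, fun y hy => hS (h3 y hy), ?_⟩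
  have h3' : ∀ y ∈ x :: (l ++ [x]), y ∈ S := by
    intro y hy
    apply h3
    simp only [List.mem_cons, List.mem_append, List.not_mem_nil, or_false] at hy ⊢
    tauto
  refine List.IsChain.imp_of_mem_imp ?_ h4
  intro a b ha hb hab
  exact hR a (h3' a ha) b (h3' b hb) hab

/-- Periodic parametrization of a cycle. -/
structure PCyc (R : V → V → Prop) (S : Finset V) (n : ℕ) (F : ℤ → V) : Prop where
  mem : ∀ i, F i ∈ S
  adj : ∀ i, R (F i) (F (i + 1))
  per : ∀ i, F (i + n) = F i
  inj : ∀ i j, F i = F j → (n : ℤ) ∣ i - j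

theorem PCyc.ne {R : V → V → Prop} {S : Finset V} {n : ℕ} {F : ℤ → V} (h : PCyc R S n F)
    {i j : ℤ} (h1 : i < j) (h2 : j < i + n) : F i ≠ F j := by
  intro he
  have := h.inj j i he.symm
  have h3 : j - i = 0 := Int.eq_zero_of_abs_lt_dvd this (by rw [abs_of_pos] <;> omega)
  omega

theorem MC.exists_pcyc {R : V → V → Prop} {S : Finset V} {n : ℕ} (h : MC R S n) :
    ∃ F, PCyc R S n F := by
  obtain ⟨x, l, h1, h2, h3, h4⟩ := h
  have hn : (0 : ℤ) < n := by omega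
  have hlen : (x :: l).length = n := by simpa using h1
  have hb : ∀ i : ℤ, (i % n).toNat < (x :: l).length := by
    intro i
    have h1 := Int.emod_nonneg i hn.ne'
    have h2 := Int.emod_lt_of_pos i hn
    omega
  refine ⟨fun i => (x :: l)[(i % n).toNat]'(hb i), ?_, ?_, ?_, ?_⟩
  · intro i; exact h3 _ (List.getElem_mem _)
  · intro i
    rw [List.isChain_iff_getElem] at h4
    have ha1 := Int.emod_nonneg i hn.ne'
    have ha2 := Int.emod_lt_of_pos i hn
    have hq := Int.emod_add_mul_ediv i n
    set a := (i % n).toNat with ha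
    have haa : (i % n) = (a : ℤ) := by omega
    have hlt : a + 1 < (x :: (l ++ [x])).length := by simp; omega
    have h5 := h4 a hlt
    have e1 : (x :: (l ++ [x]))[a]'(by omega) = (x :: l)[a]'(by omega) := by
      have : x :: (l ++ [x]) = (x :: l) ++ [x] := rfl
      simp only [this]
      rw [List.getElem_append_left]
    rw [e1] at h5
    convert h5 using 1
    by_cases hc : a + 1 < n
    · have : ((i + 1) % n).toNat = a + 1 := by
        have : (i + 1) % n = a + 1 := by
          rw [← hq, haa]
          rw [show (a : ℤ) + n * (i / n) + 1 = (a + 1 : ℤ) + n * (i / n) by ring]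
          rw [Int.add_mul_emod_self_left, Int.emod_eq_of_lt] <;> omega
        omega
      simp only [this]
      have : x :: (l ++ [x]) = (x :: l) ++ [x] := rfl
      simp only [this]
      rw [List.getElem_append_left]
    · have hae : a + 1 = n := by omega
      have : ((i + 1) % n).toNat = 0 := by
        have : (i + 1) % n = 0 := by
          rw [← hq, haa]
          rw [show (a : ℤ) + n * (i / n) + 1 = (a + 1 : ℤ) + n * (i / n) by ring]
          rw [Int.add_mul_emod_self_left, show ((a : ℤ) + 1) = n by omega, Int.emod_self]
        omega
      simp only [this]
      have : a = l.length := by omega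
      simp [this]
  · intro i; simp
  · intro i j hij
    have := (List.Nodup.getElem_inj_iff h2).1 hij
    have h1 := Int.emod_nonneg i hn.ne'
    have h2 := Int.emod_nonneg j hn.ne'
    exact Int.ModEq.dvd (show (j : ℤ) % n = i % n by omega)

theorem PCyc.shift {R : V → V → Prop} {S : Finset V} {n : ℕ} {F : ℤ → V} (h : PCyc R S n F)
    (c : ℤ) : PCyc R S n (fun i => F (i + c)) where
  mem i := h.mem _
  adj i := by
    have := h.adj (i + c)
    rwa [show i + c + 1 = i + 1 + c by ring] at this
  per i := by rw [show i + n + c = i + c + n by ring]; exact h.per _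
  inj i j hij := by
    have := h.inj _ _ hij
    rwa [show i + c - (j + c) = i - j by ring] at this

theorem MC.of_paths {R : V → V → Prop} {S : Finset V} {b b' : V} {l p : List V} {n : ℕ}
    (h1 : (b :: (l ++ [b'])).IsChain R) (h2 : (b' :: (p ++ [b])).IsChain R)
    (hn : (b :: (l ++ b' :: p)).Nodup) (hS : ∀ y ∈ b :: (l ++ b' :: p), y ∈ S)
    (hl : l.length + p.length + 2 = n) : MC R S n := by
  refine ⟨b, l ++ b' :: p, by simp; omega, hn, hS, ?_⟩
  have : b :: (l ++ b' :: p ++ [b]) = (b :: l) ++ b' :: (p ++ [b]) := by simp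
  rw [this, List.isChain_split]
  exact ⟨h1, h2⟩

end MCbasics


section Bip
variable {V : Type*} [DecidableEq V]

theorem bip_path {R : V → V → Prop} (j : ℕ) : ∀ (A B : Finset V) (b b' : V),
    Disjoint A B → (∀ a ∈ A, ∀ y ∈ B, R a y ∧ R y a) → j + 1 ≤ A.card → j + 2 ≤ B.card →
    b ∈ B → b' ∈ B → b ≠ b' →
    ∃ l : List V, l.length = 2 * j + 1 ∧ (b :: (l ++ [b'])).Nodup ∧ (b :: (l ++ [b'])).IsChain R ∧
      ∀ y ∈ l, y ∈ A ∪ B := by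
  induction j with
  | zero =>
    intro A B b b' hd hR hA hB hb hb' hne
    obtain ⟨a, ha⟩ := Finset.card_pos.1 (by omega : 0 < A.card)
    have h1 : a ≠ b := fun h => (Finset.disjoint_left.1 hd ha) (h ▸ hb)
    have h2 : a ≠ b' := fun h => (Finset.disjoint_left.1 hd ha) (h ▸ hb')
    refine ⟨[a], rfl, ?_, ?_, ?_⟩
    · simp [h1.symm, h2, hne]
    · simp [(hR a ha b hb).2, (hR a ha b' hb').1]
    · simp [ha]
  | succ j ih =>
    intro A B b b' hd hR hA hB hb hb' hne
    obtain ⟨a, ha⟩ := Finset.card_pos.1 (by omega : 0 < A.card)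
    have hc : 0 < ((B.erase b).erase b').card := by
      rw [Finset.card_erase_of_mem (by simp [hb', hne.symm]), Finset.card_erase_of_mem hb]; omega
    obtain ⟨c, hc⟩ := Finset.card_pos.1 hc
    simp only [Finset.mem_erase] at hc
    have hd' : Disjoint (A.erase a) (B.erase b) :=
      Finset.disjoint_of_subset_left (Finset.erase_subset _ _)
        (Finset.disjoint_of_subset_right (Finset.erase_subset _ _) hd)
    obtain ⟨l, h1, h2, h3, h4⟩ := ih (A.erase a) (B.erase b) c b' hd'
      (fun x hx y hy => hR x (Finset.mem_of_mem_erase hx) y (Finset.mem_of_mem_erase hy))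
      (by rw [Finset.card_erase_of_mem ha]; omega) (by rw [Finset.card_erase_of_mem hb]; omega)
      (by simp [hc]) (by simp [hb', hne.symm]) hc.1
    have hab : ∀ y ∈ B, a ≠ y := fun y hy h => (Finset.disjoint_left.1 hd ha) (h ▸ hy)
    have hal : ∀ y ∈ l, y ≠ a ∧ y ≠ b := by
      intro y hy
      have := h4 y hy
      simp only [Finset.mem_union, Finset.mem_erase] at this
      rcases this with h | h
      · exact ⟨h.1, fun e => (Finset.disjoint_left.1 hd h.2) (e ▸ hb)⟩
      · exact ⟨(hab y h.2).symm, h.1⟩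
    refine ⟨a :: c :: l, by simp; omega, ?_, ?_, ?_⟩
    · have e1 : a ∉ c :: (l ++ [b']) := by
        simp only [List.mem_cons, List.mem_append, List.not_mem_nil, or_false, not_or]
        exact ⟨hab c hc.2.2, fun h => (hal a h).1 rfl, hab b' hb'⟩
      have e2 : b ∉ a :: c :: (l ++ [b']) := by
        simp only [List.mem_cons, List.mem_append, List.not_mem_nil, or_false, not_or]
        exact ⟨(hab b hb).symm, hc.2.1.symm, fun h => (hal b h).2 rfl, hne⟩
      exact List.nodup_cons.2 ⟨e2, List.nodup_cons.2 ⟨e1, h2⟩⟩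
    · simp only [List.cons_append, List.isChain_cons_cons]
      exact ⟨(hR a ha b hb).2, (hR a ha c hc.2.2).1, h3⟩
    · intro y hy
      simp only [List.mem_cons] at hy
      rcases hy with rfl | rfl | hy
      · simp [ha]
      · simp [hc]
      · have := h4 y hy
        simp only [Finset.mem_union, Finset.mem_erase] at this ⊢
        tauto

/-- cycle from a bipartite path and an external path `p`. -/
theorem bip_cycle {R : V → V → Prop} {S A B : Finset V} {j n : ℕ} {b b' : V} {p : List V}
    (hd : Disjoint A B) (hR : ∀ a ∈ A, ∀ y ∈ B, R a y ∧ R y a) (hA : j + 1 ≤ A.card)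
    (hB : j + 2 ≤ B.card) (hb : b ∈ B) (hb' : b' ∈ B) (hne : b ≠ b')
    (hAS : A ⊆ S) (hBS : B ⊆ S)
    (hp : (b' :: (p ++ [b])).IsChain R) (hpn : p.Nodup) (hpd : ∀ y ∈ p, y ∉ A ∧ y ∉ B ∧ y ∈ S)
    (hn : 2 * j + 3 + p.length = n) : MC R S n := by
  obtain ⟨l, h1, h2, h3, h4⟩ := bip_path j A B b b' hd hR hA hB hb hb' hne
  have hmem : ∀ y ∈ b :: (l ++ [b']), y ∈ A ∪ B := by
    intro y hy
    simp only [List.mem_cons, List.mem_append, List.not_mem_nil, or_false] at hy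
    rcases hy with rfl | hy | rfl
    · simp [hb]
    · exact h4 y hy
    · simp [hb']
  refine MC.of_paths h3 hp ?_ ?_ (by omega)
  · have : b :: (l ++ b' :: p) = (b :: (l ++ [b'])) ++ p := by simp
    rw [this, List.nodup_append]
    refine ⟨h2, hpn, ?_⟩
    intro x hx y hy hxy
    subst hxy
    have := hmem x hx
    have := hpd x hy
    simp only [Finset.mem_union] at *
    tauto
  · intro y hy
    have : y ∈ (b :: (l ++ [b'])) ∨ y ∈ p := by
      simp only [List.mem_cons, List.mem_append, List.not_mem_nil, or_false] at hy ⊢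
      tauto
    rcases this with h | h
    · have := hmem y h
      simp only [Finset.mem_union] at this
      rcases this with h | h
      exacts [hAS h, hBS h]
    · exact (hpd y h).2.2

theorem KB {R : V → V → Prop} {S A B : Finset V} {l : ℕ} {b b' : V} (hl : 1 ≤ l)
    (hd : Disjoint A B) (hR : ∀ a ∈ A, ∀ y ∈ B, R a y ∧ R y a) (hA : l ≤ A.card)
    (hB : l + 1 ≤ B.card) (hb : b ∈ B) (hb' : b' ∈ B) (hne : b ≠ b')
    (hAS : A ⊆ S) (hBS : B ⊆ S) (hbb : R b' b) : MC R S (2 * l + 1) :=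
  bip_cycle (j := l - 1) (p := []) hd hR (by omega) (by omega) hb hb' hne hAS hBS
    (by simpa using hbb) (by simp) (by simp) (by simp; omega)

theorem KP {R : V → V → Prop} {S A B : Finset V} {l : ℕ} {a b s : V} (hl : 2 ≤ l)
    (hd : Disjoint A B) (hR : ∀ a ∈ A, ∀ y ∈ B, R a y ∧ R y a) (hA : l ≤ A.card)
    (hB : l ≤ B.card) (ha : a ∈ A) (hb : b ∈ B) (hsA : s ∉ A) (hsB : s ∉ B)
    (hAS : A ⊆ S) (hBS : B ⊆ S) (hs : s ∈ S) (h1 : R a s) (h2 : R s b) :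
    MC R S (2 * l + 1) := by
  obtain ⟨b', hb'⟩ := Finset.card_pos.1
    (by rw [Finset.card_erase_of_mem hb]; omega : 0 < (B.erase b).card)
  rw [Finset.mem_erase] at hb'
  have hab : a ∉ B := Finset.disjoint_left.1 hd ha
  refine bip_cycle (A := A.erase a) (B := B) (b := b) (b' := b') (j := l - 2) (p := [a, s])
    (Finset.disjoint_of_subset_left (Finset.erase_subset _ _) hd)
    (fun x hx y hy => hR x (Finset.mem_of_mem_erase hx) y hy)
    (by rw [Finset.card_erase_of_mem ha]; omega) (by omega) hb hb'.2 hb'.1.symm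
    ((Finset.erase_subset _ _).trans hAS) hBS ?_ ?_ ?_ (by simp; omega)
  · simp [h1, h2, (hR a ha b' hb'.2).2]
  · have : a ≠ s := fun h => hsA (h ▸ ha)
    simp [this]
  · simp [hab, hAS ha, hsB, hs, hsA]

theorem KP2 {R : V → V → Prop} {S A B : Finset V} {l : ℕ} {s s' o o' : V} (hl : 2 ≤ l)
    (hd : Disjoint A B) (hR : ∀ a ∈ A, ∀ y ∈ B, R a y ∧ R y a) (hA : l - 1 ≤ A.card)
    (hB : l ≤ B.card) (ho : o ∈ B) (ho' : o' ∈ B) (hoo : o ≠ o') (hss : s ≠ s')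
    (hsA : s ∉ A) (hsB : s ∉ B) (hsA' : s' ∉ A) (hsB' : s' ∉ B)
    (hAS : A ⊆ S) (hBS : B ⊆ S) (hs : s ∈ S) (hs' : s' ∈ S)
    (h1 : R s o) (h2 : R o' s') (h3 : R s' s) :
    MC R S (2 * l + 1) := by
  refine bip_cycle (A := A) (B := B) (b := o) (b' := o') (j := l - 2) (p := [s', s])
    hd hR (by omega) (by omega) ho ho' hoo hAS hBS ?_ ?_ ?_ (by simp; omega)
  · simp [h1, h2, h3]
  · simp [hss.symm]
  · simp [*]

/-- v–Y–Q–P–T–v -/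
theorem KP5 {R : V → V → Prop} {S Q P : Finset V} {l : ℕ} {v y t : V} (hl : 2 ≤ l)
    (hd : Disjoint P Q) (hR : ∀ a ∈ P, ∀ y ∈ Q, R a y ∧ R y a)
    (hQ : l ≤ Q.card) (hP : l ≤ P.card)
    (hQS : Q ⊆ S) (hPS : P ⊆ S) (hv : v ∈ S) (hy : y ∈ S) (ht : t ∈ S)
    (hvy : v ≠ y) (hvt : v ≠ t) (hyt : y ≠ t) (hvP : v ∉ P) (hvQ : v ∉ Q) (hyP : y ∉ P)
    (hyQ : y ∉ Q) (htP : t ∉ P) (htQ : t ∉ Q)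
    (h1 : R v y) (h2 : ∀ q ∈ Q, R y q) (h3 : ∀ p ∈ P, R p t) (h4 : R t v) :
    MC R S (2 * l + 1) := by
  obtain ⟨p, hp⟩ := Finset.card_pos.1 (by omega : 0 < P.card)
  obtain ⟨q, hq⟩ := Finset.card_pos.1 (by omega : 0 < Q.card)
  have hpQ : ∀ x ∈ Q, p ≠ x := fun x hx h => (Finset.disjoint_left.1 hd hp) (h ▸ hx)
  have ne1 : ∀ x ∈ P, x ≠ t := fun x hx h => htP (h ▸ hx)
  have ne2 : ∀ x ∈ P, x ≠ v := fun x hx h => hvP (h ▸ hx)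
  have ne3 : ∀ x ∈ P, x ≠ y := fun x hx h => hyP (h ▸ hx)
  have ne1' : ∀ x ∈ Q, x ≠ t := fun x hx h => htQ (h ▸ hx)
  have ne2' : ∀ x ∈ Q, x ≠ v := fun x hx h => hvQ (h ▸ hx)
  have ne3' : ∀ x ∈ Q, x ≠ y := fun x hx h => hyQ (h ▸ hx)
  rcases Nat.lt_or_ge l 3 with h | h
  · obtain rfl : l = 2 := by omega
    refine ⟨q, [p, t, v, y], rfl, ?_, ?_, ?_⟩
    · simp [(hpQ q hq).symm, ne1 p hp, ne2 p hp, ne3 p hp, ne1' q hq, ne2' q hq, ne3' q hq,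
        hvy, hvt.symm, hyt.symm]
    · simp [hPS hp, hQS hq, hv, hy, ht]
    · simp [(hR p hp q hq).2, h3 p hp, h4, h1, h2 q hq]
  · obtain ⟨q', hq'⟩ := Finset.card_pos.1
      (by rw [Finset.card_erase_of_mem hq]; omega : 0 < (Q.erase q).card)
    rw [Finset.mem_erase] at hq'
    refine bip_cycle (A := P.erase p) (B := Q) (b := q) (b' := q') (j := l - 3)
      (p := [p, t, v, y])
      (Finset.disjoint_of_subset_left (Finset.erase_subset _ _) hd)
      (fun x hx y hy => hR x (Finset.mem_of_mem_erase hx) y hy)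
      (by rw [Finset.card_erase_of_mem hp]; omega) (by omega) hq hq'.2 hq'.1.symm
      ((Finset.erase_subset _ _).trans hPS) hQS ?_ ?_ ?_ (by simp; omega)
    · simp [(hR p hp q' hq'.2).2, h3 p hp, h4, h1, h2 q hq]
    · simp [ne1 p hp, ne2 p hp, ne3 p hp, hvy, hvt.symm, hyt.symm]
    · have := Finset.disjoint_left.1 hd hp
      simp [*, hPS hp]

theorem clique_path {R : V → V → Prop} (j : ℕ) : ∀ (S : Finset V) (x y : V),
    (∀ a ∈ S, ∀ b ∈ S, a ≠ b → R a b) → x ∈ S → y ∈ S → x ≠ y → j + 2 ≤ S.card →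
    ∃ l : List V, l.length = j ∧ (x :: (l ++ [y])).Nodup ∧ (x :: (l ++ [y])).IsChain R ∧
      ∀ z ∈ l, z ∈ S := by
  induction j with
  | zero =>
    intro S x y hR hx hy hne hc
    exact ⟨[], rfl, by simp [hne], by simpa using hR x hx y hy hne, by simp⟩
  | succ j ih =>
    intro S x y hR hx hy hne hc
    have hc' : 0 < ((S.erase x).erase y).card := by
      rw [Finset.card_erase_of_mem (by simp [hy, hne.symm]), Finset.card_erase_of_mem hx]; omega
    obtain ⟨c, hc'⟩ := Finset.card_pos.1 hc'
    simp only [Finset.mem_erase] at hc'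
    obtain ⟨l, h1, h2, h3, h4⟩ := ih (S.erase x) c y
      (fun a ha b hb => hR a (Finset.mem_of_mem_erase ha) b (Finset.mem_of_mem_erase hb))
      (by simp [hc']) (by simp [hy, hne.symm]) hc'.1 (by rw [Finset.card_erase_of_mem hx]; omega)
    refine ⟨c :: l, by simp [h1], ?_, ?_, ?_⟩
    · refine List.nodup_cons.2 ⟨?_, h2⟩
      simp only [List.cons_append, List.mem_cons, List.mem_append, List.not_mem_nil, or_false, not_or]
      exact ⟨hc'.2.1.symm, fun h => (Finset.mem_erase.1 (h4 x h)).1 rfl, hne⟩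
    · simp only [List.cons_append, List.isChain_cons_cons]
      exact ⟨hR x hx c hc'.2.2 hc'.2.1.symm, h3⟩
    · intro z hz
      rcases List.mem_cons.1 hz with rfl | hz
      · exact hc'.2.2
      · exact Finset.mem_of_mem_erase (h4 z hz)

/-- Two cliques joined by two disjoint edges. -/
theorem two_cliques {R : V → V → Prop} {S E O : Finset V} {l : ℕ} {e e' o o' : V} (hl : 2 ≤ l)
    (hd : Disjoint E O) (hE : ∀ a ∈ E, ∀ b ∈ E, a ≠ b → R a b)
    (hO : ∀ a ∈ O, ∀ b ∈ O, a ≠ b → R a b) (hEc : l + 1 ≤ E.card) (hOc : l + 1 ≤ O.card)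
    (hES : E ⊆ S) (hOS : O ⊆ S) (he : e ∈ E) (he' : e' ∈ E) (ho : o ∈ O) (ho' : o' ∈ O)
    (hee : e ≠ e') (hoo : o ≠ o') (h1 : R e' o') (h2 : R o e) : MC R S (2 * l + 1) := by
  obtain ⟨p, p1, p2, p3, p4⟩ := clique_path (l - 1) E e e' hE he he' hee (by omega)
  obtain ⟨q, q1, q2, q3, q4⟩ := clique_path (l - 2) O o' o hO ho' ho hoo.symm (by omega)
  have pm : ∀ z ∈ e :: (p ++ [e']), z ∈ E := by
    intro z hz
    simp only [List.mem_cons, List.mem_append, List.not_mem_nil, or_false] at hz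
    rcases hz with rfl | hz | rfl
    exacts [he, p4 z hz, he']
  have qm : ∀ z ∈ o' :: (q ++ [o]), z ∈ O := by
    intro z hz
    simp only [List.mem_cons, List.mem_append, List.not_mem_nil, or_false] at hz
    rcases hz with rfl | hz | rfl
    exacts [ho', q4 z hz, ho]
  have e1 : e :: (p ++ e' :: (o' :: (q ++ [o]))) = (e :: (p ++ [e'])) ++ (o' :: (q ++ [o])) := by
    simp
  refine MC.of_paths (b := e) (b' := e') (l := p) (p := o' :: (q ++ [o])) p3 ?_ ?_ ?_
    (by simp; omega)
  · have : e' :: (o' :: (q ++ [o]) ++ [e]) = e' :: (o' :: q ++ o :: ([] ++ [e])) := by simp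
    rw [this, List.cons_append, List.isChain_cons_cons]
    refine ⟨h1, ?_⟩
    have : o' :: (q ++ o :: ([] ++ [e])) = (o' :: q) ++ o :: ([] ++ [e]) := by simp
    rw [this, List.isChain_split]
    exact ⟨q3, by simpa using h2⟩
  · rw [e1, List.nodup_append]
    refine ⟨p2, q2, ?_⟩
    intro x hx y hy hxy
    subst hxy
    exact Finset.disjoint_left.1 hd (pm x hx) (qm x hy)
  · rw [e1]
    intro y hy
    rcases List.mem_append.1 hy with h | h
    exacts [hES (pm y h), hOS (qm y h)]

end Bip


section MLsec
variable {V : Type*} [DecidableEq V]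

theorem ML {ι : Type*} {R : V → V → Prop} {S : Finset V} {l : ℕ} (κ : V → ι) (hl : 1 ≤ l)
    (hR : ∀ x ∈ S, ∀ y ∈ S, κ x ≠ κ y → R x y)
    (hf : ∀ T ⊆ S, (∀ x ∈ T, ∀ y ∈ T, κ x = κ y) → T.card ≤ l)
    (hS : 2 * l + 1 ≤ S.card) : MC R S (2 * l + 1) := by
  classical
  obtain ⟨_, _⟩ := exists_wellFoundedLT ι
  obtain ⟨T, hTS, hT⟩ := Finset.exists_subset_card_eq hS
  let e : Fin (2 * l + 1) ≃ T := (Finset.equivFinOfCardEq hT).symm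
  let f : Fin (2 * l + 1) → ι := fun i => κ (e i)
  have hmono : Monotone (f ∘ Tuple.sort f) := Tuple.monotone_sort f
  let a : ℕ → V := fun i => e (Tuple.sort f (Fin.ofNat (2 * l + 1) i))
  have haS : ∀ i, a i ∈ S := fun i => hTS (e _).2
  have hainj : ∀ i j, i < 2 * l + 1 → j < 2 * l + 1 → a i = a j → i = j := by
    intro i j hi hj h
    have h1 := (Tuple.sort f).injective (e.injective (Subtype.ext h))
    have := congrArg Fin.val h1
    simpa [Fin.ofNat, Nat.mod_eq_of_lt hi, Nat.mod_eq_of_lt hj] using this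
  have hamono : ∀ i j, i ≤ j → j < 2 * l + 1 → κ (a i) ≤ κ (a j) := by
    intro i j hij hj
    apply hmono
    rw [Fin.le_def]
    simp [Fin.ofNat, Nat.mod_eq_of_lt hj, Nat.mod_eq_of_lt (lt_of_le_of_lt hij hj), hij]
  have hne : ∀ i j, i + l ≤ j → j < 2 * l + 1 → κ (a i) ≠ κ (a j) := by
    intro i j hij hj he
    have hcard := hf ((Finset.Icc i j).image a) (by
      intro x hx
      obtain ⟨m, _, rfl⟩ := Finset.mem_image.1 hx
      exact haS m) (by
      have : ∀ x ∈ (Finset.Icc i j).image a, κ x = κ (a i) := by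
        intro x hx
        obtain ⟨m, hm, rfl⟩ := Finset.mem_image.1 hx
        rw [Finset.mem_Icc] at hm
        apply le_antisymm
        · rw [he]; exact hamono _ _ hm.2 hj
        · exact hamono _ _ hm.1 (by omega)
      intro x hx y hy
      rw [this x hx, this y hy])
    rw [Finset.card_image_of_injOn, Nat.card_Icc] at hcard
    · omega
    · intro x hx y hy hxy
      simp only [Finset.coe_Icc, Set.mem_Icc] at hx hy
      exact hainj x y (by omega) (by omega) hxy
  have hRa : ∀ i j, i < 2 * l + 1 → j < 2 * l + 1 → (i + l ≤ j ∨ j + l ≤ i) → R (a i) (a j) := by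
    intro i j hi hj h
    apply hR _ (haS _) _ (haS _)
    rcases h with h | h
    · exact hne i j h hj
    · exact (hne j i h hi).symm
  let p : ℕ → ℕ := fun m => if m = 0 then 0 else if m % 2 = 1 then l - m / 2 else 2 * l + 1 - m / 2
  refine MC.of_fun (by omega) (fun m => a (p m)) (fun i _ => haS _) ?_ ?_ ?_
  · intro i j hij hj h
    have := hainj _ _ (by simp only [p]; split_ifs <;> omega)
      (by simp only [p]; split_ifs <;> omega) h
    simp only [p] at this
    split_ifs at this <;> omega
  · intro i hi
    apply hRa
    · simp only [p]; split_ifs <;> omega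
    · simp only [p]; split_ifs <;> omega
    · simp only [p]; split_ifs <;> first | contradiction | omega
  · apply hRa
    · simp only [p]; split_ifs <;> omega
    · simp only [p]; split_ifs <;> omega
    · simp only [p]; split_ifs <;> omega

end MLsec


set_option linter.unusedSectionVars false
set_option linter.unusedVariables false
set_option linter.unnecessarySimpa false

section RamA
variable {V : Type*} [DecidableEq V]

theorem chain_map_range {R : V → V → Prop} (z : ℕ → V) (N : ℕ) (hN : 1 ≤ N)
    (h : ∀ i, i < N → R (z i) (z (i + 1))) :
    (z 0 :: ((List.range (N - 1)).map (fun i => z (i + 1)) ++ [z N])).IsChain R := by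
  have e : z 0 :: ((List.range (N - 1)).map (fun i => z (i + 1)) ++ [z N])
      = (List.range (N + 1)).map z := by
    obtain ⟨M, rfl⟩ : ∃ M, N = M + 1 := ⟨N - 1, by omega⟩
    conv_rhs => rw [List.range_succ_eq_map, List.range_succ]
    simp [Function.comp_def]
  rw [e, List.isChain_map, List.isChain_iff_getElem]
  intro i hi
  simp only [List.length_range] at hi
  simpa using h i (by omega)

theorem LA {R B : V → V → Prop} (hRs : ∀ x y, R x y → R y x) (hBs : ∀ x y, B x y → B y x)
    {S : Finset V} (hT : ∀ x ∈ S, ∀ y ∈ S, x ≠ y → R x y ∨ B x y)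
    {l : ℕ} (hl : 1 ≤ l) {x y : V} {M L : List V}
    (h1 : (y :: (M ++ [x])).IsChain R) (h2 : (y :: (L ++ [x])).IsChain B)
    (hn : (y :: (M ++ x :: L)).Nodup) (hS : ∀ v ∈ y :: (M ++ x :: L), v ∈ S)
    (hM : 2 * l ≤ M.length) (hML : M.length + L.length = 4 * l - 1) :
    ∃ t, 2 * l + 1 ≤ t ∧ (MC R S t ∨ MC B S t) := by
  set P := y :: (M ++ [x]) with hP
  have hPl : P.length = M.length + 2 := by simp [hP]
  obtain ⟨a, ha⟩ : ∃ a, a = M.length + 1 := ⟨_, rfl⟩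
  have hspl : y :: (M ++ x :: L) = P ++ L := by simp [hP]
  rw [hspl] at hn hS
  have hPn : P.Nodup := (List.nodup_append.1 hn).1
  have hLn : L.Nodup := (List.nodup_append.1 hn).2.1
  have hPL := (List.nodup_append.1 hn).2.2
  let r : ℕ → V := fun i => P.getD i y
  have hr : ∀ i (hi : i < P.length), r i = P[i] := fun i hi => by
    simp [r, List.getD_eq_getElem?_getD, hi]
  have hrP : ∀ i, i ≤ a → r i ∈ P := fun i hi => by
    rw [hr i (by omega)]; exact List.getElem_mem _
  have hrinj : ∀ i j, i ≤ a → j ≤ a → r i = r j → i = j := by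
    intro i j hi hj h
    rw [hr i (by omega), hr j (by omega)] at h
    exact (List.Nodup.getElem_inj_iff hPn).1 h
  have hrR : ∀ i, i < a → R (r i) (r (i + 1)) := by
    intro i hi
    rw [hr i (by omega), hr (i + 1) (by omega)]
    exact List.isChain_iff_getElem.1 h1 i (by omega)
  have hr0 : r 0 = y := by rw [hr 0 (by omega)]; simp [hP]
  have hra : r a = x := by rw [hr a (by omega)]; simp [hP, ha]
  by_cases hex : ∃ i j, i + 2 * l ≤ j ∧ j ≤ a ∧ R (r j) (r i)
  · obtain ⟨i, j, hij, hj, hR⟩ := hex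
    refine ⟨j - i + 1, by omega, Or.inl ?_⟩
    refine MC.of_fun (by omega) (fun m => r (i + m)) ?_ ?_ ?_ ?_
    · intro m hm; exact hS _ (List.mem_append_left _ (hrP _ (by omega)))
    · intro m m' h h' he
      have := hrinj _ _ (by omega) (by omega) he
      omega
    · intro m hm; exact hrR _ (by omega)
    · simp only [add_zero]
      rw [show i + (j - i + 1 - 1) = j by omega]; exact hR
  · push Not at hex
    have hB : ∀ i j, i + 2 * l ≤ j → j ≤ a → B (r j) (r i) ∧ B (r i) (r j) := by
      intro i j hij hj
      have := hT _ (hS _ (List.mem_append_left _ (hrP j (by omega)))) _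
        (hS _ (List.mem_append_left _ (hrP i (by omega))))
        (fun h => by have := hrinj _ _ (by omega) (by omega) h; omega)
      rcases this with h | h
      · exact absurd h (hex i j hij hj)
      · exact ⟨h, hBs _ _ h⟩
    let p : ℕ → ℕ := fun m => if m % 2 = 0 then m / 2 else 2 * l + 1 + m / 2
    obtain ⟨N, hN⟩ : ∃ N, N = 2 * (a - 2 * l) - 1 := ⟨_, rfl⟩
    have hpa : ∀ m, m ≤ N → p m ≤ a := by
      intro m hm; simp only [p]; split_ifs <;> omega
    have hp0 : p 0 = 0 := by simp [p]
    have hpN : p N = a := by simp only [p]; split_ifs <;> omega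
    have hpinj : ∀ m m', m ≤ N → m' ≤ N → p m = p m' → m = m' := by
      intro m m' hm hm' h
      simp only [p] at h
      split_ifs at h <;> omega
    have hch := chain_map_range (R := B) (fun m => r (p m)) N (by omega) (by
      intro i hi
      rcases Nat.mod_two_eq_zero_or_one i with h | h
      · refine (hB _ _ ?_ (hpa _ hi)).2
        simp only [p]; split_ifs <;> omega
      · refine (hB _ _ ?_ (hpa _ hi.le)).1
        simp only [p]; split_ifs <;> omega)
    simp only [hp0, hpN, hr0, hra] at hch
    refine ⟨N - 1 + L.length + 2, by omega, Or.inr ?_⟩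
    have hl2 : ∀ v ∈ y :: ((List.range (N - 1)).map (fun i => r (p (i + 1))) ++ [x]), v ∈ P := by
      intro v hv
      simp only [List.mem_cons, List.mem_append, List.mem_map, List.mem_range, List.not_mem_nil,
        or_false] at hv
      rcases hv with rfl | ⟨i, hi, rfl⟩ | rfl
      · simp [hP]
      · exact hrP _ (hpa _ (by omega))
      · simp [hP]
    have hsp2 : y :: ((List.range (N - 1)).map (fun i => r (p (i + 1))) ++ x :: L.reverse)
      = (y :: ((List.range (N - 1)).map (fun i => r (p (i + 1))) ++ [x])) ++ L.reverse := by simp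
    refine MC.of_paths hch (p := L.reverse) ?_ ?_ ?_ (by simp)
    · have : x :: (L.reverse ++ [y]) = (y :: (L ++ [x])).reverse := by simp
      rw [this, List.isChain_reverse]
      exact h2.imp (fun a b h => hBs _ _ h)
    · rw [hsp2, List.nodup_append]
      refine ⟨?_, List.nodup_reverse.2 hLn, ?_⟩
      · have e : y :: ((List.range (N - 1)).map (fun i => r (p (i + 1))) ++ [x])
            = (List.range (N + 1)).map (fun m => r (p m)) := by
          obtain ⟨N', hN'⟩ : ∃ M, N = M + 1 := ⟨N - 1, by omega⟩
          rw [← hr0, ← hra, ← hpN, ← hp0, hN']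
          conv_rhs => rw [List.range_succ_eq_map, List.range_succ]
          simp [Function.comp_def, hp0]
        rw [e]
        refine List.Nodup.map_on ?_ List.nodup_range
        intro m hm m' hm' h
        simp only [List.mem_range] at hm hm'
        exact hpinj _ _ (by omega) (by omega)
          (hrinj _ _ (hpa _ (by omega)) (hpa _ (by omega)) h)
      · intro u hu v hv
        exact hPL u (hl2 u hu) v (List.mem_reverse.1 hv)
    · rw [hsp2]
      intro v hv
      rcases List.mem_append.1 hv with h | h
      · exact hS v (List.mem_append_left _ (hl2 v h))
      · exact hS v (List.mem_append_right _ (List.mem_reverse.1 h))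

theorem insert_build {R B : V → V → Prop} (hRs : ∀ x y, R x y → R y x)
    (hBs : ∀ x y, B x y → B y x)
    {S : Finset V} (hT : ∀ x ∈ S, ∀ y ∈ S, x ≠ y → R x y ∨ B x y) (W : List V) :
    W ≠ [] → W.Nodup → (∀ v ∈ W, v ∈ S) →
    ∃ (y : V) (M L : List V) (x : V), (y :: M).IsChain R ∧ x ∈ (y :: M).getLast? ∧
      (L = [] ∨ (y :: (L ++ [x])).IsChain B) ∧ List.Perm W (y :: (M ++ L)) := by
  induction W with
  | nil => intro h; exact absurd rfl h
  | cons v W ih =>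
    intro _ hn hS
    by_cases hW : W = []
    · subst hW
      exact ⟨v, [], [], v, by simp, by simp, by simp, by simp⟩
    obtain ⟨y, M, L, x, h1, h2, h3, h4⟩ := ih hW (List.nodup_cons.1 hn).2
      (fun u hu => hS u (List.mem_cons_of_mem _ hu))
    have hvS : v ∈ S := hS v (by simp)
    have hvn : v ∉ W := (List.nodup_cons.1 hn).1
    have hin : ∀ u ∈ y :: (M ++ L), R v u ∨ B v u := by
      intro u hu
      have hu' : u ∈ W := h4.mem_iff.2 hu
      exact hT v hvS u (hS u (List.mem_cons_of_mem _ hu')) (fun h => hvn (h ▸ hu'))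
    have h4' : List.Perm (v :: W) (v :: y :: (M ++ L)) := List.Perm.cons _ h4
    have hxm : x ∈ y :: (M ++ L) := by
      have := List.mem_of_mem_getLast? h2
      simp only [List.mem_cons, List.mem_append] at this ⊢
      tauto
    cases L with
    | nil =>
      rcases hin y (by simp) with hy | hy
      · refine ⟨v, y :: M, [], x, ?_, ?_, Or.inl rfl, h4'⟩
        · rw [List.isChain_cons_cons]; exact ⟨hy, h1⟩
        · simpa using h2
      · rcases hin x hxm with hx | hx
        · refine ⟨y, M ++ [v], [], v, ?_, ?_, Or.inl rfl, ?_⟩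
          · rw [← List.cons_append, List.isChain_append]
            refine ⟨h1, by simp, ?_⟩
            intro a ha b hb
            simp only [List.head?_cons, Option.mem_def, Option.some.injEq] at hb
            subst hb
            have : a = x := Option.some_injective _ (Option.mem_def.1 ha ▸ Option.mem_def.1 h2)
            subst this
            exact hRs _ _ hx
          · rw [← List.cons_append, List.getLast?_append]; simp
          · refine h4'.trans ?_
            simp only [List.append_nil]
            have := (List.perm_append_comm (l₁ := [v]) (l₂ := y :: M))
            simpa using this
        · refine ⟨y, M, [v], x, h1, h2, Or.inr ?_, ?_⟩
          · simp [hx, hBs _ _ hy]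
          · refine h4'.trans ?_
            have := (List.perm_append_comm (l₁ := [v]) (l₂ := y :: M))
            simpa using this
    | cons b bs =>
      have hBc : (y :: (b :: bs ++ [x])).IsChain B := by
        rcases h3 with h | h
        · exact absurd h (by simp)
        · exact h
      have hBc' : B y b ∧ (b :: (bs ++ [x])).IsChain B := by
        rw [List.cons_append, List.isChain_cons_cons] at hBc; exact hBc
      have hvb := hin b (by simp)
      rcases hin y (by simp) with hy | hy
      · rcases hvb with hb | hb
        · refine ⟨b, v :: y :: M, bs, x, ?_, ?_, Or.inr hBc'.2, ?_⟩
          · simp only [List.isChain_cons_cons]; exact ⟨hRs _ _ hb, hy, h1⟩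
          · simpa using h2
          · refine h4'.trans ?_
            have := (List.perm_append_comm (l₁ := v :: y :: M) (l₂ := [b])).append_right bs
            simpa using this
        · refine ⟨v, y :: M, b :: bs, x, ?_, ?_, Or.inr ?_, h4'⟩
          · simp only [List.isChain_cons_cons]; exact ⟨hy, h1⟩
          · simpa using h2
          · rw [List.cons_append, List.isChain_cons_cons]; exact ⟨hb, hBc'.2⟩
      · cases M with
        | nil =>
          obtain rfl : y = x := by simpa using h2
          rcases hvb with hb | hb
          · refine ⟨b, [v], bs ++ [y], v, ?_, by simp, Or.inr ?_, ?_⟩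
            · simp [hRs _ _ hb]
            · have : b :: (bs ++ [y] ++ [v]) = (b :: bs) ++ y :: ([] ++ [v]) := by simp
              rw [this, List.isChain_split]
              exact ⟨hBc'.2, by simpa using hBs _ _ hy⟩
            · refine h4'.trans ?_
              have := (List.perm_append_comm (l₁ := [v, y]) (l₂ := b :: bs))
              simp only [List.nil_append]
              refine List.Perm.trans this ?_
              simp only [List.cons_append]
              refine List.Perm.cons _ ?_
              have := (List.perm_append_comm (l₁ := bs) (l₂ := [v])).append_right [y]
              simpa using this
          · refine ⟨y, [], v :: b :: bs, y, h1, h2, Or.inr ?_, ?_⟩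
            · simp only [List.cons_append, List.isChain_cons_cons]
              exact ⟨hBs _ _ hy, hb, hBc'.2⟩
            · refine h4'.trans ?_
              exact List.Perm.swap _ _ _
        | cons y' M' =>
          have h1' : R y y' ∧ (y' :: M').IsChain R := by
            rw [List.isChain_cons_cons] at h1; exact h1
          have h2' : x ∈ (y' :: M').getLast? := by simpa using h2
          rcases hin y' (by simp) with hy' | hy'
          · refine ⟨v, y' :: M', y :: b :: bs, x, ?_, ?_, Or.inr ?_, ?_⟩
            · simp only [List.isChain_cons_cons]; exact ⟨hy', h1'.2⟩
            · simpa using h2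
            · simp only [List.cons_append, List.isChain_cons_cons]
              exact ⟨hy, hBc'.1, hBc'.2⟩
            · refine h4'.trans (List.Perm.cons _ ?_)
              have := (List.perm_append_comm (l₁ := [y]) (l₂ := y' :: M')).append_right (b :: bs)
              simpa using this
          · refine ⟨y', M', v :: y :: b :: bs, x, h1'.2, h2', Or.inr ?_, ?_⟩
            · simp only [List.cons_append, List.isChain_cons_cons]
              exact ⟨hBs _ _ hy', hy, hBc'.1, hBc'.2⟩
            · refine h4'.trans ?_
              have := (List.perm_append_comm (l₁ := [v, y]) (l₂ := y' :: M')).append_right (b :: bs)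
              simpa using this

theorem ramseyA {R B : V → V → Prop} (hRs : ∀ x y, R x y → R y x)
    (hBs : ∀ x y, B x y → B y x)
    {S : Finset V} (hT : ∀ x ∈ S, ∀ y ∈ S, x ≠ y → R x y ∨ B x y) {l : ℕ} (hl : 1 ≤ l)
    (hS : 4 * l + 1 ≤ S.card) : ∃ t, 2 * l + 1 ≤ t ∧ (MC R S t ∨ MC B S t) := by
  obtain ⟨T, hTS, hTc⟩ := Finset.exists_subset_card_eq hS
  obtain ⟨y, M, L, x, h1, h2, h3, h4⟩ := insert_build hRs hBs hT T.toList
    (by intro h; have := congrArg List.length h; simp at this; simp [this] at hTc)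
    T.nodup_toList (fun v hv => hTS (by simpa using hv))
  have hn : (y :: (M ++ L)).Nodup := h4.nodup_iff.1 T.nodup_toList
  have hm : ∀ v ∈ y :: (M ++ L), v ∈ S := fun v hv =>
    hTS (by simpa using h4.mem_iff.2 hv)
  have hlen : M.length + L.length = 4 * l := by
    have := h4.length_eq
    simp at this; omega
  rcases List.eq_nil_or_concat M with rfl | ⟨M, x', rfl⟩
  · obtain rfl : y = x := by simpa using h2
    refine ⟨4 * l + 1, by omega, Or.inr ⟨y, L, by simp at hlen; omega, by simpa using hn,
      by simpa using hm, ?_⟩⟩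
    rcases h3 with rfl | h3
    · simp at hlen; omega
    · exact h3
  · obtain rfl : x' = x := by simpa [List.getLast?_cons] using h2
    simp only [List.concat_eq_append] at *
    have hx'y : x' ∈ S ∧ y ∈ S ∧ x' ≠ y := by
      refine ⟨hm _ (by simp), hm _ (by simp), ?_⟩
      rintro rfl
      simp at hn
    have hlen' : M.length + 1 + L.length = 4 * l := by simpa using hlen
    have hn' : (y :: (M ++ x' :: L)).Nodup := by simpa using hn
    have hm' : ∀ v ∈ y :: (M ++ x' :: L), v ∈ S := by simpa using hm
    have key : (∃ t, 2 * l + 1 ≤ t ∧ (MC R S t ∨ MC B S t)) ∨ (y :: (L ++ [x'])).IsChain B := by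
      rcases h3 with rfl | h3
      · rcases hT x' hx'y.1 y hx'y.2.1 hx'y.2.2 with h | h
        · left
          refine ⟨4 * l + 1, by omega, Or.inl ?_⟩
          refine MC.of_paths (b := y) (b' := x') (l := M) (p := []) h1 (by simpa using h) hn' hm' ?_
          simp at hlen' ⊢; omega
        · right
          simpa using hBs _ _ h
      · exact Or.inr h3
    rcases key with h | h3
    · exact h
    by_cases hML : 2 * l ≤ M.length
    · exact LA hRs hBs hT hl h1 h3 hn' hm' hML (by omega)
    · have hp : List.Perm (y :: (M ++ x' :: L)) (y :: (L ++ x' :: M)) := by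
        refine List.Perm.cons _ ?_
        refine List.perm_append_comm.trans ?_
        simp only [List.cons_append]
        exact List.perm_middle.symm
      obtain ⟨t, ht, h⟩ := LA hBs hRs (fun x hx y hy hxy => (hT x hx y hy hxy).symm) hl h3 h1
        (hp.nodup_iff.1 hn') (fun v hv => hm' v (hp.mem_iff.2 hv)) (by omega) (by omega)
      exact ⟨t, ht, h.symm⟩

end RamA


set_option linter.unusedSectionVars false
set_option linter.unusedVariables false
set_option linter.unnecessarySimpa false

section RamB
variable {V : Type*} [DecidableEq V]

theorem chord_short {R : V → V → Prop} {S : Finset V} {t d : ℕ} {F : ℤ → V} (hF : PCyc R S t F)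
    (i : ℤ) (hd : 1 ≤ d) (hdt : d < t) (h : R (F i) (F (i + d))) :
    MC R S (t + 1 - d) := by
  refine MC.of_fun (by omega) (fun m => F (i + d + m)) (fun m _ => hF.mem _) ?_ ?_ ?_
  · intro m m' h1 h2
    exact hF.ne (by omega) (by omega)
  · intro m hm
    have := hF.adj (i + d + m)
    rwa [show i + d + m + 1 = i + d + ((m + 1 : ℕ) : ℤ) by push_cast; ring] at this
  · have : i + d + ((t + 1 - d - 1 : ℕ) : ℤ) = i + t := by omega
    simp only [this, hF.per]
    simpa using h

theorem RB1 {R B : V → V → Prop} (hBs : ∀ x y, B x y → B y x)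
    {S : Finset V} (hT : ∀ x ∈ S, ∀ y ∈ S, x ≠ y → R x y ∨ B x y)
    {l t : ℕ} {F : ℤ → V} (hl : 2 ≤ l) (hF : PCyc R S t F) (ht : 2 * l + 3 ≤ t)
    (h1 : ¬ MC R S (t - 1)) (h2 : ¬ MC R S (t - 2)) : MC B S (2 * l + 1) := by
  have c2 : ∀ i, B (F i) (F (i + 2)) := by
    intro i
    rcases hT _ (hF.mem i) _ (hF.mem (i + 2)) (hF.ne (by omega) (by omega)) with h | h
    · exact absurd (chord_short (d := 2) hF i (by omega) (by omega) h) h1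
    · exact h
  have c3 : ∀ i, B (F i) (F (i + 3)) := by
    intro i
    rcases hT _ (hF.mem i) _ (hF.mem (i + 3)) (hF.ne (by omega) (by omega)) with h | h
    · exact absurd (chord_short (d := 3) hF i (by omega) (by omega) h) h2
    · exact h
  have c2' : ∀ i j : ℤ, j = i + 2 → B (F i) (F j) := by rintro i j rfl; exact c2 i
  have c3' : ∀ i j : ℤ, j = i + 3 → B (F i) (F j) := by rintro i j rfl; exact c3 i
  let p : ℕ → ℤ := fun j => if j ≤ l + 1 then 2 * (j : ℤ) else 4 * (l : ℤ) + 3 - 2 * (j : ℤ)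
  have hp : ∀ j, p j = if j ≤ l + 1 then 2 * (j : ℤ) else 4 * (l : ℤ) + 3 - 2 * (j : ℤ) :=
    fun j => rfl
  refine MC.of_fun (by omega) (fun j => F (p j)) (fun _ _ => hF.mem _) ?_ ?_ ?_
  · intro m m' h1 h2
    have a1 := hp m
    have a2 := hp m'
    rcases lt_trichotomy (p m) (p m') with h | h | h
    · refine hF.ne h ?_
      split_ifs at a1 a2 <;> omega
    · split_ifs at a1 a2 <;> omega
    · refine (hF.ne h ?_).symm
      split_ifs at a1 a2 <;> omega
  · intro i hi
    have a1 := hp i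
    have a2 := hp (i + 1)
    rcases lt_trichotomy i (l + 1) with h | h | h
    · exact c2' _ _ (by split_ifs at a1 a2 <;> push_cast at * <;> omega)
    · exact hBs _ _ (c3' _ _ (by split_ifs at a1 a2 <;> push_cast at * <;> omega))
    · exact hBs _ _ (c2' _ _ (by split_ifs at a1 a2 <;> push_cast at * <;> omega))
  · have a1 := hp 0
    have a2 := hp (2 * l + 1 - 1)
    rw [if_pos (by omega)] at a1
    rw [if_neg (by omega)] at a2
    exact hBs _ _ (c3' _ _ (by omega))

theorem RB2 {R B : V → V → Prop} (hRs : ∀ x y, R x y → R y x) (hBs : ∀ x y, B x y → B y x)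
    {S : Finset V} (hT : ∀ x ∈ S, ∀ y ∈ S, x ≠ y → R x y ∨ B x y)
    {h : ℕ} {F : ℤ → V} (hh : 3 ≤ h) (hF : PCyc R S (2 * h) F)
    (h1 : ¬ MC R S (2 * h - 1)) (h2 : ¬ MC B S (2 * h - 1)) (i : ℤ) (e : ℕ) (he : 1 ≤ e)
    (he' : e < h) : B (F i) (F (i + 2 * e)) := by
  have c2 : ∀ i j : ℤ, j = i + 2 → B (F i) (F j) := by
    rintro i j rfl
    rcases hT _ (hF.mem i) _ (hF.mem (i + 2)) (hF.ne (by omega) (by omega)) with h | h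
    · exact absurd (chord_short (d := 2) hF i (by omega) (by omega) h) h1
    · exact h
  by_cases hd1 : e = 1
  · subst hd1; exact c2 _ _ (by simp)
  by_cases hd2 : e = h - 1
  · apply hBs
    have : F i = F (i + (2 * h : ℕ)) := (hF.per i).symm
    rw [this]
    exact c2 _ _ (by push_cast; omega)
  -- crossing lemma
  have cr : ∀ (i : ℤ) (d : ℕ), 1 ≤ d → d + 3 ≤ 2 * h → R (F i) (F (i + d)) →
      R (F (i + 1)) (F (i + d + 2)) → False := by
    intro i d d1 d2 r1 r2
    apply h1
    let p : ℕ → ℤ := fun m => if m = 0 then i else if m ≤ d then i + (d : ℤ) + 1 - (m : ℤ)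
      else i + 1 + (m : ℤ)
    have hp : ∀ m, p m = if m = 0 then i else if m ≤ d then i + (d : ℤ) + 1 - (m : ℤ)
      else i + 1 + (m : ℤ) := fun m => rfl
    have adj : ∀ a b : ℤ, b = a + 1 → R (F a) (F b) := by rintro a b rfl; exact hF.adj a
    refine MC.of_fun (by omega) (fun j => F (p j)) (fun _ _ => hF.mem _) ?_ ?_ ?_
    · intro m m' h1 h2
      have a1 := hp m
      have a2 := hp m'
      rcases lt_trichotomy (p m) (p m') with h | h | h
      · refine hF.ne h ?_
        split_ifs at a1 a2 <;> omega
      · split_ifs at a1 a2 <;> omega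
      · refine (hF.ne h ?_).symm
        split_ifs at a1 a2 <;> omega
    · intro m hm
      have a1 := hp m
      have a2 := hp (m + 1)
      by_cases m0 : m = 0
      · have e1 : p m = i := by rw [a1, if_pos m0]
        have e2 : p (m + 1) = i + d := by
          split_ifs at a2 <;> push_cast at * <;> omega
        simp only [e1, e2]; exact r1
      by_cases m1 : m < d
      · exact hRs _ _ (adj _ _ (by split_ifs at a1 a2 <;> push_cast at * <;> omega))
      by_cases m2 : m = d
      · have e1 : p m = i + 1 := by split_ifs at a1 <;> push_cast at * <;> omega
        have e2 : p (m + 1) = i + d + 2 := by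
          split_ifs at a2 <;> push_cast at * <;> omega
        simp only [e1, e2]; exact r2
      · exact adj _ _ (by split_ifs at a1 a2 <;> push_cast at * <;> omega)
    · have a1 := hp 0
      have a2 := hp (2 * h - 1 - 1)
      have : F (p 0) = F (i + (2 * h : ℕ)) := by rw [hF.per, a1]; simp
      simp only [this]
      exact adj _ _ (by split_ifs at a2 <;> push_cast at * <;> omega)
  rcases hT _ (hF.mem i) _ (hF.mem (i + 2 * e)) (hF.ne (by omega) (by push_cast; omega)) with r | r
  swap
  · exact r
  exfalso
  have b1 : B (F (i + 1)) (F (i + 2 * e + 2)) := by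
    rcases hT _ (hF.mem (i + 1)) _ (hF.mem (i + 2 * e + 2))
      (hF.ne (by omega) (by push_cast; omega)) with r' | r'
    · refine (cr i (2 * e) (by omega) (by omega) ?_ ?_).elim
      · simpa using r
      · simpa using r'
    · exact r'
  have b2 : B (F (i - 1)) (F (i + 2 * e - 2)) := by
    rcases hT _ (hF.mem (i - 1)) _ (hF.mem (i + 2 * e - 2))
      (hF.ne (by omega) (by push_cast; omega)) with r' | r'
    · refine (cr (i - 1) (2 * e - 1) (by omega) (by omega) ?_ ?_).elim
      · rwa [show i - 1 + ((2 * e - 1 : ℕ) : ℤ) = i + 2 * e - 2 by omega]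
      · rwa [show i - 1 + ((2 * e - 1 : ℕ) : ℤ) + 2 = i + 2 * e by omega,
          show i - 1 + 1 = i by ring]
    · exact r'
  apply h2
  let p : ℕ → ℤ := fun m => if m < h - 1 then i + 2 * e + 2 * (m + 1) else i - 2 * m + 2 * h - 3
  have hp : ∀ m, p m = if m < h - 1 then i + 2 * e + 2 * ((m : ℤ) + 1) else
    i - 2 * m + 2 * h - 3 := fun m => rfl
  refine MC.of_fun (by omega) (fun j => F (p j)) (fun _ _ => hF.mem _) ?_ ?_ ?_
  · intro m m' l1 l2
    have a1 := hp m
    have a2 := hp m'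
    by_cases k1 : m' < h - 1
    · refine hF.ne ?_ ?_
      · split_ifs at a1 a2 <;> omega
      · split_ifs at a1 a2 <;> push_cast <;> omega
    · by_cases k2 : m < h - 1
      · intro hE
        obtain ⟨c, hc⟩ := hF.inj _ _ hE
        rw [if_pos k2] at a1
        rw [if_neg k1] at a2
        push_cast at hc
        rw [mul_assoc] at hc
        generalize (h : ℤ) * c = w at hc
        omega
      · refine (hF.ne ?_ ?_).symm
        · split_ifs at a1 a2 <;> omega
        · split_ifs at a1 a2 <;> push_cast <;> omega
  · intro m hm
    have a1 := hp m
    have a2 := hp (m + 1)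
    by_cases k1 : m + 1 < h - 1
    · exact c2 _ _ (by split_ifs at a1 a2 <;> push_cast at * <;> omega)
    by_cases k2 : m + 1 = h - 1
    · have e1 : p m = i + 2 * e - 2 + (2 * h : ℕ) := by
        split_ifs at a1 a2 <;> push_cast at * <;> omega
      have e2 : p (m + 1) = i - 1 := by
        split_ifs at a1 a2 <;> push_cast at * <;> omega
      simp only [e1, e2, hF.per]
      exact hBs _ _ b2
    · exact hBs _ _ (c2 _ _ (by split_ifs at a1 a2 <;> push_cast at * <;> omega))
  · have a1 := hp 0
    have a2 := hp (2 * h - 1 - 1)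
    have e1 : F (p (2 * h - 1 - 1)) = F (i + 1) := by
      rw [← hF.per]
      congr 1
      split_ifs at a1 a2 <;> push_cast at * <;> omega
    have e2 : p 0 = i + 2 * e + 2 := by
      split_ifs at a1 a2 <;> push_cast at * <;> omega
    simp only [e1, e2]
    exact b1

end RamB


set_option linter.unusedSectionVars false
set_option linter.unusedVariables false
set_option linter.unnecessarySimpa false

section RamC
variable {V : Type*} [DecidableEq V]

theorem common_vertex {E O : Finset V} {Q : V → V → Prop} (hE : E.Nonempty)
    (h : ∀ e ∈ E, ∀ e' ∈ E, ∀ o ∈ O, ∀ o' ∈ O, e ≠ e' → o ≠ o' → Q e o → Q e' o' → False) :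
    (∃ w ∈ E, ∀ e ∈ E, ∀ o ∈ O, Q e o → e = w) ∨ (∃ w ∈ O, ∀ e ∈ E, ∀ o ∈ O, Q e o → o = w) := by
  by_cases hex : ∃ e ∈ E, ∃ o ∈ O, Q e o
  · obtain ⟨e, he, o, ho, hq⟩ := hex
    by_cases h1 : ∀ e' ∈ E, ∀ o' ∈ O, Q e' o' → e' = e
    · exact Or.inl ⟨e, he, h1⟩
    · push Not at h1
      obtain ⟨e', he', o', ho', hq', hne⟩ := h1
      have hoo : o' = o := by
        by_contra hoo
        exact h e' he' e he o' ho' o ho hne hoo hq' hq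
      subst hoo
      refine Or.inr ⟨o', ho', ?_⟩
      intro e2 he2 o2 ho2 hq2
      by_contra hc
      by_cases h2 : e2 = e
      · subst h2
        exact h e2 he2 e' he' o2 ho2 o' ho' hne.symm hc hq2 hq'
      · exact h e2 he2 e he o2 ho2 o' ho' h2 hc hq2 hq
  · push Not at hex
    obtain ⟨w, hw⟩ := hE
    exact Or.inl ⟨w, hw, fun e he o ho hq => absurd hq (hex e he o ho)⟩

theorem RF {R B : V → V → Prop} (hRs : ∀ x y, R x y → R y x) (hBs : ∀ x y, B x y → B y x)
    {S : Finset V} (hT : ∀ x ∈ S, ∀ y ∈ S, x ≠ y → R x y ∨ B x y) {l : ℕ} (hl : 2 ≤ l)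
    {E O : Finset V} (hd : Disjoint E O) (hE : ∀ a ∈ E, ∀ b ∈ E, a ≠ b → B a b)
    (hO : ∀ a ∈ O, ∀ b ∈ O, a ≠ b → B a b) (hEc : E.card = l + 1) (hOc : O.card = l + 1)
    (hES : E ⊆ S) (hOS : O ⊆ S) {w : V} (hw : w ∈ E)
    (hEO : ∀ e ∈ E, ∀ o ∈ O, e ≠ w → R e o) (hS : 4 * l + 1 ≤ S.card)
    (n1 : ¬ MC R S (2 * l + 1)) (n2 : ¬ MC B S (2 * l + 1)) : False := by
  classical
  set E' := E.erase w with hE'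
  have hE'c : E'.card = l := by rw [hE', Finset.card_erase_of_mem hw]; omega
  have hE'E : E' ⊆ E := Finset.erase_subset _ _
  have hE'O : Disjoint E' O := Finset.disjoint_of_subset_left hE'E hd
  have hRE' : ∀ a ∈ E', ∀ y ∈ O, R a y ∧ R y a := by
    intro a ha y hy
    have := hEO a (hE'E ha) y hy (Finset.ne_of_mem_erase ha)
    exact ⟨this, hRs _ _ this⟩
  set X := S \ (E ∪ O) with hX
  have hXc : 4 * l + 1 ≤ X.card + (2 * l + 2) := by
    have h1 : X.card + (E ∪ O).card = S.card :=
      Finset.card_sdiff_add_card_eq_card (Finset.union_subset hES hOS)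
    rw [Finset.card_union_of_disjoint hd] at h1
    omega
  have hXS : X ⊆ S := Finset.sdiff_subset
  have hXE : ∀ x ∈ X, x ∉ E := fun x hx h => (Finset.mem_sdiff.1 hx).2 (Finset.mem_union_left _ h)
  have hXO : ∀ x ∈ X, x ∉ O := fun x hx h => (Finset.mem_sdiff.1 hx).2 (Finset.mem_union_right _ h)
  set T := X.filter (fun v => ∀ o ∈ O, B v o) with hTd
  set Y := X.filter (fun v => ¬ ∀ o ∈ O, B v o) with hYd
  have hTY : T.card + Y.card = X.card := Finset.card_filter_add_card_filter_not _
  have hTX : T ⊆ X := Finset.filter_subset _ _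
  have hYX : Y ⊆ X := Finset.filter_subset _ _
  have hTc : T.card < l := by
    by_contra hc
    obtain ⟨a, b, ha, hb, hab⟩ := Finset.one_lt_card_iff.1 (by omega : 1 < O.card)
    refine n2 (KB (A := T) (B := O) (b := a) (b' := b) (by omega) ?_ ?_ (by omega) (by omega) ha hb hab
      (hTX.trans hXS) hOS (hO b hb a ha hab.symm))
    · exact Finset.disjoint_left.2 fun x hx => hXO x (hTX hx)
    · intro x hx y hy
      have := (Finset.mem_filter.1 hx).2 y hy
      exact ⟨this, hBs _ _ this⟩
  have hYc : l ≤ Y.card := by omega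
  have hYO : ∀ s ∈ Y, ∃ o ∈ O, R s o := by
    intro s hs
    have h1 := (Finset.mem_filter.1 hs).2
    push Not at h1
    obtain ⟨o, ho, h2⟩ := h1
    refine ⟨o, ho, ?_⟩
    rcases hT s (hXS (hYX hs)) o (hOS ho) (fun h => hXO s (hYX hs) (h ▸ ho)) with h | h
    · exact h
    · exact absurd h h2
  have hYE : ∀ s ∈ Y, ∀ e ∈ E', B s e := by
    intro s hs e he
    rcases hT s (hXS (hYX hs)) e (hES (hE'E he)) (fun h => hXE s (hYX hs) (h ▸ hE'E he)) with h | h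
    · obtain ⟨o, ho, h2⟩ := hYO s hs
      exact absurd (KP (A := E') (B := O) hl hE'O hRE' (by omega) (by omega) he ho
        (fun h => hXE s (hYX hs) (hE'E h)) (hXO s (hYX hs)) (hE'E.trans hES) hOS (hXS (hYX hs))
        (hRs _ _ h) h2) n1
    · exact h
  have hwY : w ∉ Y := fun h => hXE w (hYX h) hw
  have hYY : ∀ s ∈ Y, ∀ s' ∈ Y, s ≠ s' → R s s' := by
    intro s hs s' hs' hne
    rcases hT s (hXS (hYX hs)) s' (hXS (hYX hs')) hne with h | h
    · exact h
    · refine absurd (KB (A := E') (B := insert w Y) (b := s) (b' := s') (by omega) ?_ ?_ (by omega)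
        (by rw [Finset.card_insert_of_notMem hwY]; omega) (by simp [hs]) (by simp [hs']) hne
        (hE'E.trans hES) ?_ (hBs _ _ h)) n2
      · refine Finset.disjoint_left.2 fun x hx hx' => ?_
        rcases Finset.mem_insert.1 hx' with rfl | hx'
        · exact Finset.ne_of_mem_erase hx rfl
        · exact hXE x (hYX hx') (hE'E hx)
      · intro a ha y hy
        rcases Finset.mem_insert.1 hy with rfl | hy
        · have hne := Finset.ne_of_mem_erase ha
          exact ⟨hE a (hE'E ha) y hw hne, hE y hw a (hE'E ha) hne.symm⟩
        · exact ⟨hBs _ _ (hYE y hy a ha), hYE y hy a ha⟩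
      · intro x hx
        rcases Finset.mem_insert.1 hx with rfl | hx
        · exact hES hw
        · exact hXS (hYX hx)
  have hYne : Y.Nonempty := Finset.card_pos.1 (by omega)
  have hcv := common_vertex (E := Y) (O := O) (Q := R) hYne (by
    intro s hs s' hs' o ho o' ho' hss hoo h1 h2
    exact n1 (KP2 (A := E') (B := O) hl hE'O hRE' (by omega) (by omega) ho ho' hoo hss
      (fun h => hXE s (hYX hs) (hE'E h)) (hXO s (hYX hs))
      (fun h => hXE s' (hYX hs') (hE'E h)) (hXO s' (hYX hs')) (hE'E.trans hES) hOS
      (hXS (hYX hs)) (hXS (hYX hs')) h1 (hRs _ _ h2) (hYY s' hs' s hs hss.symm)))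
  rcases hcv with ⟨s0, hs0, h⟩ | ⟨o0, ho0, h⟩
  · obtain ⟨s, hs⟩ := Finset.card_pos.1
      (by rw [Finset.card_erase_of_mem hs0]; omega : 0 < (Y.erase s0).card)
    rw [Finset.mem_erase] at hs
    obtain ⟨o, ho, hr⟩ := hYO s hs.2
    exact hs.1 (h s hs.2 o ho hr)
  · have hdis : Disjoint E' (O.erase o0) :=
      Finset.disjoint_of_subset_right (Finset.erase_subset _ _) hE'O
    obtain ⟨a, b, ha, hb, hab⟩ := Finset.one_lt_card_iff.1 (by omega : 1 < E'.card)
    refine n2 (KB (A := Y) (B := E' ∪ O.erase o0) (b := a) (b' := b) (by omega) ?_ ?_ hYc ?_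
      (by simp [ha]) (by simp [hb]) hab (hYX.trans hXS) ?_
      (hE b (hE'E hb) a (hE'E ha) hab.symm))
    · refine Finset.disjoint_left.2 fun x hx hx' => ?_
      rcases Finset.mem_union.1 hx' with h | h
      · exact hXE x (hYX hx) (hE'E h)
      · exact hXO x (hYX hx) (Finset.mem_of_mem_erase h)
    · intro s hs y hy
      have : B s y := by
        rcases Finset.mem_union.1 hy with hy | hy
        · exact hYE s hs y hy
        · have hyO := Finset.mem_of_mem_erase hy
          rcases hT s (hXS (hYX hs)) y (hOS hyO) (fun h => hXO s (hYX hs) (h ▸ hyO)) with h' | h'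
          · exact absurd (h s hs y hyO h') (Finset.ne_of_mem_erase hy)
          · exact h'
      exact ⟨this, hBs _ _ this⟩
    · rw [Finset.card_union_of_disjoint hdis, Finset.card_erase_of_mem ho0]; omega
    · exact Finset.union_subset (hE'E.trans hES) ((Finset.erase_subset _ _).trans hOS)

theorem ramsey_even {R B : V → V → Prop} (hRs : ∀ x y, R x y → R y x)
    (hBs : ∀ x y, B x y → B y x)
    {S : Finset V} (hT : ∀ x ∈ S, ∀ y ∈ S, x ≠ y → R x y ∨ B x y) {l : ℕ} (hl : 2 ≤ l)
    (hS : 4 * l + 1 ≤ S.card) (hc : MC R S (2 * l + 2))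
    (n1 : ¬ MC R S (2 * l + 1)) (n2 : ¬ MC B S (2 * l + 1)) : False := by
  obtain ⟨F, hF⟩ := hc.exists_pcyc
  have hF' : PCyc R S (2 * (l + 1)) F := hF
  have hB : ∀ (i : ℤ) (e : ℕ), 1 ≤ e → e < l + 1 → B (F i) (F (i + 2 * e)) := fun i e h1 h2 =>
    RB2 hRs hBs hT (by omega) hF' n1 n2 i e h1 h2
  set E := (Finset.range (l + 1)).image (fun s : ℕ => F (2 * s)) with hE
  set O := (Finset.range (l + 1)).image (fun s : ℕ => F (2 * s + 1)) with hO
  have hEc : E.card = l + 1 := by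
    rw [hE, Finset.card_image_of_injOn, Finset.card_range]
    intro s hs s' hs' h
    simp only [Finset.coe_range, Set.mem_Iio] at hs hs'
    rcases lt_trichotomy s s' with h' | h' | h'
    · exact absurd h (hF.ne (by omega) (by push_cast; omega))
    · exact h'
    · exact absurd h.symm (hF.ne (by omega) (by push_cast; omega))
  have hOc : O.card = l + 1 := by
    rw [hO, Finset.card_image_of_injOn, Finset.card_range]
    intro s hs s' hs' h
    simp only [Finset.coe_range, Set.mem_Iio] at hs hs'
    rcases lt_trichotomy s s' with h' | h' | h'
    · exact absurd h (hF.ne (by omega) (by push_cast; omega))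
    · exact h'
    · exact absurd h.symm (hF.ne (by omega) (by push_cast; omega))
  have hES : E ⊆ S := by
    intro x hx
    obtain ⟨s, hs, rfl⟩ := Finset.mem_image.1 hx
    exact hF.mem _
  have hOS : O ⊆ S := by
    intro x hx
    obtain ⟨s, hs, rfl⟩ := Finset.mem_image.1 hx
    exact hF.mem _
  have hEB : ∀ a ∈ E, ∀ b ∈ E, a ≠ b → B a b := by
    intro a ha b hb hab
    obtain ⟨s, hs, rfl⟩ := Finset.mem_image.1 ha
    obtain ⟨s', hs', rfl⟩ := Finset.mem_image.1 hb
    rw [Finset.mem_range] at hs hs'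
    rcases lt_trichotomy s s' with h' | h' | h'
    · have := hB (2 * s) (s' - s) (by omega) (by omega)
      rwa [show (2 * s : ℤ) + 2 * ((s' - s : ℕ) : ℤ) = 2 * s' by omega] at this
    · exact absurd (by rw [h']) hab
    · have := hB (2 * s') (s - s') (by omega) (by omega)
      rw [show (2 * s' : ℤ) + 2 * ((s - s' : ℕ) : ℤ) = 2 * s by omega] at this
      exact hBs _ _ this
  have hOB : ∀ a ∈ O, ∀ b ∈ O, a ≠ b → B a b := by
    intro a ha b hb hab
    obtain ⟨s, hs, rfl⟩ := Finset.mem_image.1 ha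
    obtain ⟨s', hs', rfl⟩ := Finset.mem_image.1 hb
    rw [Finset.mem_range] at hs hs'
    rcases lt_trichotomy s s' with h' | h' | h'
    · have := hB (2 * s + 1) (s' - s) (by omega) (by omega)
      rwa [show (2 * s + 1 : ℤ) + 2 * ((s' - s : ℕ) : ℤ) = 2 * s' + 1 by omega] at this
    · exact absurd (by rw [h']) hab
    · have := hB (2 * s' + 1) (s - s') (by omega) (by omega)
      rw [show (2 * s' + 1 : ℤ) + 2 * ((s - s' : ℕ) : ℤ) = 2 * s + 1 by omega] at this
      exact hBs _ _ this
  have hd : Disjoint E O := by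
    refine Finset.disjoint_left.2 fun x hx hx' => ?_
    obtain ⟨s, hs, rfl⟩ := Finset.mem_image.1 hx
    obtain ⟨s', hs', h⟩ := Finset.mem_image.1 hx'
    rw [Finset.mem_range] at hs hs'
    rcases lt_or_ge s' s with h' | h'
    · exact hF.ne (by omega) (by push_cast; omega) h
    · exact hF.ne (by omega) (by push_cast; omega) h.symm
  have hcv := common_vertex (E := E) (O := O) (Q := B) (Finset.card_pos.1 (by omega)) (by
    intro e he e' he' o ho o' ho' hee hoo h1 h2
    exact n2 (two_cliques hl hd hEB hOB hEc.ge hOc.ge hES hOS he he' ho ho' hee hoo h2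
      (hBs _ _ h1)))
  have hneq : ∀ e ∈ E, ∀ o ∈ O, e ≠ o := fun e he o ho h =>
    Finset.disjoint_left.1 hd he (h ▸ ho)
  rcases hcv with ⟨w, hw, h⟩ | ⟨w, hw, h⟩
  · refine RF hRs hBs hT hl hd hEB hOB hEc hOc hES hOS hw ?_ hS n1 n2
    intro e he o ho hne
    rcases hT e (hES he) o (hOS ho) (hneq e he o ho) with h' | h'
    · exact h'
    · exact absurd (h e he o ho h') hne
  · refine RF hRs hBs hT hl hd.symm hOB hEB hOc hEc hOS hES hw ?_ hS n1 n2
    intro o ho e he hne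
    rcases hT e (hES he) o (hOS ho) (hneq e he o ho) with h' | h'
    · exact hRs _ _ h'
    · exact absurd (h e he o ho h') hne

theorem ramsey {R B : V → V → Prop} (hRs : ∀ x y, R x y → R y x) (hBs : ∀ x y, B x y → B y x)
    {S : Finset V} (hT : ∀ x ∈ S, ∀ y ∈ S, x ≠ y → R x y ∨ B x y) {l : ℕ} (hl : 2 ≤ l)
    (hS : 4 * l + 1 ≤ S.card) : MC R S (2 * l + 1) ∨ MC B S (2 * l + 1) := by
  classical
  by_contra hno
  push Not at hno
  have hT' : ∀ x ∈ S, ∀ y ∈ S, x ≠ y → B x y ∨ R x y := fun x hx y hy hxy => (hT x hx y hy hxy).symm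
  have hex := ramseyA hRs hBs hT (by omega) hS
  obtain ⟨t, ht, hmc⟩ : ∃ t, t = Nat.find hex ∧ (2 * l + 1 ≤ t ∧ (MC R S t ∨ MC B S t)) :=
    ⟨_, rfl, Nat.find_spec hex⟩
  have hmin : ∀ m, m < t → 2 * l + 1 ≤ m → ¬ MC R S m ∧ ¬ MC B S m := by
    intro m hm h1
    have := Nat.find_min hex (ht ▸ hm)
    push Not at this
    exact this h1
  rcases Nat.lt_or_ge t (2 * l + 3) with h | h
  · have : t = 2 * l + 1 ∨ t = 2 * l + 2 := by omega
    rcases this with rfl | rfl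
    · rcases hmc.2 with h | h
      · exact hno.1 h
      · exact hno.2 h
    · rcases hmc.2 with h | h
      · exact ramsey_even hRs hBs hT hl hS h hno.1 hno.2
      · exact ramsey_even hBs hRs hT' hl hS h hno.2 hno.1
  · rcases hmc.2 with h' | h'
    · obtain ⟨F, hF⟩ := h'.exists_pcyc
      exact hno.2 (RB1 hBs hT hl hF h (hmin (t - 1) (by omega) (by omega)).1
        (hmin (t - 2) (by omega) (by omega)).1)
    · obtain ⟨F, hF⟩ := h'.exists_pcyc
      exact hno.1 (RB1 hRs hT' hl hF h (hmin (t - 1) (by omega) (by omega)).2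
        (hmin (t - 2) (by omega) (by omega)).2)

end RamC


set_option linter.unusedSectionVars false
set_option linter.unusedVariables false
set_option linter.unnecessarySimpa false

section GallaiSec
variable {V : Type*} [DecidableEq V] {α : Type*}

/-- symmetric, with no rainbow triangle -/
def GalCol (col : V → V → α) : Prop :=
  (∀ x y, col x y = col y x) ∧ ∀ x y z, x ≠ y → x ≠ z → y ≠ z →
    col x y = col x z ∨ col x y = col y z ∨ col x z = col y z

def GCut (col : V → V → α) (A : Finset V) : Prop :=
  ∃ (i j : α) (C : Finset V), C ⊆ A ∧ C.Nonempty ∧ (∃ y ∈ A, y ∉ C) ∧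
    ∀ x ∈ C, ∀ y ∈ A, y ∉ C → col x y = i ∨ col x y = j

def GPart (col : V → V → α) (A : Finset V) (i j : α) (κ : V → Set V) : Prop :=
  (∃ x ∈ A, ∃ y ∈ A, κ x ≠ κ y) ∧
  (∀ x ∈ A, ∀ y ∈ A, κ x ≠ κ y → col x y = i ∨ col x y = j) ∧
  (∀ x ∈ A, ∀ x' ∈ A, ∀ y ∈ A, κ x = κ x' → κ x ≠ κ y → col x y = col x' y)

theorem GCut.part {col : V → V → α} (hc : GalCol col) {A : Finset V} (h : GCut col A) :
    ∃ i j κ, GPart col A i j κ := by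
  obtain ⟨i, j, C, hCA, ⟨x0, hx0⟩, ⟨y0, hy0, hy0C⟩, hcr⟩ := h
  let G : V → V → Prop := fun x y => x ∈ A ∧ y ∈ A ∧ x ≠ y ∧ col x y ≠ i ∧ col x y ≠ j
  let E := Relation.EqvGen G
  have hκ : ∀ x y, ({z | E x z} : Set V) = {z | E y z} ↔ E x y := by
    intro x y
    constructor
    · intro h
      have : y ∈ ({z | E y z} : Set V) := Relation.EqvGen.refl y
      rw [← h] at this
      exact this
    · intro h
      ext z
      exact ⟨fun h' => (h.symm).trans _ _ _ h', fun h' => h.trans _ _ _ h'⟩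
  have hcross : ∀ x ∈ A, ∀ y ∈ A, ¬ E x y → col x y = i ∨ col x y = j := by
    intro x hx y hy hE
    by_contra hno
    push Not at hno
    apply hE
    refine Relation.EqvGen.rel _ _ ⟨hx, hy, ?_, hno.1, hno.2⟩
    rintro rfl
    exact hE (Relation.EqvGen.refl _)
  have hinv : ∀ x y, E x y → (x ∈ C ↔ y ∈ C) := by
    intro x y h
    induction h with
    | rel x y h =>
      obtain ⟨hx, hy, hne, h1, h2⟩ := h
      constructor
      · intro hxC
        by_contra hyC
        rcases hcr x hxC y hy hyC with h | h
        · exact h1 h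
        · exact h2 h
      · intro hyC
        by_contra hxC
        rcases hcr y hyC x hx hxC with h | h
        · exact h1 (by rw [hc.1, h])
        · exact h2 (by rw [hc.1, h])
    | refl => rfl
    | symm x y h ih => exact ih.symm
    | trans x y z h1 h2 ih1 ih2 => exact ih1.trans ih2
  refine ⟨i, j, fun x => {z | E x z}, ⟨x0, hCA hx0, y0, hy0, ?_⟩, ?_, ?_⟩
  · rw [Ne, hκ]
    intro h
    exact hy0C ((hinv _ _ h).1 hx0)
  · intro x hx y hy h
    rw [Ne, hκ] at h
    exact hcross x hx y hy h
  · intro x hxA x' hxA' y hy h1 h2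
    clear hxA hxA'
    rw [hκ] at h1
    rw [Ne, hκ] at h2
    clear hκ
    induction h1 with
    | rel a b h =>
      obtain ⟨ha, hb, hne, n1, n2⟩ := h
      have hab : E a b := Relation.EqvGen.rel _ _ ⟨ha, hb, hne, n1, n2⟩
      have h2' : ¬ E b y := fun h => h2 (hab.trans _ _ _ h)
      have e1 := hcross a ha y hy h2
      have e2 := hcross b hb y hy h2'
      have hay : a ≠ y := by rintro rfl; exact h2 (Relation.EqvGen.refl _)
      have hby : b ≠ y := by rintro rfl; exact h2' (Relation.EqvGen.refl _)
      rcases hc.2 a b y hne hay hby with h | h | h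
      · rcases e1 with e | e
        · exact absurd (h.trans e) n1
        · exact absurd (h.trans e) n2
      · rcases e2 with e | e
        · exact absurd (h.trans e) n1
        · exact absurd (h.trans e) n2
      · exact h
    | refl => rfl
    | symm a b h ih => exact (ih (fun h' => h2 ((h.symm).trans _ _ _ h'))).symm
    | trans a b c h1 h3 ih1 ih2 =>
      exact (ih1 h2).trans (ih2 (fun h' => h2 (h1.trans _ _ _ h')))

theorem gcut_exists {col : V → V → α} (hc : GalCol col) (A : Finset V) : 2 ≤ A.card → GCut col A := by
  classical
  induction A using Finset.induction_on with
  | empty => simp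
  | insert v A hv ih =>
    intro hcard
    rw [Finset.card_insert_of_notMem hv] at hcard
    rcases Nat.lt_or_ge A.card 2 with h | h
    · obtain ⟨u, hu⟩ := Finset.card_eq_one.1 (by omega : A.card = 1)
      subst hu
      refine ⟨col v u, col v u, {v}, by simp, by simp, ⟨u, by simp, ?_⟩, ?_⟩
      · simp only [Finset.mem_singleton] at hv ⊢; exact fun h => hv h.symm
      · intro x hx y hy hyC
        simp only [Finset.mem_singleton, Finset.mem_insert] at *
        subst hx
        rcases hy with rfl | rfl
        · exact absurd rfl hyC
        · simp
    obtain ⟨i, j, κ, ⟨x1, hx1, y1, hy1, hne1⟩, hcr, hhom⟩ := (ih h).part hc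
    by_cases c1 : ∃ z ∈ A, ∀ x ∈ A, κ x = κ z → col v x = i ∨ col v x = j
    · obtain ⟨z, hz, hzc⟩ := c1
      refine ⟨i, j, A.filter (fun x => κ x = κ z), ?_, ⟨z, by simp [hz]⟩, ⟨v, by simp, by simp [hv]⟩, ?_⟩
      · exact (Finset.filter_subset _ _).trans (Finset.subset_insert _ _)
      · intro x hx y hy hyC
        rw [Finset.mem_filter] at hx
        rcases Finset.mem_insert.1 hy with rfl | hy
        · rw [hc.1]; exact hzc x hx.1 hx.2
        · refine hcr x hx.1 y hy (fun h => hyC (Finset.mem_filter.2 ⟨hy, ?_⟩))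
          rw [← h, hx.2]
    · push Not at c1
      have hvA : ∀ x ∈ A, v ≠ x := fun x hx h => hv (h ▸ hx)
      obtain ⟨x0, hx0, ex0, bx0⟩ := c1 x1 hx1
      obtain ⟨y0, hy0, ey0, by0⟩ := c1 y1 hy1
      have hxy0 : κ x0 ≠ κ y0 := by rw [ex0, ey0]; exact hne1
      have heq : ∀ x ∈ A, ∀ y ∈ A, κ x ≠ κ y → (col v x ≠ i ∧ col v x ≠ j) →
          (col v y ≠ i ∧ col v y ≠ j) → col v x = col v y := by
        intro x hx y hy hne b1 b2
        have hxy : x ≠ y := fun h => hne (by rw [h])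
        rcases hc.2 v x y (hvA x hx) (hvA y hy) hxy with h | h | h
        · exact h
        · rcases hcr x hx y hy hne with e | e
          · exact absurd (h.trans e) b1.1
          · exact absurd (h.trans e) b1.2
        · rcases hcr x hx y hy hne with e | e
          · exact absurd (h.trans e) b2.1
          · exact absurd (h.trans e) b2.2
      set m := col v x0 with hm
      have hbad : ∀ x ∈ A, (col v x ≠ i ∧ col v x ≠ j) → col v x = m := by
        intro x hx bx
        by_cases hk : κ x = κ x0
        · have h1 := heq x hx y0 hy0 (by rw [hk]; exact hxy0) bx by0
          have h2 := heq x0 hx0 y0 hy0 hxy0 bx0 by0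
          rw [h1, ← h2]
        · exact heq x hx x0 hx0 hk bx bx0
      by_cases hall : ∀ x ∈ A, col v x = m
      · refine ⟨m, m, {v}, by simp, by simp, ⟨x0, by simp [hx0], ?_⟩, ?_⟩
        · simp only [Finset.mem_singleton]; exact fun h => hv (h ▸ hx0)
        · intro x hx y hy hyC
          simp only [Finset.mem_singleton, Finset.mem_insert] at *
          subst hx
          rcases hy with rfl | hy
          · exact absurd rfl hyC
          · simp [hall y hy]
      · push Not at hall
        obtain ⟨z, hz, hzm⟩ := hall
        have key : ∀ x ∈ A, κ x = κ z → ∀ y ∈ A, κ y ≠ κ z → col x y = col v z := by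
          intro x hx hxz y hy hyz
          obtain ⟨w, hw, hwy, bw⟩ := c1 y hy
          have hwm := hbad w hw bw
          have hwz : κ z ≠ κ w := by rw [hwy]; exact hyz.symm
          have e1 : col z w = col v z := by
            rcases hc.2 v z w (hvA z hz) (hvA w hw) (fun h => hwz (by rw [h])) with h | h | h
            · exact absurd (h.trans hwm) hzm
            · exact h.symm
            · rcases hcr z hz w hw hwz with e | e
              · exact absurd (h.trans e) bw.1
              · exact absurd (h.trans e) bw.2
          rw [hhom x hx z hz y hy hxz (by rw [hxz]; exact hyz.symm), hc.1 z y,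
            hhom y hy w hw z hz hwy.symm hyz, hc.1 w z, e1]
        refine ⟨m, col v z, A.filter (fun x => κ x = κ z), ?_, ⟨z, by simp [hz]⟩,
          ⟨v, by simp, by simp [hv]⟩, ?_⟩
        · exact (Finset.filter_subset _ _).trans (Finset.subset_insert _ _)
        · intro x hx y hy hyC
          rw [Finset.mem_filter] at hx
          rcases Finset.mem_insert.1 hy with rfl | hy
          · -- y = v
            obtain ⟨w, hw, hwz, bw⟩ : ∃ w ∈ A, κ w ≠ κ z ∧ (col y w ≠ i ∧ col y w ≠ j) := by
              by_cases hk : κ x0 = κ z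
              · exact ⟨y0, hy0, by rw [← hk]; exact hxy0.symm, by0⟩
              · exact ⟨x0, hx0, hk, bx0⟩
            have hwm := hbad w hw bw
            have e1 := key x hx.1 hx.2 w hw hwz
            have hxw : x ≠ w := fun h => hwz (by rw [← h, hx.2])
            rw [hc.1 x y]
            rcases hc.2 y x w (hvA x hx.1) (hvA w hw) hxw with h | h | h
            · left; rw [h, hwm]
            · right; rw [h, e1]
            · exact absurd (by rw [← e1, ← h, hwm]) hzm
          · right
            refine key x hx.1 hx.2 y hy (fun h => hyC (Finset.mem_filter.2 ⟨hy, h⟩))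

theorem gallai {col : V → V → α} (hc : GalCol col) {A : Finset V} (h : 2 ≤ A.card) :
    ∃ i j κ, GPart col A i j κ := (gcut_exists hc A h).part hc

end GallaiSec


set_option linter.unusedSectionVars false
set_option linter.unusedVariables false
set_option linter.unnecessarySimpa false

section Q2sec
variable {V : Type*} [DecidableEq V]

theorem cyc_rotate {R : V → V → Prop} {x x0 : V} {l : List V}
    (h : (x :: (l ++ [x])).IsChain R) (hx : x0 ∈ x :: l) :
    ∃ l', List.Perm (x0 :: l') (x :: l) ∧ (x0 :: (l' ++ [x0])).IsChain R := by
  rcases List.mem_cons.1 hx with rfl | hx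
  · exact ⟨l, List.Perm.refl _, h⟩
  · obtain ⟨p, q, rfl⟩ := List.append_of_mem hx
    refine ⟨q ++ x :: p, ?_, ?_⟩
    · have := List.perm_append_comm (l₁ := x0 :: q) (l₂ := x :: p)
      simpa using this
    · have e : x :: (p ++ x0 :: q ++ [x]) = (x :: p) ++ x0 :: (q ++ [x]) := by simp
      rw [e, List.isChain_split] at h
      have e2 : x0 :: (q ++ x :: p ++ [x0]) = (x0 :: q) ++ x :: (p ++ [x0]) := by simp
      rw [e2, List.isChain_split]
      exact ⟨h.2, h.1⟩

open Classical in
/-- number of consecutive pairs not in `B` -/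
noncomputable def badCnt (B : V → V → Prop) : List V → ℕ
  | [] => 0
  | [_] => 0
  | a :: b :: L => (if B a b then 0 else 1) + badCnt B (b :: L)

theorem badCnt_cons_le (B : V → V → Prop) (a : V) (L : List V) :
    badCnt B (a :: L) ≤ 1 + badCnt B L := by
  cases L with
  | nil => simp [badCnt]
  | cons b L => rw [badCnt]; split_ifs <;> omega

theorem badCnt_le (B : V → V → Prop) (a : V) (L : List V) : badCnt B (a :: L) ≤ L.length := by
  induction L generalizing a with
  | nil => simp [badCnt]
  | cons b L ih =>
    have := ih b
    rw [badCnt]; simp only [List.length_cons]; split_ifs <;> omega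

theorem interleave {B : V → V → Prop} {A X : Finset V} {x0 : V}
    (hAX : ∀ a ∈ A, ∀ x ∈ X, B a x ∧ B x a) (hx0 : x0 ∈ X) (L : List V) :
    ∀ (a : V) (Y : List V), (∀ v ∈ a :: L, v ∈ A) → (∀ v ∈ Y, v ∈ X) →
    badCnt B (a :: L) ≤ Y.length → Y.length ≤ L.length →
    ∃ m, List.Perm m (L ++ Y) ∧ (a :: (m ++ [x0])).IsChain B := by
  induction L with
  | nil =>
    intro a Y ha hY h1 h2
    obtain rfl : Y = [] := by simpa using h2
    exact ⟨[], by simp, by simp [(hAX a (ha a (by simp)) x0 hx0).1]⟩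
  | cons b L ih =>
    intro a Y ha hY h1 h2
    have haA : a ∈ A := ha a (by simp)
    have hbA : b ∈ A := ha b (by simp)
    by_cases hc : B a b ∧ Y.length ≤ L.length
    · obtain ⟨m, hm1, hm2⟩ := ih b Y (fun v hv => ha v (List.mem_cons_of_mem _ hv)) hY (by
        rw [badCnt, if_pos hc.1] at h1; omega) hc.2
      refine ⟨b :: m, by simpa using hm1, ?_⟩
      rw [List.cons_append, List.isChain_cons_cons]
      exact ⟨hc.1, hm2⟩
    · have hYpos : 1 ≤ Y.length := by
        by_cases hB : B a b
        · have : ¬ Y.length ≤ L.length := fun h => hc ⟨hB, h⟩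
          omega
        · rw [badCnt, if_neg hB] at h1; omega
      cases Y with
      | nil => simp at hYpos
      | cons y Y =>
        have hy : y ∈ X := hY y (by simp)
        simp only [List.length_cons] at h1 h2 hc
        obtain ⟨m, hm1, hm2⟩ := ih b Y (fun v hv => ha v (List.mem_cons_of_mem _ hv))
          (fun v hv => hY v (List.mem_cons_of_mem _ hv)) (by
            by_cases hB : B a b
            · have : ¬ Y.length + 1 ≤ L.length := fun h => hc ⟨hB, h⟩
              have := badCnt_le B b L
              omega
            · rw [badCnt, if_neg hB] at h1; omega) (by omega)
        refine ⟨y :: b :: m, ?_, ?_⟩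
        · have h1 : List.Perm (y :: b :: m) (y :: (b :: L ++ Y)) := by
            simpa using hm1
          refine h1.trans ?_
          exact List.perm_middle.symm
        · simp only [List.cons_append, List.isChain_cons_cons]
          exact ⟨(hAX a haA y hy).1, (hAX b hbA y hy).2, hm2⟩

theorem badCnt_filter {B B' : V → V → Prop} {A X : Finset V}
    (hB : ∀ a ∈ A, ∀ b ∈ A, B' a b → B a b) (n : ℕ) : ∀ w : List V, w.length ≤ n →
    w.IsChain B' →
    badCnt B (w.filter (· ∈ A)) ≤ (w.filter (· ∉ A)).length := by
  induction n with
  | zero =>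
    intro w hw _
    obtain rfl : w = [] := by simpa using hw
    simp [badCnt]
  | succ n ih =>
    intro w hw hch
    cases w with
    | nil => simp [badCnt]
    | cons a w =>
      simp only [List.length_cons] at hw
      have hch' : w.IsChain B' := hch.tail
      by_cases ha : a ∈ A
      · cases w with
        | nil => simp [ha, badCnt]
        | cons b w =>
          simp only [List.length_cons] at hw
          rw [List.isChain_cons_cons] at hch
          by_cases hb : b ∈ A
          · have := ih (b :: w) (by simp; omega) hch'
            rw [List.filter_cons_of_pos (by simpa using hb), List.filter_cons_of_neg (by simpa using hb)] at this
            rw [List.filter_cons_of_pos (by simpa using ha), List.filter_cons_of_pos (by simpa using hb),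
              List.filter_cons_of_neg (by simpa using ha), List.filter_cons_of_neg (by simpa using hb),
              badCnt, if_pos (hB a ha b hb hch.1)]
            omega
          · have := ih w (by omega) hch'.tail
            rw [List.filter_cons_of_pos (by simpa using ha), List.filter_cons_of_neg (by simpa using hb),
              List.filter_cons_of_neg (by simpa using ha), List.filter_cons_of_pos (by simpa using hb)]
            have h2 := badCnt_cons_le B a (w.filter (· ∈ A))
            simp only [List.length_cons]
            omega
      · have := ih w (by omega) hch'
        rw [List.filter_cons_of_neg (by simpa using ha), List.filter_cons_of_pos (by simpa using ha)]
        simp only [List.length_cons]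
        omega

/-- Real cycle from a virtual one, in which `X`-vertices may be adjacent. -/
theorem real_of_virtual {B B' : V → V → Prop} {A X : Finset V} {l : ℕ}
    (hd : Disjoint A X)
    (hAX : ∀ a ∈ A, ∀ x ∈ X, B a x ∧ B x a) (hB : ∀ a ∈ A, ∀ b ∈ A, B' a b → B a b)
    (hX : X.card ≤ l) (h : MC B' (A ∪ X) (2 * l + 1)) : MC B (A ∪ X) (2 * l + 1) := by
  obtain ⟨x, c, h1, h2, h3, h4⟩ := h
  by_cases hex : ∃ x0 ∈ x :: c, x0 ∈ X
  · obtain ⟨x0, hx0, hx0X⟩ := hex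
    obtain ⟨c', hp, hch⟩ := cyc_rotate h4 hx0
    have hnd : (x0 :: c').Nodup := hp.nodup_iff.2 h2
    have hmem : ∀ y ∈ x0 :: c', y ∈ A ∪ X := fun y hy => h3 y (hp.mem_iff.1 hy)
    have hlen : c'.length = 2 * l := by have := hp.length_eq; simp at this; omega
    have hch2 : c'.IsChain B' := by
      have := hch.tail
      simp only [List.tail_cons] at this
      exact (List.isChain_append.1 this).1
    have hD := badCnt_filter (X := X) hB c'.length c' le_rfl hch2
    set L := c'.filter (· ∈ A) with hL
    set Y := c'.filter (· ∉ A) with hY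
    have hLA : ∀ v ∈ L, v ∈ A := fun v hv => by simpa using (List.mem_filter.1 hv).2
    have hYX : ∀ v ∈ Y, v ∈ X := fun v hv => by
      have h1 := (List.mem_filter.1 hv)
      have h2 := hmem v (List.mem_cons_of_mem _ h1.1)
      have h3 : v ∉ A := by simpa using h1.2
      simp only [Finset.mem_union] at h2
      tauto
    have hYn : (x0 :: Y).Nodup := by
      rw [List.nodup_cons] at hnd ⊢
      exact ⟨fun h => hnd.1 (List.mem_filter.1 h).1, hnd.2.filter _⟩
    have hYc : Y.length + 1 ≤ l := by
      have h1 : (x0 :: Y).toFinset ⊆ X := by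
        intro v hv
        simp only [List.mem_toFinset, List.mem_cons] at hv
        rcases hv with rfl | hv
        exacts [hx0X, hYX v hv]
      have h2 := Finset.card_le_card h1
      rw [List.toFinset_card_of_nodup hYn] at h2
      simp at h2; omega
    have hpLY : List.Perm (L ++ Y) c' := by
      have := List.filter_append_perm (fun v => decide (v ∈ A)) c'
      simpa [hL, hY] using this
    have hLc : L.length + Y.length = 2 * l := by
      have := hpLY.length_eq; simp at this; omega
    cases hLe : L with
    | nil => rw [hLe] at hLc; simp at hLc; omega
    | cons a L' =>
      rw [hLe] at hLc hLA hD hpLY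
      simp only [List.length_cons] at hLc
      obtain ⟨m, hm1, hm2⟩ := interleave hAX hx0X L' a Y hLA hYX hD (by omega)
      have hperm : List.Perm (x0 :: a :: m) (x0 :: c') := by
        refine List.Perm.cons _ (List.Perm.trans ?_ hpLY)
        simpa using hm1
      refine ⟨x0, a :: m, ?_, hperm.nodup_iff.2 hnd, fun y hy => hmem y (hperm.mem_iff.1 hy), ?_⟩
      · have := hperm.length_eq; simp at this ⊢; omega
      · rw [List.cons_append, List.isChain_cons_cons]
        exact ⟨(hAX a (hLA a (by simp)) x0 hx0X).2, hm2⟩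
  · push Not at hex
    have hA : ∀ y ∈ x :: c, y ∈ A := fun y hy => by
      have := h3 y hy
      rw [Finset.mem_union] at this
      exact this.resolve_right (hex y hy)
    refine ⟨x, c, h1, h2, h3, ?_⟩
    refine List.IsChain.imp_of_mem_imp ?_ h4
    intro a b ha hb hab
    refine hB a (hA a ?_) b (hA b ?_) hab <;>
    simp only [List.mem_cons, List.mem_append, List.not_mem_nil, or_false] at ha hb ⊢ <;> tauto

theorem Qtwo {R B : V → V → Prop} (hRs : ∀ x y, R x y → R y x) (hBs : ∀ x y, B x y → B y x)
    {A X Y : Finset V} (hT : ∀ x ∈ A, ∀ y ∈ A, x ≠ y → R x y ∨ B x y)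
    {l : ℕ} (hl : 2 ≤ l) (hAX : Disjoint A X) (hAY : Disjoint A Y) (hXY : Disjoint X Y)
    (hX : ∀ x ∈ X, ∀ a ∈ A, R x a) (hY : ∀ x ∈ Y, ∀ a ∈ A, B x a)
    (hXc : X.card ≤ l) (hYc : Y.card ≤ l) (hc : 4 * l + 1 ≤ A.card + X.card + Y.card) :
    MC R (A ∪ X) (2 * l + 1) ∨ MC B (A ∪ Y) (2 * l + 1) := by
  have dAX := Finset.disjoint_left.1 hAX
  have dAY := Finset.disjoint_left.1 hAY
  have dXY := Finset.disjoint_left.1 hXY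
  let R' : V → V → Prop := fun x y =>
    (x ∈ A ∧ y ∈ A ∧ R x y) ∨ (x ∈ X ∧ y ∉ X) ∨ (y ∈ X ∧ x ∉ X)
  let B' : V → V → Prop := fun x y => (x ∈ A ∧ y ∈ A ∧ B x y) ∨ (x ∈ X ∧ y ∈ X) ∨
    (x ∈ Y ∧ y ∉ X) ∨ (y ∈ Y ∧ x ∉ X)
  have hScard : (A ∪ X ∪ Y).card = A.card + X.card + Y.card := by
    rw [Finset.card_union_of_disjoint (Finset.disjoint_union_left.2 ⟨hAY, hXY⟩),
      Finset.card_union_of_disjoint hAX]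
  have hram := ramsey (R := R') (B := B') (S := A ∪ X ∪ Y) (l := l) (by
      rintro x y (⟨h1, h2, h3⟩ | h | h)
      · exact Or.inl ⟨h2, h1, hRs _ _ h3⟩
      · exact Or.inr (Or.inr h)
      · exact Or.inr (Or.inl h)) (by
      rintro x y (⟨h1, h2, h3⟩ | h | h | h)
      · exact Or.inl ⟨h2, h1, hBs _ _ h3⟩
      · exact Or.inr (Or.inl h.symm)
      · exact Or.inr (Or.inr (Or.inr h))
      · exact Or.inr (Or.inr (Or.inl h))) (by
      intro x hx y hy hxy
      simp only [Finset.mem_union] at hx hy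
      by_cases h1 : x ∈ X <;> by_cases h2 : y ∈ X
      · exact Or.inr (Or.inr (Or.inl ⟨h1, h2⟩))
      · exact Or.inl (Or.inr (Or.inl ⟨h1, h2⟩))
      · exact Or.inl (Or.inr (Or.inr ⟨h2, h1⟩))
      · by_cases h3 : x ∈ Y
        · exact Or.inr (Or.inr (Or.inr (Or.inl ⟨h3, h2⟩)))
        · by_cases h4 : y ∈ Y
          · exact Or.inr (Or.inr (Or.inr (Or.inr ⟨h4, h1⟩)))
          · have hxA : x ∈ A := by tauto
            have hyA : y ∈ A := by tauto
            rcases hT x hxA y hyA hxy with h | h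
            · exact Or.inl (Or.inl ⟨hxA, hyA, h⟩)
            · exact Or.inr (Or.inl ⟨hxA, hyA, h⟩)) hl (by omega)
  rcases hram with h | h
  · left
    obtain ⟨x, c, h1, h2, h3, h4⟩ := h
    set T := (x :: c).toFinset with hTd
    have hTc : T.card = 2 * l + 1 := by
      rw [hTd, List.toFinset_card_of_nodup h2]; simpa using h1
    have hTS : T ⊆ A ∪ X ∪ Y := fun y hy => h3 y (by simpa [hTd] using hy)
    have hle : (T ∩ Y).card ≤ (A \ T).card := by
      have e1 : (A ∩ T).card + (T ∩ Y).card ≤ T.card := by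
        rw [← Finset.card_union_of_disjoint]
        · apply Finset.card_le_card
          intro v hv
          simp only [Finset.mem_union, Finset.mem_inter] at hv
          tauto
        · refine Finset.disjoint_left.2 fun v hv hv' => ?_
          simp only [Finset.mem_inter] at hv hv'
          exact dAY hv.1 hv'.2
      have e2 : (A \ T).card + (A ∩ T).card = A.card := Finset.card_sdiff_add_card_inter A T
      omega
    obtain ⟨U, hU, hUc⟩ := Finset.exists_subset_card_eq hle
    let e := Finset.equivOfCardEq hUc.symm
    let φ : V → V := fun v => if hv : v ∈ T ∩ Y then (e ⟨v, hv⟩ : V) else v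
    have hφY : ∀ v, v ∈ T → v ∈ Y → φ v ∈ A ∧ φ v ∉ T := by
      intro v h1 h2
      have hv : v ∈ T ∩ Y := Finset.mem_inter.2 ⟨h1, h2⟩
      have : φ v = (e ⟨v, hv⟩ : V) := by simp only [φ]; rw [dif_pos hv]
      rw [this]
      simpa using hU (e ⟨v, hv⟩).2
    have hφn : ∀ v, v ∉ Y → φ v = v := by
      intro v h2
      simp only [φ]; rw [dif_neg]; simp [h2]
    have hφinj : ∀ u ∈ T, ∀ v ∈ T, φ u = φ v → u = v := by
      intro u hu v hv huv
      by_cases h1 : u ∈ Y <;> by_cases h2 : v ∈ Y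
      · have hu' : u ∈ T ∩ Y := Finset.mem_inter.2 ⟨hu, h1⟩
        have hv' : v ∈ T ∩ Y := Finset.mem_inter.2 ⟨hv, h2⟩
        simp only [φ] at huv
        rw [dif_pos hu', dif_pos hv'] at huv
        have := e.injective (Subtype.ext huv)
        simpa using this
      · rw [hφn v h2] at huv
        exact absurd hv (huv ▸ (hφY u hu h1).2)
      · rw [hφn u h1] at huv
        exact absurd hu (huv ▸ (hφY v hv h2).2)
      · rwa [hφn u h1, hφn v h2] at huv
    have hTm : ∀ v ∈ x :: c, v ∈ T := fun v hv => by rw [hTd, List.mem_toFinset]; exact hv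
    have hφA : ∀ v ∈ T, v ∉ X → φ v ∈ A := by
      intro v hv hvX
      by_cases h : v ∈ Y
      · exact (hφY v hv h).1
      · rw [hφn v h]
        have := hTS hv
        simp only [Finset.mem_union] at this
        tauto
    refine ⟨φ x, c.map φ, by simpa using h1, ?_, ?_, ?_⟩
    · rw [← List.map_cons]
      exact List.Nodup.map_on (fun u hu v hv h => hφinj u (hTm u hu) v (hTm v hv) h) h2
    · rw [← List.map_cons]
      intro y hy
      obtain ⟨v, hv, rfl⟩ := List.mem_map.1 hy
      by_cases hvX : v ∈ X
      · rw [hφn v (dXY hvX)]; simp [hvX]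
      · simp [hφA v (hTm v hv) hvX]
    · have e1 : φ x :: (c.map φ ++ [φ x]) = (x :: (c ++ [x])).map φ := by simp
      rw [e1, List.isChain_map]
      refine List.IsChain.imp_of_mem_imp ?_ h4
      intro a b ha hb hab
      have ha' : a ∈ T := hTm a (by
        simp only [List.mem_cons, List.mem_append, List.not_mem_nil, or_false] at ha ⊢; tauto)
      have hb' : b ∈ T := hTm b (by
        simp only [List.mem_cons, List.mem_append, List.not_mem_nil, or_false] at hb ⊢; tauto)
      rcases hab with ⟨g1, g2, g3⟩ | ⟨g1, g2⟩ | ⟨g1, g2⟩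
      · rw [hφn a (dAY g1), hφn b (dAY g2)]; exact g3
      · rw [hφn a (dXY g1)]; exact hX a g1 _ (hφA b hb' g2)
      · rw [hφn b (dXY g1)]; exact hRs _ _ (hX b g1 _ (hφA a ha' g2))
  · right
    apply real_of_virtual (B' := B') hAY
      (fun a ha x hx => ⟨hBs _ _ (hY x hx a ha), hY x hx a ha⟩) ?_ hYc
    · obtain ⟨F, hF⟩ := h.exists_pcyc
      have hstep : ∀ i, F i ∈ X → F (i + 1) ∈ X := by
        intro i hi
        rcases hF.adj i with g | g | g | g
        · exact absurd hi (dAX g.1)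
        · exact g.2
        · exact absurd g.1 (dXY hi)
        · exact absurd hi g.2
      have hnot : ∀ i, F i ∉ X := by
        intro i hi
        have hall : ∀ n : ℕ, F (i + n) ∈ X := by
          intro n
          induction n with
          | zero => simpa using hi
          | succ n ih =>
            have := hstep _ ih
            rwa [show i + (n : ℤ) + 1 = i + ((n + 1 : ℕ) : ℤ) by push_cast; ring] at this
        have hsub : (Finset.range (2 * l + 1)).image (fun n : ℕ => F (i + n)) ⊆ X := by
          intro v hv
          obtain ⟨n, _, rfl⟩ := Finset.mem_image.1 hv
          exact hall n
        have := Finset.card_le_card hsub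
        rw [Finset.card_image_of_injOn, Finset.card_range] at this
        · omega
        · intro m hm n hn hmn
          simp only [Finset.coe_range, Set.mem_Iio] at hm hn
          rcases lt_trichotomy m n with h | h | h
          · exact absurd hmn (hF.ne (by omega) (by omega))
          · exact h
          · exact absurd hmn.symm (hF.ne (by omega) (by omega))
      refine MC.of_fun (by omega) (fun n => F n) ?_ ?_ ?_ ?_
      · intro n _
        have h1 := hF.mem n
        have h2 := hnot n
        simp only [Finset.mem_union] at h1 ⊢
        tauto
      · intro m n h1 h2
        exact hF.ne (by omega) (by omega)
      · intro n _
        have := hF.adj n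
        simpa using this
      · have := hF.adj ((2 * l + 1 - 1 : ℕ) : ℤ)
        rw [show ((2 * l + 1 - 1 : ℕ) : ℤ) + 1 = 0 + ((2 * l + 1 : ℕ) : ℤ) by omega, hF.per] at this
        simpa using this
    · intro a ha b hb hab
      rcases hab with g | g | g | g
      · exact g.2.2
      · exact absurd g.1 (dAX ha)
      · exact absurd g.1 (dAY ha)
      · exact absurd g.1 (dAY hb)

end Q2sec


set_option linter.unusedSectionVars false
set_option linter.unusedVariables false
set_option linter.unnecessarySimpa false

section Forest
variable {V : Type*} [DecidableEq V] [Fintype V] {ι : Type*}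

/-- Data for the forest lemmas. -/
structure FS (R B : V → V → Prop) (κ : V → ι) (l : ℕ) (W : Finset V) : Prop where
  rs : ∀ x y, R x y → R y x
  bs : ∀ x y, B x y → B y x
  tot : ∀ x ∈ W, ∀ y ∈ W, κ x ≠ κ y → R x y ∨ B x y
  hom : ∀ x ∈ W, ∀ x' ∈ W, ∀ y ∈ W, κ x = κ x' → κ x ≠ κ y → R x y → R x' y
  fib : ∀ T ⊆ W, (∀ x ∈ T, ∀ y ∈ T, κ x = κ y) → T.card ≤ l
  nb : ¬ MC B Finset.univ (2 * l + 1)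

theorem FS.mono {R B : V → V → Prop} {κ : V → ι} {l : ℕ} {W W' : Finset V} (h : FS R B κ l W)
    (hW : W' ⊆ W) : FS R B κ l W' where
  rs := h.rs
  bs := h.bs
  tot := fun x hx y hy => h.tot x (hW hx) y (hW hy)
  hom := fun x hx x' hx' y hy => h.hom x (hW hx) x' (hW hx') y (hW hy)
  fib := fun T hT => h.fib T (hT.trans hW)
  nb := h.nb

theorem FS.edge {R B : V → V → Prop} {κ : V → ι} {l : ℕ} {W : Finset V} (h : FS R B κ l W)
    (hl : 2 ≤ l) (hW : 2 * l + 1 ≤ W.card) :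
    ∃ x ∈ W, ∃ y ∈ W, x ≠ y ∧ R x y := by
  by_contra hcon
  push Not at hcon
  refine h.nb ((ML (R := B) (S := W) κ (by omega) ?_ h.fib hW).mono (Finset.subset_univ _) (fun _ _ _ _ h => h))
  intro x hx y hy hxy
  rcases h.tot x hx y hy hxy with h1 | h1
  · exact absurd h1 (hcon x hx y hy (fun e => hxy (by rw [e])))
  · exact h1

theorem FS.p3 {R B : V → V → Prop} {κ : V → ι} {l : ℕ} {W : Finset V} (h : FS R B κ l W)
    (hl : 2 ≤ l) (hW : 2 * l + 1 ≤ W.card) :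
    ∃ x ∈ W, ∃ y ∈ W, ∃ z ∈ W, x ≠ y ∧ y ≠ z ∧ x ≠ z ∧ R x y ∧ R y z := by
  classical
  by_contra hcon
  push Not at hcon
  let rel : V → V → Prop := fun x y => κ x = κ y ∨ (κ x ≠ κ y ∧ R x y)
  have ne : ∀ x y, κ x ≠ κ y → x ≠ y := fun x y h e => h (by rw [e])
  -- a crossing red edge has singleton parts
  have single : ∀ x ∈ W, ∀ y ∈ W, ∀ z ∈ W, κ x ≠ κ y → R x y → κ z = κ x → z = x := by
    intro x hx y hy z hz hxy hR hzx
    by_contra hne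
    have h1 : R z y := h.hom x hx z hz y hy hzx.symm hxy hR
    exact hcon x hx y hy z hz (ne _ _ hxy) (ne _ _ (by rw [hzx]; exact hxy.symm)) (Ne.symm hne) hR
      (h.rs _ _ h1)
  have symm : ∀ x y, rel x y → rel y x := by
    rintro x y (e | ⟨e, hR⟩)
    · exact Or.inl e.symm
    · exact Or.inr ⟨e.symm, h.rs _ _ hR⟩
  have trans : ∀ x ∈ W, ∀ y ∈ W, ∀ z ∈ W, rel x y → rel y z → rel x z := by
    rintro x hx y hy z hz (e | ⟨e, hR⟩) (e' | ⟨e', hR'⟩)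
    · exact Or.inl (e.trans e')
    · have := single y hy z hz x hx e' hR' e
      subst this; exact Or.inr ⟨e', hR'⟩
    · have := single y hy x hx z hz e.symm (h.rs _ _ hR) e'.symm
      subst this; exact Or.inr ⟨e, hR⟩
    · by_cases hxz : x = z
      · subst hxz; exact Or.inl rfl
      · exact absurd hR' (hcon x hx y hy z hz (ne _ _ e) (ne _ _ e') hxz hR)
  refine h.nb ((ML (R := B) (S := W) (fun x => W.filter (fun y => rel x y)) (by omega) ?_ ?_ hW).mono
    (Finset.subset_univ _) (fun _ _ _ _ h => h))
  · intro x hx y hy hxy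
    by_contra hB
    apply hxy
    have hr : rel x y := by
      by_cases e : κ x = κ y
      · exact Or.inl e
      · rcases h.tot x hx y hy e with h1 | h1
        · exact Or.inr ⟨e, h1⟩
        · exact absurd h1 hB
    ext z
    simp only [Finset.mem_filter]
    constructor
    · rintro ⟨hz, h1⟩; exact ⟨hz, trans y hy x hx z hz (symm _ _ hr) h1⟩
    · rintro ⟨hz, h1⟩; exact ⟨hz, trans x hx y hy z hz hr h1⟩
  · intro T hT hc
    have hrel : ∀ x ∈ T, ∀ y ∈ T, rel x y := by
      intro x hx y hy
      have h1 : y ∈ W.filter (fun z => rel y z) := Finset.mem_filter.2 ⟨hT hy, Or.inl rfl⟩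
      have h2 := hc x hx y hy
      rw [← h2] at h1
      exact (Finset.mem_filter.1 h1).2
    by_cases hk : ∀ x ∈ T, ∀ y ∈ T, κ x = κ y
    · exact h.fib T hT hk
    · push Not at hk
      obtain ⟨x, hx, y, hy, hxy⟩ := hk
      have hR : R x y := by
        rcases hrel x hx y hy with e | e
        · exact absurd e hxy
        · exact e.2
      have : T ⊆ {x, y} := by
        intro z hz
        simp only [Finset.mem_insert, Finset.mem_singleton]
        by_contra hne
        push Not at hne
        rcases hrel z hz x hx with e | e
        · exact hne.1 (single x (hT hx) y (hT hy) z (hT hz) hxy hR e)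
        · exact hcon y (hT hy) x (hT hx) z (hT hz) (ne _ _ hxy).symm hne.1.symm hne.2.symm
            (h.rs _ _ hR) (h.rs _ _ e.2)
      have h2 := Finset.card_le_card this
      have h3 := Finset.card_le_two (a := x) (b := y)
      omega

theorem FL0 {R B : V → V → Prop} {κ : V → ι} {l : ℕ} {W U : Finset V} (h : FS R B κ l W)
    (hl : 2 ≤ l) (hd : Disjoint U W) (hU : ∀ u ∈ U, ∀ w ∈ W, R u w) (hUc : l ≤ U.card)
    (hW : 2 * l + 1 ≤ W.card) : MC R Finset.univ (2 * l + 1) := by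
  obtain ⟨x, hx, y, hy, hxy, hR⟩ := h.edge hl hW
  exact KB (by omega) hd (fun a ha y hy => ⟨hU a ha y hy, h.rs _ _ (hU a ha y hy)⟩) hUc (by omega)
    hx hy hxy (Finset.subset_univ _) (Finset.subset_univ _) (h.rs _ _ hR)

theorem card_sdiff3 {W : Finset V} (x y z : V) : W.card ≤ (W \ {x, y, z}).card + 3 := by
  have h1 : W.card ≤ (W \ {x, y, z}).card + ({x, y, z} : Finset V).card := by
    have := Finset.le_card_sdiff ({x, y, z} : Finset V) W
    omega
  have := Finset.card_le_three (a := x) (b := y) (c := z)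
  omega

theorem FL1 {R B : V → V → Prop} {κ : V → ι} {l : ℕ} {W U : Finset V} (h : FS R B κ l W)
    (hl : 3 ≤ l) (hd : Disjoint U W) (hU : ∀ u ∈ U, ∀ w ∈ W, R u w) (hUc : l - 1 ≤ U.card)
    (hW : 2 * l + 4 ≤ W.card) : MC R Finset.univ (2 * l + 1) := by
  obtain ⟨x, hx, y, hy, z, hz, hxy, hyz, hxz, hR, hR'⟩ := h.p3 (by omega) (by omega)
  have hc := card_sdiff3 (W := W) x y z
  obtain ⟨p, hp, q, hq, hpq, hR2⟩ := (h.mono (W' := W \ {x, y, z}) Finset.sdiff_subset).edge (by omega)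
    (by omega)
  simp only [Finset.mem_sdiff, Finset.mem_insert, Finset.mem_singleton, not_or] at hp hq
  obtain ⟨u, hu⟩ := Finset.card_pos.1 (by omega : 0 < U.card)
  have huW : ∀ w ∈ W, u ≠ w := fun w hw e => Finset.disjoint_left.1 hd hu (e ▸ hw)
  have hdU : ∀ w ∈ W, w ∉ U := fun w hw e => Finset.disjoint_left.1 hd e hw
  have hc2 := card_sdiff3 (W := W) y z p
  refine bip_cycle (A := U.erase u) (B := W \ {y, z, p}) (b := q) (b' := x) (j := l - 3)
    (p := [y, z, u, p]) ?_ ?_ ?_ ?_ ?_ ?_ ?_ (Finset.subset_univ _) (Finset.subset_univ _) ?_ ?_ ?_ ?_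
  · exact Finset.disjoint_of_subset_left (Finset.erase_subset _ _)
      (Finset.disjoint_of_subset_right Finset.sdiff_subset hd)
  · intro a ha y hy
    have := hU a (Finset.mem_of_mem_erase ha) y (Finset.mem_sdiff.1 hy).1
    exact ⟨this, h.rs _ _ this⟩
  · rw [Finset.card_erase_of_mem hu]; omega
  · omega
  · simp [hq, hpq.symm]
  · simp [hx, hxy, hxz, Ne.symm hp.2.1]
  · exact hq.2.1
  · simp [hR, hR', h.rs _ _ (hU u hu z hz), hU u hu p hp.1, hR2]
  · simp [hyz, Ne.symm hp.2.2.1, Ne.symm hp.2.2.2, (huW y hy).symm, (huW z hz).symm, huW p hp.1]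
  · simp [hdU y hy, hdU z hz, hdU p hp.1, Finset.disjoint_left.1 hd hu]
  · simp; omega

theorem FL2 {R B : V → V → Prop} {κ : V → ι} {W U : Finset V} (h : FS R B κ 5 W)
    (hd : Disjoint U W) (hU : ∀ u ∈ U, ∀ w ∈ W, R u w) (hUc : 3 ≤ U.card)
    (hW : 16 ≤ W.card) : MC R Finset.univ (2 * 5 + 1) := by
  obtain ⟨x, hx, y, hy, z, hz, hxy, hyz, hxz, hR, hR'⟩ := h.p3 (by omega) (by omega)
  have hc := card_sdiff3 (W := W) x y z
  obtain ⟨x', hx', y', hy', z', hz', hxy', hyz', hxz', hS, hS'⟩ :=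
    (h.mono (W' := W \ {x, y, z}) Finset.sdiff_subset).p3 (by omega) (by omega)
  have hc2 := card_sdiff3 (W := W \ {x, y, z}) x' y' z'
  obtain ⟨p, hp, q, hq, hpq, hT⟩ := (h.mono (W' := insert x ((W \ {x, y, z}) \ {x', y', z'}))
    (by
      intro v hv
      rcases Finset.mem_insert.1 hv with rfl | hv
      · exact hx
      · exact (Finset.mem_sdiff.1 (Finset.mem_sdiff.1 hv).1).1)).edge (by omega)
    (by rw [Finset.card_insert_of_notMem (by simp)]; omega)
  obtain ⟨u, u', u'', h1, h2, h3⟩ : ∃ u u' u'', u ∈ U ∧ u' ∈ U.erase u ∧ u'' ∈ (U.erase u).erase u' := by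
    obtain ⟨u, hu⟩ := Finset.card_pos.1 (by omega : 0 < U.card)
    have e1 := Finset.card_erase_of_mem hu
    obtain ⟨u', hu'⟩ := Finset.card_pos.1 (by omega : 0 < (U.erase u).card)
    have e2 := Finset.card_erase_of_mem hu'
    obtain ⟨u'', hu''⟩ := Finset.card_pos.1 (by omega : 0 < ((U.erase u).erase u').card)
    exact ⟨u, u', u'', hu, hu', hu''⟩
  have hne : ∀ u ∈ U, ∀ w ∈ W, u ≠ w := fun u hu w hw e => Finset.disjoint_left.1 hd hu (e ▸ hw)
  simp only [Finset.mem_erase] at h2 h3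
  -- star case
  have star : ∀ w ∈ (W \ {x, y, z}) \ {x', y', z'}, R w x → MC R Finset.univ (2 * 5 + 1) := by
    intro w hw hwx
    obtain ⟨s, hs⟩ := Finset.card_pos.1 (by rw [Finset.card_erase_of_mem hw]; omega :
      0 < (((W \ {x, y, z}) \ {x', y', z'}).erase w).card)
    simp only [Finset.mem_erase, Finset.mem_sdiff, Finset.mem_insert, Finset.mem_singleton, not_or]
      at hs hw hx' hy' hz'
    have g1 := hne u h1
    have g2 := hne u' h2.2
    have g3 := hne u'' h3.2.2
    refine ⟨w, [x, y, z, u, x', y', z', u', s, u''], rfl, ?_, by simp, ?_⟩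
    · simp only [List.nodup_cons, List.mem_cons, List.not_mem_nil, not_or, or_false,
        not_false_eq_true, List.nodup_nil, and_true]
      grind
    · simp only [List.cons_append, List.nil_append, List.isChain_cons_cons, List.isChain_singleton,
        and_true]
      have e := h.rs
      refine ⟨hwx, hR, hR', e _ _ (hU u h1 z hz), hU u h1 x' hx'.1, hS, hS',
        e _ _ (hU u' h2.2 z' hz'.1), hU u' h2.2 s hs.2.1.1, e _ _ (hU u'' h3.2.2 s hs.2.1.1),
        hU u'' h3.2.2 w hw.1.1⟩
  rcases Finset.mem_insert.1 hp with hpx | hp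
  · rcases Finset.mem_insert.1 hq with hqx | hq
    · exact absurd (hpx.trans hqx.symm) hpq
    · subst hpx; exact star q hq (h.rs _ _ hT)
  rcases Finset.mem_insert.1 hq with hqx | hq
  · subst hqx; exact star p hp hT
  simp only [Finset.mem_sdiff, Finset.mem_insert, Finset.mem_singleton, not_or]
      at hp hq hx' hy' hz'
  have g1 := hne u h1
  have g2 := hne u' h2.2
  have g3 := hne u'' h3.2.2
  refine ⟨x, [y, z, u, x', y', z', u', p, q, u''], rfl, ?_, by simp, ?_⟩
  · simp only [List.nodup_cons, List.mem_cons, List.not_mem_nil, not_or, or_false,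
      not_false_eq_true, List.nodup_nil, and_true]
    grind
  · simp only [List.cons_append, List.nil_append, List.isChain_cons_cons, List.isChain_singleton,
      and_true]
    have e := h.rs
    exact ⟨hR, hR', e _ _ (hU u h1 z hz), hU u h1 x' hx'.1, hS, hS',
      e _ _ (hU u' h2.2 z' hz'.1), hU u' h2.2 p hp.1.1, hT, e _ _ (hU u'' h3.2.2 q hq.1.1),
      hU u'' h3.2.2 x hx⟩

/-- Combined forest lemma. -/
theorem FLall {R B : V → V → Prop} {κ : V → ι} {l : ℕ} {W U : Finset V} (h : FS R B κ l W)
    (hl : 2 ≤ l) (hl5 : l ≤ 5) (hd : Disjoint U W) (hU : ∀ u ∈ U, ∀ w ∈ W, R u w)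
    (hUc : l ≤ U.card ∧ 2 * l + 1 ≤ W.card ∨ 3 ≤ l ∧ l - 1 ≤ U.card ∧ 2 * l + 4 ≤ W.card ∨
      l = 5 ∧ 3 ≤ U.card ∧ 16 ≤ W.card) : MC R Finset.univ (2 * l + 1) := by
  rcases hUc with h1 | h1 | h1
  · exact FL0 h hl hd hU h1.1 h1.2
  · exact FL1 h h1.1 hd hU h1.2.1 h1.2.2
  · obtain ⟨rfl, h2, h3⟩ := h1
    exact FL2 h hd hU h2 h3

end Forest


set_option linter.unusedSectionVars false
set_option linter.unusedVariables false
set_option linter.unnecessarySimpa false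

section NoBig
variable {V : Type*} [DecidableEq V] [Fintype V] {ι : Type*} [DecidableEq ι]

theorem nb_half {R B : V → V → Prop} {κ : V → ι} {l : ℕ} {A X : Finset V} (h : FS R B κ l A)
    (hnR : ¬ MC R Finset.univ (2 * l + 1))
    (hl : 2 ≤ l) (hl5 : l ≤ 5) (hd : Disjoint X A) (hX : ∀ u ∈ X, ∀ w ∈ A, R u w)
    (hXc : X.card ≤ l) {p : V} (hp : p ∈ A) {W : Finset V}
    (hW : ∀ y ∈ W, y ∈ A ∧ κ p ≠ κ y ∧ R p y)
    (hc : 7 * l + 1 ≤ 2 * (W.card + X.card) + (A.filter (fun y => κ y = κ p)).card) :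
    (A.filter (fun y => κ y = κ p)).card + X.card + 1 ≤ l ∧
    ((A.filter (fun y => κ y = κ p)).card + X.card ≤ 1 ∨
     (4 ≤ l ∧ (A.filter (fun y => κ y = κ p)).card + X.card ≤ 2)) := by
  set P := A.filter (fun y => κ y = κ p) with hP
  have hPc : P.card ≤ l := by
    refine h.fib P (Finset.filter_subset _ _) ?_
    intro x hx y hy
    rw [(Finset.mem_filter.1 hx).2, (Finset.mem_filter.1 hy).2]
  have hP1 : 1 ≤ P.card := Finset.card_pos.2 ⟨p, Finset.mem_filter.2 ⟨hp, rfl⟩⟩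
  have hPX : Disjoint P X := by
    rw [Finset.disjoint_left]; intro x hx hx'
    exact Finset.disjoint_left.1 hd hx' (Finset.mem_filter.1 hx).1
  have hUc := Finset.card_union_of_disjoint hPX
  have hcon : ¬ (l ≤ (P ∪ X).card ∧ 2 * l + 1 ≤ W.card ∨
      3 ≤ l ∧ l - 1 ≤ (P ∪ X).card ∧ 2 * l + 4 ≤ W.card ∨
      l = 5 ∧ 3 ≤ (P ∪ X).card ∧ 16 ≤ W.card) := by
    intro hh
    refine hnR (FLall (W := W) (U := P ∪ X) (h.mono (fun y hy => (hW y hy).1)) hl hl5 ?_ ?_ hh)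
    · rw [Finset.disjoint_left]; intro x hx hx'
      rcases Finset.mem_union.1 hx with hx | hx
      · exact (hW x hx').2.1 (Finset.mem_filter.1 hx).2.symm
      · exact Finset.disjoint_left.1 hd hx (hW x hx').1
    · intro u hu w hw
      rcases Finset.mem_union.1 hu with hu | hu
      · have hu := Finset.mem_filter.1 hu
        exact h.hom p hp u hu.1 w (hW w hw).1 hu.2.symm (hW w hw).2.1 (hW w hw).2.2
      · exact hX u hu w (hW w hw).1
  rw [hUc] at hcon
  omega

theorem blow {R : V → V → Prop} {κ : V → ι} {A T : Finset V} {l : ℕ} (hl : l = 4 ∨ l = 5)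
    (hRs : ∀ x y, R x y → R y x)
    (hom : ∀ x ∈ A, ∀ x' ∈ A, ∀ y ∈ A, κ x = κ x' → κ x ≠ κ y → R x y → R x' y)
    (hT : T ⊆ A) (hinj : ∀ x ∈ T, ∀ y ∈ T, κ x = κ y → x = y)
    (τ : V → V) (hτA : ∀ x ∈ T, τ x ∈ A) (hτT : ∀ x ∈ T, τ x ∉ T) (hτ : ∀ x ∈ T, κ (τ x) = κ x)
    (h : MC R T (2 * (l - 2) + 1)) : MC R Finset.univ (2 * l + 1) := by
  have r1 : ∀ x ∈ T, ∀ y ∈ T, x ≠ y → R x y → R (τ x) y := by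
    intro x hx y hy hne hR
    exact hom x (hT hx) _ (hτA x hx) y (hT hy) (hτ x hx).symm (fun e => hne (hinj x hx y hy e)) hR
  have r2 : ∀ x ∈ T, ∀ y ∈ T, x ≠ y → R x y → R x (τ y) := by
    intro x hx y hy hne hR
    exact hRs _ _ (r1 y hy x hx hne.symm (hRs _ _ hR))
  have r3 : ∀ x ∈ T, ∀ y ∈ T, x ≠ y → R x y → R (τ x) (τ y) := by
    intro x hx y hy hne hR
    refine hom x (hT hx) _ (hτA x hx) _ (hτA y hy) (hτ x hx).symm ?_ (r2 x hx y hy hne hR)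
    rw [hτ y hy]
    exact (fun e => hne (hinj x hx y hy e))
  have n1 : ∀ x ∈ T, ∀ y ∈ T, x ≠ τ y := fun x hx y hy e => hτT y hy (e ▸ hx)
  have n2 : ∀ x ∈ T, ∀ y ∈ T, x ≠ y → τ x ≠ τ y := by
    intro x hx y hy hne e
    exact hne (hinj x hx y hy (by rw [← hτ x hx, ← hτ y hy, e]))
  obtain ⟨x0, L, h1, h2, h3, h4⟩ := h
  rcases hl with rfl | rfl
  · obtain ⟨x1, x2, x3, x4, rfl⟩ : ∃ x1 x2 x3 x4, L = [x1, x2, x3, x4] := by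
      match L, h1 with
      | [a, b, c, d], _ => exact ⟨a, b, c, d, rfl⟩
    simp only [List.nodup_cons, List.mem_cons, List.not_mem_nil, not_or, or_false,
        not_false_eq_true, List.nodup_nil, and_true] at h2
    simp only [List.mem_cons, List.not_mem_nil, or_false, forall_eq_or_imp, forall_eq] at h3
    simp only [List.cons_append, List.nil_append, List.isChain_cons_cons, List.isChain_singleton,
        and_true] at h4
    obtain ⟨m0, m1, m2, m3, m4⟩ := h3
    obtain ⟨c0, c1, c2, c3, c4⟩ := h4
    refine ⟨x0, [x1, τ x0, τ x1, x2, x3, τ x2, τ x3, x4], rfl, ?_, by simp, ?_⟩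
    · simp only [List.nodup_cons, List.mem_cons, List.not_mem_nil, not_or, or_false,
        not_false_eq_true, List.nodup_nil, and_true]
      grind
    · simp only [List.cons_append, List.nil_append, List.isChain_cons_cons, List.isChain_singleton,
        and_true]
      grind
  · obtain ⟨x1, x2, x3, x4, x5, x6, rfl⟩ : ∃ x1 x2 x3 x4 x5 x6, L = [x1, x2, x3, x4, x5, x6] := by
      match L, h1 with
      | [a, b, c, d, e, f], _ => exact ⟨a, b, c, d, e, f, rfl⟩
    simp only [List.nodup_cons, List.mem_cons, List.not_mem_nil, not_or, or_false,
        not_false_eq_true, List.nodup_nil, and_true] at h2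
    simp only [List.mem_cons, List.not_mem_nil, or_false, forall_eq_or_imp, forall_eq] at h3
    simp only [List.cons_append, List.nil_append, List.isChain_cons_cons, List.isChain_singleton,
        and_true] at h4
    obtain ⟨m0, m1, m2, m3, m4, m5, m6⟩ := h3
    obtain ⟨c0, c1, c2, c3, c4, c5, c6⟩ := h4
    refine ⟨x0, [x1, τ x0, τ x1, x2, x3, τ x2, τ x3, x4, x5, x6], rfl, ?_, by simp, ?_⟩
    · simp only [List.nodup_cons, List.mem_cons, List.not_mem_nil, not_or, or_false,
        not_false_eq_true, List.nodup_nil, and_true]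
      grind
    · simp only [List.cons_append, List.nil_append, List.isChain_cons_cons, List.isChain_singleton,
        and_true]
      grind

/-- No big parts: final Ramsey stage. -/
theorem nb_final {R B : V → V → Prop} {κ : V → ι} {l : ℕ} {A : Finset V} (h : FS R B κ l A)
    (h' : FS B R κ l A) (hl : 2 ≤ l) (hl5 : l ≤ 5) {a : ℕ}
    (hfa : ∀ T ⊆ A, (∀ x ∈ T, ∀ y ∈ T, κ x = κ y) → T.card ≤ a)
    (hc : a = 1 ∧ 4 * l + 1 ≤ A.card ∨ a = 2 ∧ 4 ≤ l ∧ 7 * l - 2 ≤ A.card) : False := by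
  have key : ∀ T ⊆ A, (∀ x ∈ T, ∀ y ∈ T, κ x = κ y → x = y) → T.card ≤ 4 * l := by
    intro T hT hinj
    by_contra hlt
    rcases ramsey (R := R) (B := B) (S := T) h.rs h.bs
      (fun x hx y hy hxy => h.tot x (hT hx) y (hT hy) (fun e => hxy (hinj x hx y hy e))) hl
      (by omega) with h1 | h1
    · exact h'.nb (h1.mono (Finset.subset_univ _) (fun _ _ _ _ h => h))
    · exact h.nb (h1.mono (Finset.subset_univ _) (fun _ _ _ _ h => h))
  have two : a = 1 → ∀ x ∈ A, ∀ y ∈ A, κ x = κ y → x = y := by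
    intro ha x hx y hy hxy
    by_contra hne
    have := hfa {x, y} (by intro z hz; simp at hz; rcases hz with rfl | rfl <;> assumption)
      (by intro u hu v hv; simp at hu hv; rcases hu with rfl | rfl <;> rcases hv with rfl | rfl <;> simp [hxy])
    rw [Finset.card_pair hne] at this
    omega
  rcases hc with ⟨ha, hc⟩ | ⟨ha, hl4, hc⟩
  · have := key A subset_rfl (two ha); omega
  -- maximal transversal
  obtain ⟨T, hTm, hTmax⟩ := Finset.exists_max_image
    (A.powerset.filter (fun T => ∀ x ∈ T, ∀ y ∈ T, κ x = κ y → x = y)) Finset.card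
    ⟨∅, by simp⟩
  simp only [Finset.mem_filter, Finset.mem_powerset] at hTm hTmax
  obtain ⟨hTA, hTi⟩ := hTm
  have tw : ∀ x ∈ A \ T, ∃ t ∈ T, κ t = κ x := by
    intro x hx
    by_contra hno
    push Not at hno
    obtain ⟨hxA, hxT⟩ := Finset.mem_sdiff.1 hx
    have := hTmax (insert x T) ⟨Finset.insert_subset hxA hTA, by
      intro u hu v hv e
      rcases Finset.mem_insert.1 hu with rfl | hu1 <;> rcases Finset.mem_insert.1 hv with rfl | hv1
      · rfl
      · exact absurd e.symm (hno v hv1)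
      · exact absurd e (hno u hu1)
      · exact hTi u hu1 v hv1 e⟩
    rw [Finset.card_insert_of_notMem hxT] at this
    omega
  have h1 := key T hTA hTi
  have hinj : ∀ x ∈ A \ T, ∀ y ∈ A \ T, κ x = κ y → x = y := by
    intro x hx y hy hxy
    by_contra hne
    obtain ⟨t, ht, htx⟩ := tw x hx
    obtain ⟨hxA, hxT⟩ := Finset.mem_sdiff.1 hx
    obtain ⟨hyA, hyT⟩ := Finset.mem_sdiff.1 hy
    have := hfa {x, y, t} (by
        intro z hz; simp at hz
        rcases hz with rfl | rfl | rfl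
        exacts [hxA, hyA, hTA ht])
      (by
        intro u hu v hv; simp at hu hv
        rcases hu with rfl | rfl | rfl <;> rcases hv with rfl | rfl | rfl <;> simp [hxy, htx])
    rw [Finset.card_eq_three.2 ⟨x, y, t, hne, fun e => hxT (e ▸ ht), fun e => hyT (e ▸ ht), rfl⟩]
      at this
    omega
  have hcard := Finset.card_sdiff_add_card_eq_card hTA
  choose! τ hτ using tw
  have hl45 : l = 4 ∨ l = 5 := by omega
  rcases ramsey (R := R) (B := B) (S := A \ T) (l := l - 2) h.rs h.bs
      (fun x hx y hy hxy => h.tot x (Finset.mem_sdiff.1 hx).1 y (Finset.mem_sdiff.1 hy).1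
        (fun e => hxy (hinj x hx y hy e))) (by omega)
      (by omega) with h1 | h1
  · exact h'.nb (blow hl45 h.rs h.hom Finset.sdiff_subset hinj τ (fun x hx => hTA (hτ x hx).1)
      (fun x hx e => (Finset.mem_sdiff.1 e).2 (hτ x hx).1) (fun x hx => (hτ x hx).2) h1)
  · exact h.nb (blow hl45 h.bs h'.hom Finset.sdiff_subset hinj τ (fun x hx => hTA (hτ x hx).1)
      (fun x hx e => (Finset.mem_sdiff.1 e).2 (hτ x hx).1) (fun x hx => (hτ x hx).2) h1)

/-- No big parts, after choosing the majority color red. -/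
theorem nb_red {R B : V → V → Prop} {κ : V → ι} {l : ℕ} {A X Y : Finset V} (h : FS R B κ l A)
    (h' : FS B R κ l A) (hl : 2 ≤ l) (hl5 : l ≤ 5) (hdX : Disjoint X A) (hdY : Disjoint Y A)
    (hX : ∀ u ∈ X, ∀ w ∈ A, R u w) (hY : ∀ u ∈ Y, ∀ w ∈ A, B u w)
    (hXc : X.card ≤ l) (hYc : Y.card ≤ l) (hA : 7 * l + 1 ≤ A.card + X.card + Y.card)
    {p : V} (hp : p ∈ A)
    (hmax : ∀ T ⊆ A, (∀ x ∈ T, ∀ y ∈ T, κ x = κ y) →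
      T.card ≤ (A.filter (fun y => κ y = κ p)).card) {W : Finset V}
    (hW : ∀ y ∈ W, y ∈ A ∧ κ p ≠ κ y ∧ R p y)
    (hc : 7 * l + 1 ≤ 2 * (W.card + X.card) + (A.filter (fun y => κ y = κ p)).card) : False := by
  have hh := nb_half h h'.nb hl hl5 hdX hX hXc hp hW hc
  have hP1 : 1 ≤ (A.filter (fun y => κ y = κ p)).card :=
    Finset.card_pos.2 ⟨p, Finset.mem_filter.2 ⟨hp, rfl⟩⟩
  have hcon : ¬ (l ≤ Y.card ∧ 2 * l + 1 ≤ A.card ∨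
      3 ≤ l ∧ l - 1 ≤ Y.card ∧ 2 * l + 4 ≤ A.card ∨
      l = 5 ∧ 3 ≤ Y.card ∧ 16 ≤ A.card) := by
    intro hh
    exact h.nb (FLall h' hl hl5 hdY hY hh)
  refine nb_final h h' hl hl5 hmax ?_
  omega

theorem nobig {R B : V → V → Prop} {κ : V → ι} {l : ℕ} {A X Y : Finset V} (h : FS R B κ l A)
    (h' : FS B R κ l A) (hl : 2 ≤ l) (hl5 : l ≤ 5) (hdX : Disjoint X A) (hdY : Disjoint Y A)
    (hX : ∀ u ∈ X, ∀ w ∈ A, R u w) (hY : ∀ u ∈ Y, ∀ w ∈ A, B u w)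
    (hXc : X.card ≤ l) (hYc : Y.card ≤ l) (hA : 7 * l + 1 ≤ A.card + X.card + Y.card) : False := by
  classical
  obtain ⟨p, hp, hmax⟩ := Finset.exists_max_image A (fun p => (A.filter (fun y => κ y = κ p)).card)
    (Finset.card_pos.1 (by omega))
  have hmax' : ∀ T ⊆ A, (∀ x ∈ T, ∀ y ∈ T, κ x = κ y) →
      T.card ≤ (A.filter (fun y => κ y = κ p)).card := by
    intro T hT hc
    rcases T.eq_empty_or_nonempty with rfl | ⟨t, ht⟩
    · simp
    · refine le_trans (Finset.card_le_card ?_) (hmax t (hT ht))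
      intro x hx
      exact Finset.mem_filter.2 ⟨hT hx, hc x hx t ht⟩
  have hcov : A ⊆ A.filter (fun y => κ y = κ p) ∪ (A.filter (fun y => κ p ≠ κ y ∧ R p y) ∪
      A.filter (fun y => κ p ≠ κ y ∧ B p y)) := by
    intro y hy
    simp only [Finset.mem_union, Finset.mem_filter]
    by_cases e : κ y = κ p
    · exact Or.inl ⟨hy, e⟩
    · rcases h.tot p hp y hy (Ne.symm e) with h1 | h1
      · exact Or.inr (Or.inl ⟨hy, Ne.symm e, h1⟩)
      · exact Or.inr (Or.inr ⟨hy, Ne.symm e, h1⟩)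
  have c1 := Finset.card_le_card hcov
  have c2 := Finset.card_union_le (A.filter (fun y => κ y = κ p)) (A.filter (fun y => κ p ≠ κ y ∧ R p y) ∪
      A.filter (fun y => κ p ≠ κ y ∧ B p y))
  have c3 := Finset.card_union_le (A.filter (fun y => κ p ≠ κ y ∧ R p y))
      (A.filter (fun y => κ p ≠ κ y ∧ B p y))
  by_cases hc : 7 * l + 1 ≤ 2 * ((A.filter (fun y => κ p ≠ κ y ∧ R p y)).card + X.card) +
      (A.filter (fun y => κ y = κ p)).card
  · exact nb_red h h' hl hl5 hdX hdY hX hY hXc hYc hA hp hmax'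
      (fun y hy => Finset.mem_filter.1 hy) hc
  · exact nb_red h' h hl hl5 hdY hdX hY hX hYc hXc (by omega) hp hmax'
      (fun y hy => Finset.mem_filter.1 hy) (by omega : 7 * l + 1 ≤
        2 * ((A.filter (fun y => κ p ≠ κ y ∧ B p y)).card + Y.card) + (A.filter (fun y => κ y = κ p)).card)

end NoBig


set_option linter.unusedSectionVars false
set_option linter.unusedVariables false
set_option linter.unnecessarySimpa false

section Step
variable {V : Type*} [DecidableEq V] [Fintype V] {ι : Type*} [DecidableEq ι]

/-- Data of the induction step: reduced to the two colors of the Gallai partition. -/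
structure SH (R B : V → V → Prop) (κ : V → ι) (l u s : ℕ) (A X Y : Finset V) : Prop where
  rs : ∀ x y, R x y → R y x
  bs : ∀ x y, B x y → B y x
  np : ∃ x ∈ A, ∃ y ∈ A, κ x ≠ κ y
  tot : ∀ x ∈ A, ∀ y ∈ A, κ x ≠ κ y → R x y ∨ B x y
  homR : ∀ x ∈ A, ∀ x' ∈ A, ∀ y ∈ A, κ x = κ x' → κ x ≠ κ y → R x y → R x' y
  homB : ∀ x ∈ A, ∀ x' ∈ A, ∀ y ∈ A, κ x = κ x' → κ x ≠ κ y → B x y → B x' y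
  nR : ¬ MC R Finset.univ (2 * l + 1)
  nB : ¬ MC B Finset.univ (2 * l + 1)
  dX : Disjoint X A
  dY : Disjoint Y A
  oX : ∀ x ∈ X, ∀ a ∈ A, R x a
  oY : ∀ x ∈ Y, ∀ a ∈ A, B x a
  cX : X.card ≤ l
  cY : Y.card ≤ l
  hl : 2 ≤ l
  hl5 : l ≤ 5
  hu : 2 * l ≤ u
  hs : 7 * l + s ≤ 4 * u
  d0 : ∀ P ⊆ A, (∀ x ∈ P, ∀ y ∈ P, x ≠ y → ¬ R x y) → (∀ x ∈ P, ∀ y ∈ P, x ≠ y → ¬ B x y) →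
    P.card + s ≤ u
  dr : ∀ P ⊆ A, ∀ Z : Finset V, (∀ x ∈ P, ∀ y ∈ P, x ≠ y → ¬ R x y) → Z.card ≤ l → Disjoint Z P →
    (∀ z ∈ Z, ∀ p ∈ P, B z p) → P.card + Z.card + s ≤ 2 * u
  db : ∀ P ⊆ A, ∀ Z : Finset V, (∀ x ∈ P, ∀ y ∈ P, x ≠ y → ¬ B x y) → Z.card ≤ l → Disjoint Z P →
    (∀ z ∈ Z, ∀ p ∈ P, R z p) → P.card + Z.card + s ≤ 2 * u
  d2 : ∀ P ⊂ A, ∀ Z Z' : Finset V, Z.card ≤ l → Z'.card ≤ l → Disjoint Z P → Disjoint Z' P →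
    (∀ z ∈ Z, ∀ p ∈ P, R z p) → (∀ z ∈ Z', ∀ p ∈ P, B z p) →
    P.card + Z.card + Z'.card + s ≤ 4 * u

variable {R B : V → V → Prop} {κ : V → ι} {l u s : ℕ} {A X Y : Finset V}

theorem SH.swap (h : SH R B κ l u s A X Y) : SH B R κ l u s A Y X where
  rs := h.bs
  bs := h.rs
  np := h.np
  tot := fun x hx y hy e => (h.tot x hx y hy e).symm
  homR := h.homB
  homB := h.homR
  nR := h.nB
  nB := h.nR
  dX := h.dY
  dY := h.dX
  oX := h.oY
  oY := h.oX
  cX := h.cY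
  cY := h.cX
  hl := h.hl
  hl5 := h.hl5
  hu := h.hu
  hs := h.hs
  d0 := fun P hP h1 h2 => h.d0 P hP h2 h1
  dr := h.db
  db := h.dr
  d2 := fun P hP Z Z' h1 h2 h3 h4 h5 h6 => by
    have := h.d2 P hP Z' Z h2 h1 h4 h3 h6 h5
    omega

/-- part of the partition -/
def part (κ : V → ι) (A : Finset V) (p : V) : Finset V := A.filter (fun y => κ y = κ p)

theorem mem_part {p x : V} : x ∈ part κ A p ↔ x ∈ A ∧ κ x = κ p := by
  simp [part]

theorem part_sub {p : V} : part κ A p ⊆ A := Finset.filter_subset _ _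

theorem part_disj {p q : V} (h : κ p ≠ κ q) : Disjoint (part κ A p) (part κ A q) := by
  rw [Finset.disjoint_left]
  intro x hx hy
  exact h ((mem_part.1 hx).2.symm.trans (mem_part.1 hy).2)

theorem SH.full (h : SH R B κ l u s A X Y) {p q : V} (hp : p ∈ A) (hq : q ∈ A) (hpq : κ p ≠ κ q)
    (hR : R p q) : ∀ x ∈ part κ A p, ∀ y ∈ part κ A q, R x y ∧ R y x := by
  intro x hx y hy
  rw [mem_part] at hx hy
  have h1 := h.homR p hp x hx.1 q hq hx.2.symm hpq hR
  have h2 := h.homR q hq y hy.1 x hx.1 hy.2.symm (by rw [hx.2]; exact hpq.symm) (h.rs _ _ h1)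
  exact ⟨h.rs _ _ h2, h2⟩

/-- no red inside a big part that is red to `l` vertices -/
theorem SH.noR (h : SH R B κ l u s A X Y) {P Q : Finset V} (hd : Disjoint P Q)
    (hR : ∀ x ∈ P, ∀ y ∈ Q, R x y) (hP : l ≤ P.card) (hQ : l + 1 ≤ Q.card) :
    ∀ x ∈ Q, ∀ y ∈ Q, x ≠ y → ¬ R x y := by
  intro x hx y hy hxy hr
  have := h.hl
  exact h.nR (KB (by omega) hd (fun a ha b hb => ⟨hR a ha b hb, h.rs _ _ (hR a ha b hb)⟩) hP hQ hx hy hxy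
    (Finset.subset_univ _) (Finset.subset_univ _) (h.rs _ _ hr))

theorem SH.noTri (h : SH R B κ l u s A X Y) {P Q : Finset V} (hd : Disjoint P Q)
    (hR : ∀ x ∈ P, ∀ y ∈ Q, R x y) (hP : l ≤ P.card) (hQ : l ≤ Q.card) {v a b : V}
    (hvP : v ∉ P) (hvQ : v ∉ Q) (ha : a ∈ P) (hb : b ∈ Q) (h1 : R v a) (h2 : R v b) : False :=
  h.nR (KP h.hl hd (fun a ha b hb => ⟨hR a ha b hb, h.rs _ _ (hR a ha b hb)⟩) hP hQ ha hb hvP hvQ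
    (Finset.subset_univ _) (Finset.subset_univ _) (Finset.mem_univ v) (h.rs _ _ h1) h2)

/-- external red set is empty -/
theorem SH.Xempty (h : SH R B κ l u s A X Y) {P Q : Finset V} (hPA : P ⊆ A) (hQA : Q ⊆ A)
    (hd : Disjoint P Q)
    (hR : ∀ x ∈ P, ∀ y ∈ Q, R x y) (hP : l ≤ P.card) (hQ : l ≤ Q.card) : X.card = 0 := by
  rw [Finset.card_eq_zero]
  by_contra hne
  obtain ⟨v, hv⟩ := Finset.nonempty_iff_ne_empty.2 hne
  have := h.hl
  obtain ⟨a, ha⟩ := Finset.card_pos.1 (by omega : 0 < P.card)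
  obtain ⟨b, hb⟩ := Finset.card_pos.1 (by omega : 0 < Q.card)
  have hvA : v ∉ A := Finset.disjoint_left.1 h.dX hv
  exact h.noTri hd hR hP hQ (fun e => hvA (hPA e)) (fun e => hvA (hQA e)) ha hb
    (h.oX v hv a (hPA ha)) (h.oX v hv b (hQA hb))

/-- The side lemma for blue. -/
theorem SH.side (h : SH R B κ l u s A X Y) {P D : Finset V} (hPA : P ⊆ A) (hDA : D ⊆ A)
    (hd : Disjoint D P) (hP : l + 1 ≤ P.card) (hB : ∀ x ∈ D, ∀ y ∈ P, B x y)
    (hf : ∀ T ⊆ D, (∀ x ∈ T, ∀ y ∈ T, κ x = κ y) → T.card ≤ l) :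
    D.card + Y.card ≤ 2 * l ∧ (l ≤ D.card + Y.card → ∀ x ∈ P, ∀ y ∈ P, x ≠ y → ¬ B x y) := by
  have hl := h.hl
  have hDY : Disjoint D Y := by
    rw [Finset.disjoint_left]; intro x hx hx'
    exact Finset.disjoint_left.1 h.dY hx' (hDA hx)
  have hc := Finset.card_union_of_disjoint hDY
  constructor
  · by_cases hD : D.card ≤ l
    · have := h.cY; omega
    · have h0 : Y.card = 0 := h.swap.Xempty hDA hPA hd hB (by omega) (by omega)
      have hnB := h.swap.noR hd.symm (fun x hx y hy => h.bs _ _ (hB y hy x hx)) (by omega)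
        (by omega : l + 1 ≤ D.card)
      by_contra hlt
      refine h.nR ((ML (R := R) (S := D) κ (by omega) ?_ hf (by omega)).mono (Finset.subset_univ _)
        (fun _ _ _ _ h => h))
      intro x hx y hy hxy
      rcases h.tot x (hDA hx) y (hDA hy) hxy with h1 | h1
      · exact h1
      · exact absurd h1 (hnB x hx y hy (fun e => hxy (by rw [e])))
  · intro hlc
    refine h.swap.noR (P := D ∪ Y) ?_ ?_ (by omega) hP
    · rw [Finset.disjoint_left]; intro x hx hx'
      rcases Finset.mem_union.1 hx with hx | hx
      · exact Finset.disjoint_left.1 hd hx hx'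
      · exact Finset.disjoint_left.1 h.dY hx (hPA hx')
    · intro x hx y hy
      rcases Finset.mem_union.1 hx with hx | hx
      · exact hB x hx y hy
      · exact h.oY x hx y (hPA hy)

theorem SH.unionY (h : SH R B κ l u s A X Y) {P D : Finset V} (hPA : P ⊆ A) (hDA : D ⊆ A)
    (hd : Disjoint D P) (hB : ∀ x ∈ D, ∀ y ∈ P, B x y) :
    (D ∪ Y).card = D.card + Y.card ∧ Disjoint (D ∪ Y) P ∧ ∀ x ∈ D ∪ Y, ∀ y ∈ P, B x y := by
  have hDY : Disjoint D Y := by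
    rw [Finset.disjoint_left]; intro x hx hx'
    exact Finset.disjoint_left.1 h.dY hx' (hDA hx)
  refine ⟨Finset.card_union_of_disjoint hDY, ?_, ?_⟩
  · rw [Finset.disjoint_left]; intro x hx hx'
    rcases Finset.mem_union.1 hx with hx | hx
    · exact Finset.disjoint_left.1 hd hx hx'
    · exact Finset.disjoint_left.1 h.dY hx (hPA hx')
  · intro x hx y hy
    rcases Finset.mem_union.1 hx with hx | hx
    · exact hB x hx y hy
    · exact h.oY x hx y (hPA hy)

theorem SH.half (h : SH R B κ l u s A X Y) {P D : Finset V} (hPA : P ⊆ A) (hDA : D ⊆ A)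
    (hd : Disjoint D P) (hP : l + 1 ≤ P.card) (hnR : ∀ x ∈ P, ∀ y ∈ P, x ≠ y → ¬ R x y)
    (hB : ∀ x ∈ D, ∀ y ∈ P, B x y)
    (hf : ∀ T ⊆ D, (∀ x ∈ T, ∀ y ∈ T, κ x = κ y) → T.card ≤ l) :
    P.card + D.card + Y.card + s ≤ 2 * u := by
  obtain ⟨h1, h2⟩ := h.side hPA hDA hd hP hB hf
  obtain ⟨e1, e2, e3⟩ := h.unionY hPA hDA hd hB
  have hu := h.hu
  by_cases hc : D.card + Y.card ≤ l
  · have := h.dr P hPA (D ∪ Y) hnR (by omega) e2 e3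
    omega
  · have := h.d0 P hPA hnR (h2 (by omega))
    omega

theorem SH.single (h : SH R B κ l u s A X Y) {p : V} (hp : p ∈ A)
    (hbig : l + 1 ≤ (part κ A p).card)
    (huniq : ∀ q ∈ A, κ q ≠ κ p → (part κ A q).card ≤ l) :
    A.card + X.card + Y.card + s ≤ 4 * u := by
  classical
  set P := part κ A p with hPdef
  set SR := A.filter (fun y => κ y ≠ κ p ∧ R p y) with hSR
  set SB := A.filter (fun y => κ y ≠ κ p ∧ B p y) with hSB
  have hPA : P ⊆ A := part_sub
  have hdR : Disjoint SR P := by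
    rw [Finset.disjoint_left]; intro x hx hx'
    exact (Finset.mem_filter.1 hx).2.1 (mem_part.1 hx').2
  have hdB : Disjoint SB P := by
    rw [Finset.disjoint_left]; intro x hx hx'
    exact (Finset.mem_filter.1 hx).2.1 (mem_part.1 hx').2
  have hR : ∀ x ∈ SR, ∀ y ∈ P, R x y := by
    intro x hx y hy
    obtain ⟨hxA, hxp, hr⟩ := Finset.mem_filter.1 hx
    exact (h.full hp hxA (Ne.symm hxp) hr y hy x (mem_part.2 ⟨hxA, rfl⟩)).2
  have hB : ∀ x ∈ SB, ∀ y ∈ P, B x y := by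
    intro x hx y hy
    obtain ⟨hxA, hxp, hr⟩ := Finset.mem_filter.1 hx
    exact (h.swap.full hp hxA (Ne.symm hxp) hr y hy x (mem_part.2 ⟨hxA, rfl⟩)).2
  have hf : ∀ T ⊆ A, (∀ x ∈ T, κ x ≠ κ p) → (∀ x ∈ T, ∀ y ∈ T, κ x = κ y) → T.card ≤ l := by
    intro T hT hn hc
    rcases T.eq_empty_or_nonempty with rfl | ⟨t, ht⟩
    · simp
    · refine le_trans (Finset.card_le_card ?_) (huniq t (hT ht) (hn t ht))
      intro x hx
      exact mem_part.2 ⟨hT hx, hc x hx t ht⟩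
  have hSRA : SR ⊆ A := Finset.filter_subset _ _
  have hSBA : SB ⊆ A := Finset.filter_subset _ _
  obtain ⟨r1, r2⟩ := h.swap.side hPA hSRA hdR hbig hR
    (fun T hT hc => hf T (hT.trans hSRA) (fun x hx => (Finset.mem_filter.1 (hT hx)).2.1) hc)
  obtain ⟨b1, b2⟩ := h.side hPA hSBA hdB hbig hB
    (fun T hT hc => hf T (hT.trans hSBA) (fun x hx => (Finset.mem_filter.1 (hT hx)).2.1) hc)
  have hcov : A ⊆ P ∪ (SR ∪ SB) := by
    intro y hy
    simp only [Finset.mem_union]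
    by_cases e : κ y = κ p
    · exact Or.inl (mem_part.2 ⟨hy, e⟩)
    · rcases h.tot p hp y hy (Ne.symm e) with h1 | h1
      · exact Or.inr (Or.inl (Finset.mem_filter.2 ⟨hy, e, h1⟩))
      · exact Or.inr (Or.inr (Finset.mem_filter.2 ⟨hy, e, h1⟩))
  have c1 := Finset.card_le_card hcov
  have c2 := Finset.card_union_le P (SR ∪ SB)
  have c3 := Finset.card_union_le SR SB
  have hu := h.hu
  by_cases hcR : l ≤ SR.card + X.card
  · have := h.dr P hPA ∅ (r2 hcR) (by simp) (by simp) (by simp)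
    rw [Finset.card_empty] at this
    omega
  by_cases hcB : l ≤ SB.card + Y.card
  · have := h.db P hPA ∅ (b2 hcB) (by simp) (by simp) (by simp)
    rw [Finset.card_empty] at this
    omega
  obtain ⟨e1, e2, e3⟩ := h.swap.unionY hPA hSRA hdR hR
  obtain ⟨f1, f2, f3⟩ := h.unionY hPA hSBA hdB hB
  have hPss : P ⊂ A := by
    refine Finset.ssubset_iff_subset_ne.2 ⟨hPA, fun e => ?_⟩
    obtain ⟨x, hx, y, hy, hxy⟩ := h.np
    rw [← e] at hx hy
    exact hxy ((mem_part.1 hx).2.trans (mem_part.1 hy).2.symm)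
  have := h.d2 P hPss (SR ∪ X) (SB ∪ Y) (by omega) (by omega) e2 f2 e3 f3
  omega

theorem SH.two (h : SH R B κ l u s A X Y) {p q : V} (hp : p ∈ A) (hq : q ∈ A) (hpq : κ p ≠ κ q)
    (hR : R p q) (hP : l + 1 ≤ (part κ A p).card) (hQ : l + 1 ≤ (part κ A q).card)
    (huniq : ∀ t ∈ A, κ t ≠ κ p → κ t ≠ κ q → (part κ A t).card ≤ l) :
    A.card + X.card + Y.card + s ≤ 4 * u := by
  classical
  have hfull := h.full hp hq hpq hR
  have hPQ : Disjoint (part κ A p) (part κ A q) := part_disj hpq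
  have nQ := h.noR hPQ (fun x hx y hy => (hfull x hx y hy).1) (by omega) hQ
  have nP := h.noR hPQ.symm (fun x hx y hy => (hfull y hy x hx).2) (by omega) hP
  have hX := h.Xempty part_sub part_sub hPQ (fun x hx y hy => (hfull x hx y hy).1) (by omega) (by omega)
  have pp : p ∈ part κ A p := mem_part.2 ⟨hp, rfl⟩
  have qq : q ∈ part κ A q := mem_part.2 ⟨hq, rfl⟩
  have gen : ∀ a ∈ A, l + 1 ≤ (part κ A a).card →
      (∀ x ∈ part κ A a, ∀ y ∈ part κ A a, x ≠ y → ¬ R x y) → (κ a = κ p ∨ κ a = κ q) →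
      (part κ A a).card + (A.filter (fun y => κ y ≠ κ p ∧ κ y ≠ κ q ∧ B a y)).card + Y.card + s ≤ 2 * u := by
    intro a ha hbig hn hor
    refine h.half part_sub (Finset.filter_subset _ _) ?_ hbig hn ?_ ?_
    · rw [Finset.disjoint_left]; intro x hx hx'
      have h1 := (Finset.mem_filter.1 hx).2
      have h2 := (mem_part.1 hx').2
      rcases hor with e | e
      · exact h1.1 (h2.trans e)
      · exact h1.2.1 (h2.trans e)
    · intro x hx y hy
      obtain ⟨hxA, hxp, hxq, hr⟩ := Finset.mem_filter.1 hx
      refine (h.swap.full ha hxA ?_ hr y hy x (mem_part.2 ⟨hxA, rfl⟩)).2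
      rcases hor with e | e
      · rw [e]; exact Ne.symm hxp
      · rw [e]; exact Ne.symm hxq
    · intro T hT hc
      rcases T.eq_empty_or_nonempty with rfl | ⟨t, ht⟩
      · simp
      · obtain ⟨hxA, hxp, hxq, hr⟩ := Finset.mem_filter.1 (hT ht)
        refine le_trans (Finset.card_le_card ?_) (huniq t hxA hxp hxq)
        intro x hx
        exact mem_part.2 ⟨(Finset.mem_filter.1 (hT hx)).1, hc x hx t ht⟩
  have g1 := gen p hp hP nP (Or.inl rfl)
  have g2 := gen q hq hQ nQ (Or.inr rfl)
  have hcov : A ⊆ (part κ A p ∪ (A.filter (fun y => κ y ≠ κ p ∧ κ y ≠ κ q ∧ B p y))) ∪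
      (part κ A q ∪ (A.filter (fun y => κ y ≠ κ p ∧ κ y ≠ κ q ∧ B q y))) := by
    intro y hy
    by_cases e : κ y = κ p
    · exact Finset.mem_union_left _ (Finset.mem_union_left _ (mem_part.2 ⟨hy, e⟩))
    by_cases e' : κ y = κ q
    · exact Finset.mem_union_right _ (Finset.mem_union_left _ (mem_part.2 ⟨hy, e'⟩))
    rcases h.tot p hp y hy (Ne.symm e) with h1 | h1
    · rcases h.tot q hq y hy (Ne.symm e') with h2 | h2
      · exact absurd (h.noTri hPQ (fun x hx y hy => (hfull x hx y hy).1) (by omega) (by omega)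
          (fun hh => e (mem_part.1 hh).2) (fun hh => e' (mem_part.1 hh).2) pp qq (h.rs _ _ h1)
          (h.rs _ _ h2)) id
      · exact Finset.mem_union_right _ (Finset.mem_union_right _ (Finset.mem_filter.2 ⟨hy, e, e', h2⟩))
    · exact Finset.mem_union_left _ (Finset.mem_union_right _ (Finset.mem_filter.2 ⟨hy, e, e', h1⟩))
  have c1 := Finset.card_le_card hcov
  have c2 := Finset.card_union_le (part κ A p ∪ (A.filter (fun y => κ y ≠ κ p ∧ κ y ≠ κ q ∧ B p y)))
      (part κ A q ∪ (A.filter (fun y => κ y ≠ κ p ∧ κ y ≠ κ q ∧ B q y)))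
  have c3 := Finset.card_union_le (part κ A p) (A.filter (fun y => κ y ≠ κ p ∧ κ y ≠ κ q ∧ B p y))
  have c4 := Finset.card_union_le (part κ A q) (A.filter (fun y => κ y ≠ κ p ∧ κ y ≠ κ q ∧ B q y))
  omega

/-- big-part triangle -/
theorem SH.tri (h : SH R B κ l u s A X Y) {p q v : V} (hp : p ∈ A) (hq : q ∈ A) (hpq : κ p ≠ κ q)
    (hR : R p q) (hP : l + 1 ≤ (part κ A p).card) (hQ : l + 1 ≤ (part κ A q).card)
    (hvp : κ v ≠ κ p) (hvq : κ v ≠ κ q) (h1 : R p v) (h2 : R q v) : False :=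
  h.noTri (part_disj hpq) (fun x hx y hy => (h.full hp hq hpq hR x hx y hy).1) (by omega) (by omega)
    (fun hh => hvp (mem_part.1 hh).2) (fun hh => hvq (mem_part.1 hh).2)
    (mem_part.2 ⟨hp, rfl⟩) (mem_part.2 ⟨hq, rfl⟩) (h.rs _ _ h1) (h.rs _ _ h2)

theorem SH.noRin (h : SH R B κ l u s A X Y) {p q : V} (hp : p ∈ A) (hq : q ∈ A) (hpq : κ p ≠ κ q)
    (hR : R p q) (hP : l + 1 ≤ (part κ A p).card) (hQ : l + 1 ≤ (part κ A q).card) :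
    ∀ x ∈ part κ A p, ∀ y ∈ part κ A p, x ≠ y → ¬ R x y :=
  h.noR (part_disj hpq.symm) (fun x hx y hy => (h.full hp hq hpq hR y hy x hx).2) (by omega) hP

theorem SH.four (h : SH R B κ l u s A X Y) {p q t y : V} (hp : p ∈ A) (hq : q ∈ A) (ht : t ∈ A)
    (hy : y ∈ A)
    (hpq : κ p ≠ κ q) (hpt : κ p ≠ κ t) (hqt : κ q ≠ κ t) (hyp : κ y ≠ κ p) (hyq : κ y ≠ κ q)
    (hyt : κ y ≠ κ t)
    (hRpq : R p q) (hRpt : R p t) (hBqt : B q t)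
    (hP : l + 1 ≤ (part κ A p).card) (hQ : l + 1 ≤ (part κ A q).card)
    (hT : l + 1 ≤ (part κ A t).card) (hY : l + 1 ≤ (part κ A y).card)
    (hrest : ∀ v ∈ A, κ v ≠ κ p → κ v ≠ κ q → κ v ≠ κ t → B p v) (hRyq : R y q) :
    A.card + X.card + Y.card + s ≤ 4 * u := by
  have hBpy := hrest y hy hyp hyq hyt
  have hX := h.Xempty part_sub part_sub (part_disj hpq)
    (fun x hx y hy => (h.full hp hq hpq hRpq x hx y hy).1) (by omega) (by omega)
  have hY0 := h.swap.Xempty part_sub part_sub (part_disj hqt)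
    (fun x hx y hy => (h.swap.full hq ht hqt hBqt x hx y hy).1) (by omega) (by omega)
  have qP := h.d0 _ part_sub (h.noRin hp hq hpq hRpq hP hQ)
    (h.swap.noRin hp hy hyp.symm hBpy hP hY)
  have qQ := h.d0 _ part_sub (h.noRin hq hp hpq.symm (h.rs _ _ hRpq) hQ hP)
    (h.swap.noRin hq ht hqt hBqt hQ hT)
  have qT := h.d0 _ part_sub (h.noRin ht hp hpt.symm (h.rs _ _ hRpt) hT hP)
    (h.swap.noRin ht hq hqt.symm (h.bs _ _ hBqt) hT hQ)
  have qY := h.d0 _ part_sub (h.noRin hy hq hyq hRyq hY hQ)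
    (h.swap.noRin hy hp hyp (h.bs _ _ hBpy) hY hP)
  have hcov : A ⊆ (part κ A p ∪ part κ A q) ∪ (part κ A t ∪ part κ A y) := by
    intro v hv
    by_contra hcon
    simp only [Finset.mem_union, mem_part, hv, true_and, not_or] at hcon
    obtain ⟨⟨vp, vq⟩, vt, vy⟩ := hcon
    have hBpv := hrest v hv vp vq vt
    have hRyv : R y v := by
      rcases h.tot y hy v hv (Ne.symm vy) with h1 | h1
      · exact h1
      · exact absurd (h.swap.tri hp hy hyp.symm hBpy hP hY vp vy hBpv h1) id
    have hBqv : B q v := by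
      rcases h.tot q hq v hv (Ne.symm vq) with h1 | h1
      · exact absurd (h.tri hy hq hyq hRyq hY hQ vy vq hRyv h1) id
      · exact h1
    have hRtv : R t v := by
      rcases h.tot t ht v hv (Ne.symm vt) with h1 | h1
      · exact h1
      · exact absurd (h.swap.tri hq ht hqt hBqt hQ hT vq vt hBqv h1) id
    have ne : ∀ x y, κ x ≠ κ y → x ≠ y := fun x y h e => h (by rw [e])
    refine h.nR (KP5 (Q := part κ A q) (P := part κ A p) (v := v) (y := y) (t := t) h.hl
      (part_disj hpq) (h.full hp hq hpq hRpq) (by omega) (by omega) (Finset.subset_univ _)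
      (Finset.subset_univ _) (Finset.mem_univ _) (Finset.mem_univ _) (Finset.mem_univ _)
      (ne _ _ vy) (ne _ _ vt) (ne _ _ hyt) (fun e => vp (mem_part.1 e).2) (fun e => vq (mem_part.1 e).2)
      (fun e => hyp (mem_part.1 e).2) (fun e => hyq (mem_part.1 e).2)
      (fun e => hpt.symm (mem_part.1 e).2) (fun e => hqt.symm (mem_part.1 e).2)
      (h.rs _ _ hRyv) ?_ ?_ hRtv)
    · intro q' hq'
      exact (h.full hy hq hyq hRyq y (mem_part.2 ⟨hy, rfl⟩) q' hq').1
    · intro p' hp'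
      exact (h.full hp ht hpt hRpt p' hp' t (mem_part.2 ⟨ht, rfl⟩)).1
  have c1 := Finset.card_le_card hcov
  have c2 := Finset.card_union_le (part κ A p ∪ part κ A q) (part κ A t ∪ part κ A y)
  have c3 := Finset.card_union_le (part κ A p) (part κ A q)
  have c4 := Finset.card_union_le (part κ A t) (part κ A y)
  omega

theorem SH.three (h : SH R B κ l u s A X Y) {p q t : V} (hp : p ∈ A) (hq : q ∈ A) (ht : t ∈ A)
    (hpq : κ p ≠ κ q) (hpt : κ p ≠ κ t) (hqt : κ q ≠ κ t)
    (hRpq : R p q) (hRpt : R p t) (hBqt : B q t)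
    (hP : l + 1 ≤ (part κ A p).card) (hQ : l + 1 ≤ (part κ A q).card)
    (hT : l + 1 ≤ (part κ A t).card) :
    A.card + X.card + Y.card + s ≤ 4 * u := by
  classical
  have hrest : ∀ v ∈ A, κ v ≠ κ p → κ v ≠ κ q → κ v ≠ κ t → B p v := by
    intro v hv vp vq vt
    rcases h.tot p hp v hv (Ne.symm vp) with h0 | h0
    · rcases h.tot q hq v hv (Ne.symm vq) with h1 | h1
      · exact absurd (h.tri hp hq hpq hRpq hP hQ vp vq h0 h1) id
      · rcases h.tot t ht v hv (Ne.symm vt) with h2 | h2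
        · exact absurd (h.tri hp ht hpt hRpt hP hT vp vt h0 h2) id
        · exact absurd (h.swap.tri hq ht hqt hBqt hQ hT vq vt h1 h2) id
    · exact h0
  by_cases hex : ∃ y ∈ A, κ y ≠ κ p ∧ κ y ≠ κ q ∧ κ y ≠ κ t ∧ l + 1 ≤ (part κ A y).card
  · obtain ⟨y, hy, yp, yq, yt, hY⟩ := hex
    rcases h.tot y hy q hq yq with h1 | h1
    · exact h.four hp hq ht hy hpq hpt hqt yp yq yt hRpq hRpt hBqt hP hQ hT hY hrest h1
    · have h2 : R y t := by
        rcases h.tot y hy t ht yt with h2 | h2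
        · exact h2
        · exact absurd (h.swap.tri hq ht hqt hBqt hQ hT yq yt (h.bs _ _ h1) (h.bs _ _ h2)) id
      exact h.four hp ht hq hy hpt hpq hqt.symm yp yt yq hRpt hRpq (h.bs _ _ hBqt) hP hT hQ hY
        (fun v hv a b c => hrest v hv a c b) h2
  · push Not at hex
    have hX := h.Xempty part_sub part_sub (part_disj hpq)
      (fun x hx y hy => (h.full hp hq hpq hRpq x hx y hy).1) (by omega) (by omega)
    have qQ := h.d0 _ part_sub (h.noRin hq hp hpq.symm (h.rs _ _ hRpq) hQ hP)
      (h.swap.noRin hq ht hqt hBqt hQ hT)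
    have qT := h.d0 _ part_sub (h.noRin ht hp hpt.symm (h.rs _ _ hRpt) hT hP)
      (h.swap.noRin ht hq hqt.symm (h.bs _ _ hBqt) hT hQ)
    have qP := h.half (P := part κ A p)
      (D := A.filter (fun v => κ v ≠ κ p ∧ κ v ≠ κ q ∧ κ v ≠ κ t)) part_sub (Finset.filter_subset _ _)
      (by
        rw [Finset.disjoint_left]; intro x hx hx'
        exact (Finset.mem_filter.1 hx).2.1 (mem_part.1 hx').2) hP
      (h.noRin hp hq hpq hRpq hP hQ)
      (by
        intro x hx y hy
        obtain ⟨hxA, xp, xq, xt⟩ := Finset.mem_filter.1 hx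
        exact (h.swap.full hp hxA (Ne.symm xp) (hrest x hxA xp xq xt) y hy x
          (mem_part.2 ⟨hxA, rfl⟩)).2)
      (by
        intro T hT hc
        rcases T.eq_empty_or_nonempty with rfl | ⟨w, hw⟩
        · simp
        · obtain ⟨hxA, xp, xq, xt⟩ := Finset.mem_filter.1 (hT hw)
          have := hex w hxA xp xq xt
          refine le_trans (Finset.card_le_card ?_) (Nat.lt_succ_iff.1 this)
          intro x hx
          exact mem_part.2 ⟨(Finset.mem_filter.1 (hT hx)).1, hc x hx w hw⟩)
    have hcov : A ⊆ (part κ A p ∪ A.filter (fun v => κ v ≠ κ p ∧ κ v ≠ κ q ∧ κ v ≠ κ t)) ∪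
        (part κ A q ∪ part κ A t) := by
      intro v hv
      simp only [Finset.mem_union, mem_part, Finset.mem_filter, hv, true_and]
      tauto
    have c1 := Finset.card_le_card hcov
    have c2 := Finset.card_union_le (part κ A p ∪ A.filter (fun v => κ v ≠ κ p ∧ κ v ≠ κ q ∧ κ v ≠ κ t))
      (part κ A q ∪ part κ A t)
    have c3 := Finset.card_union_le (part κ A p)
      (A.filter (fun v => κ v ≠ κ p ∧ κ v ≠ κ q ∧ κ v ≠ κ t))
    have c4 := Finset.card_union_le (part κ A q) (part κ A t)
    omega

theorem SH.main (h : SH R B κ l u s A X Y) : A.card + X.card + Y.card + s ≤ 4 * u := by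
  by_cases h1 : ∃ p ∈ A, l + 1 ≤ (part κ A p).card
  swap
  · push Not at h1
    by_contra hlt
    have hs := h.hs
    have hf : ∀ T ⊆ A, (∀ x ∈ T, ∀ y ∈ T, κ x = κ y) → T.card ≤ l := by
      intro T hT hc
      rcases T.eq_empty_or_nonempty with rfl | ⟨t, ht⟩
      · simp
      · refine le_trans (Finset.card_le_card ?_) (Nat.lt_succ_iff.1 (h1 t (hT ht)))
        intro x hx
        exact mem_part.2 ⟨hT hx, hc x hx t ht⟩
    exact nobig (R := R) (B := B) (κ := κ) (l := l) (A := A) (X := X) (Y := Y)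
      ⟨h.rs, h.bs, h.tot, h.homR, hf, h.nB⟩ ⟨h.bs, h.rs, h.swap.tot, h.homB, hf, h.nR⟩ h.hl h.hl5 h.dX
      h.dY h.oX h.oY h.cX h.cY (by omega)
  obtain ⟨p, hp, hP⟩ := h1
  by_cases h2 : ∃ q ∈ A, κ q ≠ κ p ∧ l + 1 ≤ (part κ A q).card
  swap
  · push Not at h2
    exact h.single hp hP (fun q hq hne => Nat.lt_succ_iff.1 (h2 q hq hne))
  obtain ⟨q, hq, hqp, hQ⟩ := h2
  by_cases h3 : ∃ t ∈ A, κ t ≠ κ p ∧ κ t ≠ κ q ∧ l + 1 ≤ (part κ A t).card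
  swap
  · push Not at h3
    rcases h.tot p hp q hq hqp.symm with h4 | h4
    · exact h.two hp hq hqp.symm h4 hP hQ (fun q hq h1 h2 => Nat.lt_succ_iff.1 (h3 q hq h1 h2))
    · have := h.swap.two hp hq hqp.symm h4 hP hQ (fun q hq h1 h2 => Nat.lt_succ_iff.1 (h3 q hq h1 h2))
      omega
  obtain ⟨t, ht, htp, htq, hT⟩ := h3
  have h' := h.swap
  have conv : A.card + Y.card + X.card + s ≤ 4 * u → A.card + X.card + Y.card + s ≤ 4 * u := by omega
  have rs := h.rs
  have bs := h.bs
  rcases h.tot p hp q hq hqp.symm with a | a <;> rcases h.tot p hp t ht htp.symm with b | b <;>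
    rcases h.tot q hq t ht htq.symm with c | c
  · exact absurd (h.tri hp hq hqp.symm a hP hQ htp htq b c) id
  · exact h.three hp hq ht hqp.symm htp.symm htq.symm a b c hP hQ hT
  · exact h.three hq hp ht hqp htq.symm htp.symm (rs _ _ a) c b hQ hP hT
  · exact conv (h'.three ht hp hq htp htq hqp.symm (bs _ _ b) (bs _ _ c) a hT hP hQ)
  · exact h.three ht hp hq htp htq hqp.symm (rs _ _ b) (rs _ _ c) a hT hP hQ
  · exact conv (h'.three hq hp ht hqp htq.symm htp.symm (bs _ _ a) c b hQ hP hT)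
  · exact conv (h'.three hp hq ht hqp.symm htp.symm htq.symm a b c hP hQ hT)
  · exact absurd (h'.tri hp hq hqp.symm a hP hQ htp htq b c) id

end Step


set_option linter.unusedSectionVars false
set_option linter.unusedVariables false
set_option linter.unnecessarySimpa false

section MainQ
variable {V : Type*} [DecidableEq V] [Fintype V] {α : Type*} [DecidableEq α]

/-- Hypotheses of the main claim. -/
structure QH (col : V → V → α) (l : ℕ) (K : Finset α) (A : Finset V) (X : α → Finset V) : Prop where
  edge : ∀ x ∈ A, ∀ y ∈ A, x ≠ y → col x y ∈ K
  card : ∀ i ∈ K, (X i).card ≤ l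
  disj : ∀ i ∈ K, Disjoint (X i) A
  out : ∀ i ∈ K, ∀ x ∈ X i, ∀ a ∈ A, col x a = i

theorem Qone {col : V → V → α} {l : ℕ} {i : α} {A : Finset V} {X : α → Finset V}
    (hc : GalCol col) (hno : ∀ i, ¬ MC (fun x y => col x y = i) Finset.univ (2 * l + 1))
    (hl : 2 ≤ l) (h : QH col l {i} A X) : A.card + (X i).card ≤ l * 2 := by
  classical
  by_contra hlt
  have hi : i ∈ ({i} : Finset α) := Finset.mem_singleton_self i
  have hd := h.disj i hi
  have hcard := Finset.card_union_of_disjoint hd.symm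
  refine hno i ((ML (R := fun x y => col x y = i) (S := A ∪ X i)
    (fun x => if x ∈ X i then (none : Option V) else some x) (by omega) ?_ ?_ (by omega)).mono
    (Finset.subset_univ _) (fun _ _ _ _ h => h))
  · intro x hx y hy hxy
    by_cases h1 : x ∈ X i <;> by_cases h2 : y ∈ X i
    · simp [h1, h2] at hxy
    · have hy' : y ∈ A := by simpa [h2] using hy
      exact h.out i hi x h1 y hy'
    · have hx' : x ∈ A := by simpa [h1] using hx
      rw [hc.1]; exact h.out i hi y h2 x hx'
    · have hx' : x ∈ A := by simpa [h1] using hx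
      have hy' : y ∈ A := by simpa [h2] using hy
      simp only [h1, h2, if_false, ne_eq, Option.some.injEq] at hxy
      exact Finset.mem_singleton.1 (h.edge x hx' y hy' hxy)
  · intro T hT hk
    by_cases hTX : T ⊆ X i
    · exact (Finset.card_le_card hTX).trans (h.card i hi)
    · obtain ⟨t, ht, htX⟩ := Finset.not_subset.1 hTX
      have : T ⊆ {t} := by
        intro x hx
        have := hk x hx t ht
        simp only [htX, if_false] at this
        by_cases hxX : x ∈ X i
        · simp [hxX] at this
        · simpa [hxX] using this
      have := Finset.card_le_card this
      simp at this; omega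

theorem Qtwo' {col : V → V → α} {l : ℕ} {r b : α} (hrb : r ≠ b) {A : Finset V} {X : α → Finset V}
    (hc : GalCol col) (hno : ∀ i, ¬ MC (fun x y => col x y = i) Finset.univ (2 * l + 1))
    (hl : 2 ≤ l) (hA : 1 ≤ A.card) (h : QH col l {r, b} A X) :
    A.card + ((X r).card + (X b).card) ≤ l * 4 := by
  by_contra hlt
  have hr : r ∈ ({r, b} : Finset α) := by simp
  have hb : b ∈ ({r, b} : Finset α) := by simp
  obtain ⟨a, ha⟩ := Finset.card_pos.1 (by omega : 0 < A.card)
  have hXY : Disjoint (X r) (X b) := by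
    rw [Finset.disjoint_left]; intro x hx hx'
    exact hrb ((h.out r hr x hx a ha).symm.trans (h.out b hb x hx' a ha))
  rcases Qtwo (R := fun x y => col x y = r) (B := fun x y => col x y = b) (A := A) (X := X r)
    (Y := X b) (l := l) (fun x y e => by rw [hc.1]; exact e) (fun x y e => by rw [hc.1]; exact e)
    (fun x hx y hy hxy => by simpa using h.edge x hx y hy hxy) hl (h.disj r hr).symm
    (h.disj b hb).symm hXY (h.out r hr) (h.out b hb) (h.card r hr) (h.card b hb) (by omega) with h1 | h1
  · exact hno r (h1.mono (Finset.subset_univ _) (fun _ _ _ _ h => h))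
  · exact hno b (h1.mono (Finset.subset_univ _) (fun _ _ _ _ h => h))

theorem sum_split {K : Finset α} {f : α → ℕ} {r b : α} (hr : r ∈ K) (hb : b ∈ K) (hrb : r ≠ b) :
    ∑ i ∈ K, f i = f r + f b + ∑ i ∈ (K.erase r).erase b, f i := by
  rw [← Finset.add_sum_erase K f hr, ← Finset.add_sum_erase (K.erase r) f
    (Finset.mem_erase.2 ⟨hrb.symm, hb⟩)]
  ring

theorem Qmain {col : V → V → α} {l : ℕ}
    (hc : GalCol col) (hno : ∀ i, ¬ MC (fun x y => col x y = i) Finset.univ (2 * l + 1))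
    (hl : 2 ≤ l) (hl5 : l ≤ 5) : ∀ (n : ℕ) (K : Finset α) (A : Finset V) (X : α → Finset V),
    A.card + K.card = n → QH col l K A X → A.card + ∑ i ∈ K, (X i).card ≤ l * 2 ^ K.card := by
  classical
  intro n
  induction n using Nat.strong_induction_on with
  | _ n IH' =>
  intro K A X hn h
  have IH : ∀ (K' : Finset α) (A' : Finset V) (X' : α → Finset V), A'.card + K'.card < A.card + K.card →
      QH col l K' A' X' → A'.card + ∑ i ∈ K', (X' i).card ≤ l * 2 ^ K'.card :=
    fun K' A' X' hlt => IH' _ (hn ▸ hlt) K' A' X' rfl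
  clear IH'
  have hsum : ∀ K' ⊆ K, ∑ i ∈ K', (X i).card ≤ K'.card * l := fun K' hK' =>
    Finset.sum_le_card_nsmul _ _ _ (fun i hi => h.card i (hK' hi))
  by_cases hA : A.card ≤ 1
  · have h1 := hsum K subset_rfl
    have h2 : K.card + 1 ≤ 2 ^ K.card := Nat.lt_two_pow_self
    have h3 := Nat.mul_le_mul_left l h2
    have : l * (K.card + 1) = K.card * l + l := by ring
    omega
  have hK0 : K.card ≠ 0 := by
    intro h0
    obtain ⟨x, hx, y, hy, hxy⟩ := Finset.one_lt_card.1 (by omega : 1 < A.card)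
    have := h.edge x hx y hy hxy
    rw [Finset.card_eq_zero.1 h0] at this
    simp at this
  by_cases hK1 : K.card = 1
  · obtain ⟨i, rfl⟩ := Finset.card_eq_one.1 hK1
    have := Qone hc hno hl h
    simpa using this
  by_cases hK2 : K.card = 2
  · obtain ⟨r, b, hrb, rfl⟩ := Finset.card_eq_two.1 hK2
    have := Qtwo' hrb hc hno hl (by omega) h
    rw [Finset.sum_pair hrb, hK2]
    omega
  -- main case
  obtain ⟨i, j, κ, hnp, hcr, hhom⟩ := gallai hc (by omega : 2 ≤ A.card)
  obtain ⟨T, hT1, hT2, hT3⟩ := Finset.exists_subsuperset_card_eq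
    (Finset.filter_subset (fun c => c = i ∨ c = j) K) (n := 2)
    ((Finset.card_le_card (by intro c hc; simpa using (Finset.mem_filter.1 hc).2 :
      K.filter (fun c => c = i ∨ c = j) ⊆ {i, j})).trans Finset.card_le_two) (by omega)
  obtain ⟨r, b, hrb, rfl⟩ := Finset.card_eq_two.1 hT3
  have hr : r ∈ K := hT2 (by simp)
  have hb : b ∈ K := hT2 (by simp)
  have ne : ∀ x y, κ x ≠ κ y → x ≠ y := fun x y h e => h (by rw [e])
  have tot : ∀ x ∈ A, ∀ y ∈ A, κ x ≠ κ y → col x y = r ∨ col x y = b := by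
    intro x hx y hy hxy
    have := hT1 (Finset.mem_filter.2 ⟨h.edge x hx y hy (ne _ _ hxy), hcr x hx y hy hxy⟩)
    simpa using this
  have hbr : b ∈ K.erase r := Finset.mem_erase.2 ⟨hrb.symm, hb⟩
  have hrb' : r ∈ K.erase b := Finset.mem_erase.2 ⟨hrb, hr⟩
  have ce1 : (K.erase r).card = K.card - 1 := Finset.card_erase_of_mem hr
  have ce1' : (K.erase b).card = K.card - 1 := Finset.card_erase_of_mem hb
  have ce2 : ((K.erase r).erase b).card = K.card - 2 := by
    rw [Finset.card_erase_of_mem hbr, ce1]; omega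
  obtain ⟨k, hk⟩ : ∃ k, K.card = k + 3 := ⟨K.card - 3, by omega⟩
  have p1 : 2 ^ (K.card - 1) = 2 * 2 ^ (K.card - 2) := by
    rw [hk, show k + 3 - 1 = (k + 3 - 2) + 1 by omega, pow_succ]; ring
  have p2 : 2 ^ K.card = 4 * 2 ^ (K.card - 2) := by
    rw [hk, show k + 3 = (k + 3 - 2) + 2 by omega, pow_add]
    simp; ring
  have hkk : k + 1 ≤ 2 ^ k := Nat.lt_two_pow_self
  have p3 : 2 ^ (K.card - 2) = 2 * 2 ^ k := by
    rw [hk, show k + 3 - 2 = k + 1 by omega, pow_succ]; ring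
  set K0 := (K.erase r).erase b with hK0def
  have hK0K : K0 ⊆ K := (Finset.erase_subset _ _).trans (Finset.erase_subset _ _)
  have hmem0 : ∀ i ∈ K0, i ∈ K ∧ i ≠ r ∧ i ≠ b := by
    intro i hi
    simp only [hK0def, Finset.mem_erase] at hi
    exact ⟨hi.2.2, hi.2.1, hi.1⟩
  have hs0 : ∑ i ∈ K0, (X i).card ≤ (k + 1) * l := by
    have := hsum K0 hK0K
    rw [ce2, hk] at this
    exact this
  have sr : ∀ f : α → ℕ, ∑ i ∈ K.erase r, f i = f b + ∑ i ∈ K0, f i := fun f =>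
    (Finset.add_sum_erase (K.erase r) f hbr).symm
  have sb : ∀ f : α → ℕ, ∑ i ∈ K.erase b, f i = f r + ∑ i ∈ K0, f i := fun f => by
    rw [hK0def, Finset.erase_right_comm]
    exact (Finset.add_sum_erase (K.erase b) f hrb').symm
  have main : A.card + (X r).card + (X b).card + ∑ i ∈ K0, (X i).card ≤ 4 * (l * 2 ^ (K.card - 2)) := by
    refine SH.main (R := fun x y => col x y = r) (B := fun x y => col x y = b) (κ := κ) (l := l)
      (u := l * 2 ^ (K.card - 2)) ?_
    refine
      { rs := fun x y e => by rw [hc.1]; exact e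
        bs := fun x y e => by rw [hc.1]; exact e
        np := hnp
        tot := tot
        homR := ?_
        homB := ?_
        nR := hno r
        nB := hno b
        dX := h.disj r hr
        dY := h.disj b hb
        oX := h.out r hr
        oY := h.out b hb
        cX := h.card r hr
        cY := h.card b hb
        hl := hl
        hl5 := hl5
        hu := ?_
        hs := ?_
        d0 := ?_
        dr := ?_
        db := ?_
        d2 := ?_ }
    · intro x hx x' hx' y hy e1 e2 e3
      have e3 : col x y = r := e3
      show col x' y = r
      rw [← hhom x hx x' hx' y hy e1 e2, e3]
    · intro x hx x' hx' y hy e1 e2 e3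
      have e3 : col x y = b := e3
      show col x' y = b
      rw [← hhom x hx x' hx' y hy e1 e2, e3]
    · rw [p3]; nlinarith
    · rw [p3]; nlinarith
    · intro P hP hnR hnB
      have hPc := Finset.card_le_card hP
      have := IH K0 P X (by omega)
        { edge := by
            intro x hx y hy hxy
            simp only [hK0def, Finset.mem_erase]
            exact ⟨hnB x hx y hy hxy, hnR x hx y hy hxy, h.edge x (hP hx) y (hP hy) hxy⟩
          card := fun i hi => h.card i (hK0K hi)
          disj := fun i hi => Finset.disjoint_of_subset_right hP (h.disj i (hK0K hi))
          out := fun i hi x hx a ha => h.out i (hK0K hi) x hx a (hP ha) }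
      rw [ce2] at this
      exact this
    · intro P hP Z hnR hZ hZP hZB
      have hPc := Finset.card_le_card hP
      have := IH (K.erase r) P (Function.update X b Z) (by omega)
        { edge := by
            intro x hx y hy hxy
            simp only [Finset.mem_erase]
            exact ⟨hnR x hx y hy hxy, h.edge x (hP hx) y (hP hy) hxy⟩
          card := by
            intro i hi
            by_cases hib : i = b
            · subst hib; simpa using hZ
            · simpa [hib] using h.card i (Finset.mem_of_mem_erase hi)
          disj := by
            intro i hi
            by_cases hib : i = b
            · subst hib; simpa using hZP
            · simpa [hib] using
                Finset.disjoint_of_subset_right hP (h.disj i (Finset.mem_of_mem_erase hi))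
          out := by
            intro i hi x hx a ha
            by_cases hib : i = b
            · subst hib
              simp only [Function.update_self] at hx
              exact hZB x hx a ha
            · simp only [ne_eq, hib, not_false_eq_true, Function.update_of_ne] at hx
              exact h.out i (Finset.mem_of_mem_erase hi) x hx a (hP ha) }
      rw [sr, ce1, p1, Function.update_self, Finset.sum_congr rfl (g := fun i => (X i).card)
        (fun i hi => by rw [Function.update_of_ne (hmem0 i hi).2.2])] at this
      have e : l * (2 * 2 ^ (K.card - 2)) = 2 * (l * 2 ^ (K.card - 2)) := by ring
      omega
    · intro P hP Z hnR hZ hZP hZB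
      have hPc := Finset.card_le_card hP
      have := IH (K.erase b) P (Function.update X r Z) (by omega)
        { edge := by
            intro x hx y hy hxy
            simp only [Finset.mem_erase]
            exact ⟨hnR x hx y hy hxy, h.edge x (hP hx) y (hP hy) hxy⟩
          card := by
            intro i hi
            by_cases hib : i = r
            · subst hib; simpa using hZ
            · simpa [hib] using h.card i (Finset.mem_of_mem_erase hi)
          disj := by
            intro i hi
            by_cases hib : i = r
            · subst hib; simpa using hZP
            · simpa [hib] using
                Finset.disjoint_of_subset_right hP (h.disj i (Finset.mem_of_mem_erase hi))
          out := by
            intro i hi x hx a ha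
            by_cases hib : i = r
            · subst hib
              simp only [Function.update_self] at hx
              exact hZB x hx a ha
            · simp only [ne_eq, hib, not_false_eq_true, Function.update_of_ne] at hx
              exact h.out i (Finset.mem_of_mem_erase hi) x hx a (hP ha) }
      rw [sb, ce1', p1, Function.update_self, Finset.sum_congr rfl (g := fun i => (X i).card)
        (fun i hi => by rw [Function.update_of_ne (hmem0 i hi).2.1])] at this
      have e : l * (2 * 2 ^ (K.card - 2)) = 2 * (l * 2 ^ (K.card - 2)) := by ring
      omega
    · intro P hP Z Z' hZ hZ' hZP hZP' hZR hZB
      have hPc := Finset.card_lt_card hP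
      have hPA := hP.1
      let X' : α → Finset V := fun i => if i = r then Z else if i = b then Z' else X i
      have X'r : X' r = Z := by simp [X']
      have X'b : X' b = Z' := by simp [X', hrb.symm]
      have X'o : ∀ i, i ≠ r → i ≠ b → X' i = X i := by intro i h1 h2; simp [X', h1, h2]
      have := IH K P X' (by omega)
        { edge := fun x hx y hy hxy => h.edge x (hPA hx) y (hPA hy) hxy
          card := by
            intro i hi
            by_cases hir : i = r
            · subst hir; rw [X'r]; exact hZ
            by_cases hib : i = b
            · subst hib; rw [X'b]; exact hZ'
            · rw [X'o i hir hib]; exact h.card i hi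
          disj := by
            intro i hi
            by_cases hir : i = r
            · subst hir; rw [X'r]; exact hZP
            by_cases hib : i = b
            · subst hib; rw [X'b]; exact hZP'
            · rw [X'o i hir hib]; exact Finset.disjoint_of_subset_right hPA (h.disj i hi)
          out := by
            intro i hi x hx a ha
            by_cases hir : i = r
            · subst hir; rw [X'r] at hx; exact hZR x hx a ha
            by_cases hib : i = b
            · subst hib; rw [X'b] at hx; exact hZB x hx a ha
            · rw [X'o i hir hib] at hx; exact h.out i hi x hx a (hPA ha) }
      rw [sum_split hr hb hrb, X'r, X'b, p2, Finset.sum_congr rfl (g := fun i => (X i).card)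
        (fun i hi => by rw [X'o i (hmem0 i hi).2.1 (hmem0 i hi).2.2])] at this
      have e : l * (4 * 2 ^ (K.card - 2)) = 4 * (l * 2 ^ (K.card - 2)) := by ring
      have this2 : P.card + (Z.card + Z'.card + ∑ i ∈ K0, (X i).card) ≤ l * (4 * 2 ^ (K.card - 2)) := this
      omega
  rw [sum_split hr hb hrb, p2]
  have e : l * (4 * 2 ^ (K.card - 2)) = 4 * (l * 2 ^ (K.card - 2)) := by ring
  have goal' : A.card + ((X r).card + (X b).card + ∑ i ∈ K0, (X i).card) ≤ l * (4 * 2 ^ (K.card - 2)) := by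
    omega
  exact goal'

theorem Qfinal {col : V → V → α} [Fintype α] {l : ℕ}
    (hc : GalCol col) (hl : 2 ≤ l) (hl5 : l ≤ 5) (hV : l * 2 ^ Fintype.card α + 1 ≤ Fintype.card V) :
    ∃ i, MC (fun x y => col x y = i) Finset.univ (2 * l + 1) := by
  by_contra hno
  push Not at hno
  have := Qmain hc hno hl hl5 _ Finset.univ Finset.univ (fun _ => ∅) rfl
    ⟨fun _ _ _ _ _ => Finset.mem_univ _, by simp, by simp, by simp⟩
  simp only [Finset.card_empty, Finset.sum_const_zero, Finset.card_univ] at this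
  omega

end MainQ


section Lower

/-- first differing bit below `k`, or `k` -/
noncomputable def fdb (k a b : ℕ) : ℕ := sInf {j | a.testBit j ≠ b.testBit j ∨ j = k}

theorem fdb_le (k a b : ℕ) : fdb k a b ≤ k := Nat.sInf_le (Or.inr rfl)

theorem fdb_comm (k a b : ℕ) : fdb k a b = fdb k b a := by
  unfold fdb
  congr 1
  ext j
  simp [ne_comm]

theorem fdb_ne {k a b : ℕ} (h : fdb k a b < k) : a.testBit (fdb k a b) ≠ b.testBit (fdb k a b) := by
  have h1 : fdb k a b ∈ {j | a.testBit j ≠ b.testBit j ∨ j = k} := Nat.sInf_mem ⟨k, Or.inr rfl⟩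
  rcases h1 with h1 | h1
  · exact h1
  · exact absurd h1 (by omega)

theorem fdb_eq {k a b j : ℕ} (h : j < fdb k a b) : a.testBit j = b.testBit j := by
  by_contra hne
  have h1 : fdb k a b ≤ j := Nat.sInf_le (Or.inl hne)
  omega

theorem fdb_full {k a b : ℕ} (ha : a < 2 ^ k) (hb : b < 2 ^ k) (h : fdb k a b = k) : a = b := by
  apply Nat.eq_of_testBit_eq
  intro j
  by_cases hj : j < k
  · exact fdb_eq (k := k) (by omega)
  · have h2 : 2 ^ k ≤ 2 ^ j := Nat.pow_le_pow_right (by omega) (by omega)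
    rw [Nat.testBit_lt_two_pow (by omega), Nat.testBit_lt_two_pow (by omega)]

theorem fdb_tri {k a b c : ℕ} (h1 : fdb k a b < fdb k a c) (h2 : fdb k a b < fdb k b c) : False := by
  have h3 := fdb_le k a c
  have h4 := fdb_ne (lt_of_lt_of_le h1 h3)
  rw [fdb_eq h1, fdb_eq h2] at h4
  exact h4 rfl

theorem lower_bound (ℓ k : ℕ) (hℓ : 2 ≤ ℓ) :
    ¬ grProp (k + 1) (SimpleGraph.cycleGraph (2 * ℓ + 1)) (ℓ * 2 ^ (k + 1)) := by
  intro hgr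
  have hbound : ∀ v : Fin (ℓ * 2 ^ (k + 1)), v.val / (2 * ℓ) < 2 ^ k := by
    intro v
    rw [Nat.div_lt_iff_lt_mul (by omega)]
    have h1 := v.isLt
    have h2 : ℓ * 2 ^ (k + 1) = 2 ^ k * (2 * ℓ) := by rw [pow_succ]; ring
    omega
  let c : Sym2 (Fin (ℓ * 2 ^ (k + 1))) → Fin (k + 1) :=
    Sym2.lift ⟨fun x y => ⟨fdb k (x.val / (2 * ℓ)) (y.val / (2 * ℓ)), Nat.lt_succ_of_le (fdb_le _ _ _)⟩, by
      intro x y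
      simp only [Fin.mk.injEq]
      exact fdb_comm _ _ _⟩
  have hcv : ∀ x y, (c s(x, y)).val = fdb k (x.val / (2 * ℓ)) (y.val / (2 * ℓ)) := fun x y => rfl
  rcases hgr c with ⟨x, y, z, hxy, hxz, hyz, h1, h2, h3⟩ | ⟨i, f, hf⟩
  · simp only [ne_eq, Fin.ext_iff, hcv] at h1 h2 h3
    generalize x.val / (2 * ℓ) = a at *
    generalize y.val / (2 * ℓ) = b at *
    generalize z.val / (2 * ℓ) = d at *
    have t1 : ¬ (fdb k a b < fdb k a d ∧ fdb k a b < fdb k b d) := fun h => fdb_tri h.1 h.2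
    have t2 : ¬ (fdb k a d < fdb k a b ∧ fdb k a d < fdb k d b) := fun h => fdb_tri h.1 h.2
    have t3 : ¬ (fdb k b d < fdb k b a ∧ fdb k b d < fdb k d a) := fun h => fdb_tri h.1 h.2
    rw [fdb_comm k d b] at t2
    rw [fdb_comm k b a, fdb_comm k d a] at t3
    omega
  · have hf' : ∀ u v, (SimpleGraph.cycleGraph (2 * ℓ + 1)).Adj u v →
        fdb k ((f u).val / (2 * ℓ)) ((f v).val / (2 * ℓ)) = i.val := by
      intro u v huv
      rw [← hcv, hf u v huv]
    by_cases hi : i.val = k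
    · have hcon : ∀ u v, (f u).val / (2 * ℓ) = (f v).val / (2 * ℓ) := by
        intro u v
        obtain ⟨w⟩ := (SimpleGraph.cycleGraph_preconnected (n := 2 * ℓ + 1)) u v
        induction w with
        | nil => rfl
        | cons hadj w ih =>
          rw [← ih]
          exact fdb_full (hbound _) (hbound _) ((hf' _ _ hadj).trans hi)
      have hinj : Function.Injective (fun u : Fin (2 * ℓ + 1) =>
          (⟨(f u).val % (2 * ℓ), Nat.mod_lt _ (by omega)⟩ : Fin (2 * ℓ))) := by
        intro u v huv
        simp only [Fin.mk.injEq] at huv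
        apply f.injective
        apply Fin.ext
        rw [← Nat.div_add_mod (f u).val (2 * ℓ), ← Nat.div_add_mod (f v).val (2 * ℓ), huv, hcon u v]
      have := Fintype.card_le_of_injective _ hinj
      simp at this
    · have hik : i.val < k := by have := i.isLt; omega
      let C : (SimpleGraph.cycleGraph (2 * ℓ + 1)).Coloring Bool :=
        SimpleGraph.Coloring.mk (fun u => ((f u).val / (2 * ℓ)).testBit i.val) (by
          intro u v huv
          have h1 := hf' u v huv
          have h2 := fdb_ne (k := k) (a := (f u).val / (2 * ℓ)) (b := (f v).val / (2 * ℓ)) (by omega)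
          rw [h1] at h2
          exact h2)
      have h1 := C.colorable.chromaticNumber_le
      rw [SimpleGraph.chromaticNumber_cycleGraph_of_odd (2 * ℓ + 1) (by omega) ⟨ℓ, rfl⟩] at h1
      simp only [Fintype.card_bool] at h1
      exact absurd h1 (by decide)

theorem mono_of_MC {V α : Type*} [Fintype V] (c : Sym2 V → α) (i : α) {m : ℕ} (hm : 3 ≤ m)
    (h : MC (fun x y => c s(x, y) = i) Finset.univ m) :
    HasMonoCopyIn c (SimpleGraph.cycleGraph m) i := by
  obtain ⟨F, hF⟩ := h.exists_pcyc
  have key : ∀ u v : Fin m, (u - v).val = 1 → c s(F v.val, F u.val) = i := by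
    intro u v huv
    have h1 : u.val = v.val + 1 ∨ u.val + m = v.val + 1 := by
      have hu := u.isLt
      have hv := v.isLt
      rw [Fin.sub_def] at huv
      simp only at huv
      by_cases hle : v.val ≤ u.val
      · have e : m - v.val + u.val = (u.val - v.val) + m := by omega
        rw [e, Nat.add_mod_right, Nat.mod_eq_of_lt (by omega)] at huv
        omega
      · rw [Nat.mod_eq_of_lt (by omega)] at huv
        omega
    have h2 : F (v.val + 1) = F u.val := by
      rcases h1 with h1 | h1
      · congr 1; omega
      · rw [← hF.per u.val]; congr 1; omega
    have := hF.adj v.val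
    rw [h2] at this
    exact this
  refine ⟨⟨fun u => F u.val, ?_⟩, ?_⟩
  · intro u v huv
    have hu := u.isLt
    have hv := v.isLt
    apply Fin.ext
    by_contra hne
    rcases Nat.lt_or_gt_of_ne hne with h1 | h1
    · exact hF.ne (by omega) (by omega) huv
    · exact hF.ne (by omega) (by omega) huv.symm
  · intro u v huv
    rw [SimpleGraph.cycleGraph_adj'] at huv
    rcases huv with h1 | h1
    · rw [Sym2.eq_swap]; exact key u v h1
    · exact key v u h1

theorem upper_bound (ℓ k n : ℕ) (hℓ₁ : 2 ≤ ℓ) (hℓ₂ : ℓ ≤ 5) (hn : ℓ * 2 ^ k + 1 ≤ n) :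
    grProp k (SimpleGraph.cycleGraph (2 * ℓ + 1)) n := by
  intro c
  by_cases hr : HasRainbowTriangle c
  · exact Or.inl hr
  · right
    have hG : GalCol (fun x y : Fin n => c s(x, y)) := by
      refine ⟨fun x y => by simp only [Sym2.eq_swap], ?_⟩
      intro x y z h1 h2 h3
      by_contra hcon
      push Not at hcon
      exact hr ⟨x, y, z, h1, h2, h3, hcon.1, hcon.2.1, hcon.2.2⟩
    obtain ⟨i, hi⟩ := Qfinal hG hℓ₁ hℓ₂ (by simpa using hn)
    exact ⟨i, mono_of_MC c i (by omega) hi⟩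

end Lower

theorem gallai_ramsey_short_odd_cycles (ℓ k : ℕ) (hℓ₁ : 2 ≤ ℓ) (hℓ₂ : ℓ ≤ 5) (hk : 1 ≤ k) :
    gr k (cycleGraph (2 * ℓ + 1)) = ℓ * 2 ^ k + 1 := by
  obtain ⟨k, rfl⟩ : ∃ k', k = k' + 1 := ⟨k - 1, by omega⟩
  have hmem : ℓ * 2 ^ (k + 1) + 1 ∈ {N | ∀ n, N ≤ n → grProp (k + 1) (cycleGraph (2 * ℓ + 1)) n} :=
    fun n hn => upper_bound ℓ (k + 1) n hℓ₁ hℓ₂ hn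
  apply le_antisymm
  · exact Nat.sInf_le hmem
  · apply le_csInf ⟨_, hmem⟩
    intro N hN
    by_contra hlt
    exact lower_bound ℓ k hℓ₁ (hN _ (by omega))
end

section
/- Let G be a nonempty graph whose edges are each colored red or blue, and let a and b be non-negative integers with a + b ≥ 3. If for every vertex v of G the sum of its red degree and blue degree satisfies d_R(v) + d_B(v) ≥ a + b − 3, then G contains either a red path on a vertices or a blue path on b vertices. -/
open SimpleGraph

/-- Erdős–Gallai rotation step: a path whose ends have large degree closes to a cycle. -/
theorem eg_cycle {V : Type*} [DecidableEq V] (r : V → V → Prop) [DecidableRel r]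
    (hs : ∀ x y, r x y → r y x) (hi : ∀ x, ¬ r x x) (S : Finset V) (l : List V)
    (hne : l ≠ []) (hc : l.IsChain r)
    (h0 : ∀ x ∈ S, r (l.head hne) x → x ∈ l)
    (h1 : ∀ x ∈ S, r (l.getLast hne) x → x ∈ l)
    (hd : l.length ≤ (S.filter (r (l.head hne))).card + (S.filter (r (l.getLast hne))).card) :
    ∃ A B : List V, l.Perm (A ++ B) ∧ (A ++ B).IsChain r ∧
      ∃ (h : A ++ B ≠ []), r ((A ++ B).getLast h) ((A ++ B).head h) := by
  have hpos : 0 < l.length := List.length_pos_iff.2 hne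
  set u := l.head hne with hu
  set w := l.getLast hne with hw
  have hu0 : l[0] = u := by rw [hu, List.head_eq_getElem]
  have hw0 : l[l.length - 1] = w := by rw [hw, List.getLast_eq_getElem]
  set I := (Finset.range (l.length - 1)).filter (fun i => r u (l.getD (i+1) u)) with hI
  set J := (Finset.range (l.length - 1)).filter (fun i => r w (l.getD i u)) with hJ
  have cI : (S.filter (r u)).card ≤ I.card := by
    refine le_trans (Finset.card_le_card ?_) (Finset.card_image_le (s := I) (f := fun i => l.getD (i+1) u))
    intro x hx
    rw [Finset.mem_filter] at hx
    obtain ⟨i, hil, rfl⟩ := List.getElem_of_mem (h0 x hx.1 hx.2)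
    rcases i with _ | i
    · exact absurd hx.2 (by rw [hu0]; exact hi _)
    · refine Finset.mem_image.2 ⟨i, ?_, ?_⟩
      · rw [hI, Finset.mem_filter, Finset.mem_range, List.getD_eq_getElem _ _ hil]
        exact ⟨by omega, hx.2⟩
      · simp only [List.getD_eq_getElem _ _ hil]
  have cJ : (S.filter (r w)).card ≤ J.card := by
    refine le_trans (Finset.card_le_card ?_) (Finset.card_image_le (s := J) (f := fun i => l.getD i u))
    intro x hx
    rw [Finset.mem_filter] at hx
    obtain ⟨i, hil, rfl⟩ := List.getElem_of_mem (h1 x hx.1 hx.2)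
    by_cases hie : i = l.length - 1
    · subst hie
      exact absurd hx.2 (by rw [hw0]; exact hi _)
    · refine Finset.mem_image.2 ⟨i, ?_, ?_⟩
      · rw [hJ, Finset.mem_filter, Finset.mem_range, List.getD_eq_getElem _ _ hil]
        exact ⟨by omega, hx.2⟩
      · simp only [List.getD_eq_getElem _ _ hil]
  have hne' : (I ∩ J).Nonempty := by
    rw [← Finset.card_pos]
    have e := Finset.card_union_add_card_inter I J
    have : (I ∪ J).card ≤ l.length - 1 := by
      calc _ ≤ (Finset.range (l.length - 1)).card := Finset.card_le_card
            (Finset.union_subset (Finset.filter_subset _ _) (Finset.filter_subset _ _))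
        _ = _ := Finset.card_range _
    omega
  obtain ⟨i, hi'⟩ := hne'
  rw [Finset.mem_inter, hI, hJ, Finset.mem_filter, Finset.mem_filter, Finset.mem_range] at hi'
  obtain ⟨⟨hil, hri⟩, -, hrj⟩ := hi'
  rw [List.getD_eq_getElem _ _ (by omega)] at hri hrj
  have hcs : (l.take (i+1) ++ l.drop (i+1)).IsChain r := by rw [List.take_append_drop]; exact hc
  rw [List.isChain_append] at hcs
  have hdne : l.drop (i+1) ≠ [] := by
    rw [← List.length_pos_iff, List.length_drop]; omega
  have htne : l.take (i+1) ≠ [] := by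
    rw [← List.length_pos_iff, List.length_take]; omega
  have hrne : (l.drop (i+1)).reverse ≠ [] := by simpa using hdne
  refine ⟨l.take (i+1), (l.drop (i+1)).reverse, ?_, ?_, by simp [htne], ?_⟩
  · conv_lhs => rw [← List.take_append_drop (i+1) l]
    exact (List.reverse_perm _).symm.append_left _
  · rw [List.isChain_append]
    refine ⟨hcs.1, ?_, ?_⟩
    · rw [List.isChain_reverse]
      exact hcs.2.1.imp (fun a b h => hs _ _ h)
    · intro x hx y hy
      rw [List.getLast?_eq_getLast_of_ne_nil htne] at hx
      rw [List.head?_eq_some_head hrne] at hy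
      simp only [Option.mem_def, Option.some.injEq] at hx hy
      subst hx hy
      rw [List.head_reverse, List.getLast_drop, List.getLast_eq_getElem]
      simp only [List.getElem_take, List.length_take]
      apply hs
      convert hrj using 2
      omega
  · rw [List.getLast_append_of_ne_nil _ hrne, List.head_append_of_ne_nil htne, List.getLast_reverse,
      List.head_take, List.head_drop]
    exact hs _ _ hri

theorem eg_extend {V : Type*} (r : V → V → Prop)
    (l : List V) (hc : l.IsChain r) (h : l ≠ []) (hcl : r (l.getLast h) (l.head h))
    (x : V) (hx : x ∈ l) (w : V) (hwx : r w x) :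
    ∃ l' : List V, l'.Perm (w :: l) ∧ l'.IsChain r := by
  obtain ⟨A, B, rfl⟩ := List.append_of_mem hx
  refine ⟨w :: (x :: B ++ A), (List.perm_append_comm).cons w, ?_⟩
  rw [List.isChain_append] at hc
  rw [List.cons_append, List.isChain_cons_cons, ← List.cons_append, List.isChain_append]
  refine ⟨hwx, hc.2.1, hc.1, ?_⟩
  intro a ha b hb
  rcases A with _ | ⟨c, A⟩
  · simp at hb
  · rw [List.getLast_append_of_ne_nil _ (by simp)] at hcl
    rw [List.getLast?_eq_getLast_of_ne_nil (by simp)] at ha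
    simp at ha hb hcl
    subst ha hb
    exact hcl

theorem eg_bound {V : Type*} [DecidableEq V] (r : V → V → Prop) [DecidableRel r]
    (hs : ∀ x y, r x y → r y x) (hi : ∀ x, ¬ r x x) (K : ℕ)
    (hK : ∀ l : List V, l.Nodup → l.IsChain r → l.length ≤ K + 1) (n : ℕ) :
    ∀ S : Finset V, S.card = n → ∑ v ∈ S, (S.filter (r v)).card ≤ K * S.card := by
  induction n using Nat.strong_induction_on with
  | _ n ih =>
  intro S hS
  rcases S.eq_empty_or_nonempty with rfl | hSne
  · simp
  by_cases hlow : ∃ v ∈ S, 2 * (S.filter (r v)).card ≤ K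
  · obtain ⟨v, hv, hvd⟩ := hlow
    have hcard := Finset.card_erase_add_one hv
    have h1 := ih (S.erase v).card (by omega) (S.erase v) rfl
    have h2 : ∑ x ∈ S.erase v, (S.filter (r x)).card
        = ∑ x ∈ S.erase v, ((S.erase v).filter (r x)).card + (S.filter (r v)).card := by
      have : (S.filter (r v)).card = ∑ x ∈ S.erase v, if r x v then 1 else 0 := by
        rw [← Finset.card_filter]
        congr 1
        ext y
        simp only [Finset.mem_filter, Finset.mem_erase]
        constructor
        · rintro ⟨a, b⟩
          exact ⟨⟨by rintro rfl; exact hi _ b, a⟩, hs _ _ b⟩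
        · rintro ⟨⟨a, b⟩, c⟩
          exact ⟨b, hs _ _ c⟩
      rw [this, ← Finset.sum_add_distrib]
      refine Finset.sum_congr rfl fun x hx => ?_
      rw [Finset.filter_erase]
      split_ifs with h
      · rw [Finset.card_erase_add_one (by simp [hv, h])]
      · rw [Finset.erase_eq_of_notMem (by simp [h])]; rfl
    rw [← Finset.add_sum_erase _ _ hv, h2, ← hcard]
    nlinarith
  · push Not at hlow
    -- longest path inside S
    let P : ℕ → Prop := fun m => ∃ l : List V, l.Nodup ∧ l.IsChain r ∧ (∀ x ∈ l, x ∈ S) ∧ l.length = m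
    obtain ⟨v, hv⟩ := hSne
    have hP1 : P 1 := ⟨[v], by simp, by simp, by simpa using hv, rfl⟩
    classical
    obtain ⟨l, hnd, hc, hlS, hlen⟩ : P (Nat.findGreatest P (K+1)) :=
      Nat.findGreatest_spec (m := 1) (by omega) hP1
    have hmax : ∀ l' : List V, l'.Nodup → l'.IsChain r → (∀ x ∈ l', x ∈ S) → l'.length ≤ l.length := by
      intro l' a b c
      rw [hlen]
      exact Nat.le_findGreatest (hK l' a b) ⟨l', a, b, c, rfl⟩
    have hlK := hK l hnd hc
    have hpos : 0 < l.length := by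
      have := hmax [v] (by simp) (by simp) (by simpa using hv)
      simp only [List.length_singleton] at this
      omega
    have hne : l ≠ [] := List.length_pos_iff.1 hpos
    have h0 : ∀ x ∈ S, r (l.head hne) x → x ∈ l := by
      intro x hx hr
      by_contra hxl
      have := hmax (x :: l) (List.nodup_cons.2 ⟨hxl, hnd⟩)
        (by
          rw [List.isChain_cons]
          refine ⟨?_, hc⟩
          intro y hy
          rw [List.head?_eq_some_head hne] at hy
          simp only [Option.mem_def, Option.some.injEq] at hy
          subst hy
          exact hs _ _ hr)
        (by
          intro y hy
          rcases List.mem_cons.1 hy with rfl | hy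
          · exact hx
          · exact hlS y hy)
      simp at this
    have h1 : ∀ x ∈ S, r (l.getLast hne) x → x ∈ l := by
      intro x hx hr
      by_contra hxl
      have := hmax (x :: l.reverse) (List.nodup_cons.2 ⟨by simpa using hxl, List.nodup_reverse.2 hnd⟩)
        (by
          rw [List.isChain_cons]
          refine ⟨?_, ?_⟩
          · intro y hy
            rw [List.head?_reverse, List.getLast?_eq_getLast_of_ne_nil hne] at hy
            simp only [Option.mem_def, Option.some.injEq] at hy
            subst hy
            exact hs _ _ hr
          · rw [List.isChain_reverse]
            exact hc.imp (fun a b h => hs _ _ h))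
        (by
          intro y hy
          rcases List.mem_cons.1 hy with rfl | hy
          · exact hx
          · exact hlS y (by simpa using hy))
      simp at this
    have d0 := hlow _ (hlS _ (List.head_mem hne))
    have d1 := hlow _ (hlS _ (List.getLast_mem hne))
    obtain ⟨A, B, hperm, hch, hABne, hcl⟩ := eg_cycle r hs hi S l hne hc h0 h1 (by omega)
    -- no edges leave the cycle
    have hclosed : ∀ x ∈ l, ∀ y ∈ S, r x y → y ∈ l := by
      intro x hx y hy hr
      by_contra hyl
      obtain ⟨l', hp', hc'⟩ := eg_extend r (A ++ B) hch hABne hcl x (hperm.mem_iff.1 hx) y (hs _ _ hr)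
      have hp2 : l'.Perm (y :: l) := hp'.trans (hperm.symm.cons y)
      have := hmax l' (hp2.nodup_iff.2 (List.nodup_cons.2 ⟨hyl, hnd⟩)) hc'
        (by
          intro z hz
          rcases List.mem_cons.1 (hp2.mem_iff.1 hz) with rfl | hz
          · exact hy
          · exact hlS z hz)
      rw [hp2.length_eq] at this
      simp at this
    set C := l.toFinset with hC
    have hCS : C ⊆ S := fun x hx => hlS x (List.mem_toFinset.1 hx)
    have hCc : C.card = l.length := List.toFinset_card_of_nodup hnd
    have hsd := Finset.card_sdiff_add_card_eq_card hCS
    have e1 := ih (S \ C).card (by omega) (S \ C) rfl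
    have e2 : ∑ x ∈ S \ C, (S.filter (r x)).card = ∑ x ∈ S \ C, ((S \ C).filter (r x)).card := by
      refine Finset.sum_congr rfl fun x hx => ?_
      congr 1
      ext y
      simp only [Finset.mem_filter, Finset.mem_sdiff] at hx ⊢
      constructor
      · rintro ⟨a, b⟩
        refine ⟨⟨a, fun hyC => hx.2 ?_⟩, b⟩
        exact List.mem_toFinset.2 (hclosed y (List.mem_toFinset.1 hyC) x hx.1 (hs _ _ b))
      · rintro ⟨⟨a, _⟩, b⟩
        exact ⟨a, b⟩
    have e3 : ∑ x ∈ C, (S.filter (r x)).card ≤ C.card * K := by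
      rw [← smul_eq_mul]
      refine Finset.sum_le_card_nsmul _ _ _ fun x hx => ?_
      have : S.filter (r x) ⊆ C.erase x := by
        intro y hy
        rw [Finset.mem_filter] at hy
        refine Finset.mem_erase.2 ⟨by rintro rfl; exact hi _ hy.2, ?_⟩
        exact List.mem_toFinset.2 (hclosed x (List.mem_toFinset.1 hx) y hy.1 hy.2)
      have := Finset.card_le_card this
      have := Finset.card_erase_add_one hx
      omega
    rw [← Finset.sum_sdiff hCS, e2, ← hsd]
    nlinarith

theorem eg_color {V : Type*} [Fintype V] [DecidableEq V]
    (G : SimpleGraph V) [DecidableRel G.Adj] (c : Sym2 V → Fin 2) (i : Fin 2) (K : ℕ)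
    (h : ¬ ∃ f : Fin (K+2) ↪ V, ∀ u v, (pathGraph (K+2)).Adj u v →
      G.Adj (f u) (f v) ∧ c s(f u, f v) = i) :
    ∑ v : V, (Finset.univ.filter fun u => G.Adj v u ∧ c s(v, u) = i).card ≤ K * Fintype.card V := by
  have hsym : ∀ x y, (G.Adj x y ∧ c s(x, y) = i) → (G.Adj y x ∧ c s(y, x) = i) := by
    rintro x y ⟨a, b⟩
    exact ⟨a.symm, by rw [Sym2.eq_swap]; exact b⟩
  refine eg_bound (fun v u => G.Adj v u ∧ c s(v, u) = i) hsym
    (fun x hx => G.loopless.irrefl x hx.1) K ?_ _ Finset.univ rfl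
  intro l hnd hc
  by_contra hl
  push Not at hl
  apply h
  rw [List.isChain_iff_getElem] at hc
  refine ⟨⟨fun j => l[j.1]'(by omega), ?_⟩, ?_⟩
  · intro j k hjk
    exact Fin.ext ((hnd.getElem_inj_iff).1 hjk)
  · intro u v huv
    rw [pathGraph_adj] at huv
    obtain ⟨u, hu⟩ := u
    obtain ⟨v, hv⟩ := v
    simp only [Function.Embedding.coeFn_mk] at huv ⊢
    rcases huv with rfl | rfl
    · exact hc u (by omega)
    · exact hsym _ _ (hc v (by omega))

theorem colored_erdos_gallai {V : Type*} [Fintype V] [DecidableEq V] [Nonempty V]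
    (G : SimpleGraph V) [DecidableRel G.Adj] (c : Sym2 V → Fin 2)
    (a b : ℕ) (hab : 3 ≤ a + b)
    (hdeg : ∀ v : V, a + b - 3 ≤
      (Finset.univ.filter fun u => G.Adj v u ∧ c s(v, u) = 0).card +
      (Finset.univ.filter fun u => G.Adj v u ∧ c s(v, u) = 1).card) :
    (∃ f : Fin a ↪ V, ∀ u v, (pathGraph a).Adj u v → G.Adj (f u) (f v) ∧ c s(f u, f v) = 0) ∨
    (∃ f : Fin b ↪ V, ∀ u v, (pathGraph b).Adj u v → G.Adj (f u) (f v) ∧ c s(f u, f v) = 1) := by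
  rcases a with _ | _ | K
  · exact Or.inl ⟨⟨fun j => j.elim0, fun j => j.elim0⟩, fun j => j.elim0⟩
  · left
    obtain ⟨v⟩ := ‹Nonempty V›
    refine ⟨⟨fun _ => v, fun j k _ => Subsingleton.elim (α := Fin 1) j k⟩, fun j k h => ?_⟩
    have : j = k := Subsingleton.elim (α := Fin 1) j k
    exact absurd this h.ne
  rcases b with _ | _ | L
  · exact Or.inr ⟨⟨fun j => j.elim0, fun j => j.elim0⟩, fun j => j.elim0⟩
  · right
    obtain ⟨v⟩ := ‹Nonempty V›
    refine ⟨⟨fun _ => v, fun j k _ => Subsingleton.elim (α := Fin 1) j k⟩, fun j k h => ?_⟩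
    have : j = k := Subsingleton.elim (α := Fin 1) j k
    exact absurd this h.ne
  by_contra hcon
  rw [not_or] at hcon
  have e0 := eg_color G c 0 K hcon.1
  have e1 := eg_color G c 1 L hcon.2
  have e2 := Finset.card_nsmul_le_sum Finset.univ _ _ (fun v _ => hdeg v)
  rw [Finset.sum_add_distrib, smul_eq_mul, Finset.card_univ] at e2
  have hp : 0 < Fintype.card V := Fintype.card_pos
  have e3 : K + 1 + 1 + (L + 1 + 1) - 3 = K + L + 1 := by omega
  rw [e3] at e2
  nlinarith
end
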